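/- arXiv:2001.02827 — 3 statements merged into one kernel-verified Lean document; each statement's English description precedes it below -/
import Mathlib

section
/- Let (X, Π) be a weighted pure H-dimensional simplicial complex such that γ_j ≤ 1/2 for all 0 ≤ j ≤ H−2 and 1 − γ_{−1} ≥ c for some c > 0. Then for every 0 ≤ j ≤ H−2, λ₂(P∨_{j+1}) = λ₂(P∧_j) ≤ 1 − c / ((j+2) · 2^j). -/
open Finset

/-- A weighted pure `d`-dimensional simplicial complex on a finite ground set `V`.
Faces are finsets; a face of cardinality `m` has dimension `m - 1` (so `X(j)` is the
set of faces of cardinality `j + 1`).  The family of faces is downward closed, every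
face is contained in a face of cardinality `d + 1` (purity), and a probability
distribution `Π = Π_d` (positive weights summing to `1`) is given on the
top-dimensional faces. -/
structure WSC (V : Type*) [DecidableEq V] [Fintype V] (d : ℕ) where
  faces : Finset (Finset V)
  empty_mem : ∅ ∈ faces
  down_closed : ∀ β ∈ faces, ∀ α ⊆ β, α ∈ faces
  pure : ∀ α ∈ faces, ∃ β ∈ faces, α ⊆ β ∧ β.card = d + 1
  dim_le : ∀ α ∈ faces, α.card ≤ d + 1
  weight : Finset V → ℝ
  weight_pos : ∀ β ∈ faces, β.card = d + 1 → 0 < weight β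
  weight_zero : ∀ β : Finset V, β ∉ faces ∨ β.card ≠ d + 1 → weight β = 0
  weight_sum : ∑ β ∈ faces.filter (fun β => β.card = d + 1), weight β = 1

namespace WSC

variable {V : Type*} [DecidableEq V] [Fintype V] {d : ℕ}

/-- Auxiliary recursion for the marginal distributions: `Waux X t` is the marginal
distribution `Π_{d - t}` on faces of cardinality `d + 1 - t`, defined by
`Π_j(α) = (1/(j+2)) ∑_{β ∈ X(j+1), β ⊇ α} Π_{j+1}(β)`. -/
noncomputable def Waux (X : WSC V d) : ℕ → Finset V → ℝ
  | 0 => X.weight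
  | (t + 1) => fun α =>
      (1 / ((d + 1 - t : ℕ) : ℝ)) *
        ∑ β ∈ X.faces.filter (fun β => α ⊆ β ∧ β.card = d + 1 - t), X.Waux t β

/-- `X.W m α` is the marginal probability `Π_{m-1}(α)` of the face `α` of cardinality
`m` (dimension `m - 1`). -/
noncomputable def W (X : WSC V d) (m : ℕ) : Finset V → ℝ := X.Waux (d + 1 - m)

/-- The inner product `⟨f, g⟩_{Π_{m-1}}` on `ℝ^{X(m-1)}` (faces of cardinality `m`). -/
noncomputable def inn (X : WSC V d) (m : ℕ) (f g : Finset V → ℝ) : ℝ :=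
  ∑ α ∈ X.faces.filter (fun α => α.card = m), X.W m α * f α * g α

/-- The up operator `U_j`: `(U_j f)(β) = (1/(j+2)) ∑_{x ∈ β} f(β \ {x})`, for `β` of
cardinality `j + 2`.  (The formula is uniform in the cardinality of `β`.) -/
noncomputable def upOp (f : Finset V → ℝ) : Finset V → ℝ :=
  fun β => (1 / (β.card : ℝ)) * ∑ x ∈ β, f (β.erase x)

/-- The down operator `D_{j+1}`:
`(D_{j+1} g)(α) = ∑_{β ∈ X(j+1), β ⊇ α} Π_{j+1}(β) g(β) / ((j+2) Π_j(α))`, for `α` of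
cardinality `j + 1`.  (The formula is uniform in the cardinality of `α`.) -/
noncomputable def downOp (X : WSC V d) (g : Finset V → ℝ) : Finset V → ℝ :=
  fun α => ∑ β ∈ X.faces.filter (fun β => α ⊆ β ∧ β.card = α.card + 1),
      (X.W (α.card + 1) β * g β) / (((α.card : ℝ) + 1) * X.W α.card α)

/-- The down-up walk `P∨_k = U_{k-1} D_k`, acting on functions on `X(k)` (faces of
cardinality `k + 1`). -/
noncomputable def downUp (X : WSC V d) (f : Finset V → ℝ) : Finset V → ℝ :=
  upOp (X.downOp f)

/-- The up-down walk `P∧_k = D_{k+1} U_k`, acting on functions on `X(k)` (faces of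
cardinality `k + 1`). -/
noncomputable def upDown (X : WSC V d) (f : Finset V → ℝ) : Finset V → ℝ :=
  X.downOp (upOp f)

/-- The `k`-th non-lazy up-down walk `N_k = ((k+2)/(k+1)) (P∧_k - (1/(k+2)) I)`. -/
noncomputable def nonLazy (X : WSC V d) (k : ℕ) (f : Finset V → ℝ) : Finset V → ℝ :=
  fun α => (((k : ℝ) + 2) / ((k : ℝ) + 1)) * (X.upDown f α - (1 / ((k : ℝ) + 2)) * f α)

/-- The up-down walk `U_{a,b} = D_{a+1} ⋯ D_b · U_{b-1} ⋯ U_a` on `X(a)` through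
`X(b)`, where `t = b - a`. -/
noncomputable def upDownAB (X : WSC V d) (t : ℕ) (f : Finset V → ℝ) : Finset V → ℝ :=
  (X.downOp)^[t] (upOp^[t] f)

/-- The second largest eigenvalue of a row-stochastic operator `M` on `ℝ^{X(m-1)}`
(faces of cardinality `m`) which is self-adjoint with respect to `⟨·,·⟩_{Π_{m-1}}`
and has stationary distribution `Π_{m-1}`: by the variational principle it is the
supremum of the Rayleigh quotients of (nonzero) functions orthogonal to the
constant function `1`. -/
noncomputable def lam2 (X : WSC V d) (m : ℕ) (M : (Finset V → ℝ) → Finset V → ℝ) : ℝ :=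
  sSup { r : ℝ | ∃ f : Finset V → ℝ,
    X.inn m f (fun _ => 1) = 0 ∧ X.inn m f f ≠ 0 ∧
    r = X.inn m f (M f) / X.inn m f f }

/-- The vertices of the link `X_α`: those `x ∉ α` with `α ∪ {x} ∈ X`. -/
def linkVerts (X : WSC V d) (α : Finset V) : Finset V :=
  Finset.univ.filter (fun x => x ∉ α ∧ insert x α ∈ X.faces)

/-- The link distribution `Π^α_l(τ) = Π_{j+1+l}(α ∪ τ) / (C(|α ∪ τ|, |α|) · Π_j(α))`
for a face `α` of dimension `j` and `τ ∈ X_α(l)`. -/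
noncomputable def linkPi (X : WSC V d) (α τ : Finset V) : ℝ :=
  X.W (α ∪ τ).card (α ∪ τ) / ((Nat.choose (α ∪ τ).card α.card : ℝ) * X.W α.card α)

/-- The random walk matrix `M_α` of the graph of the link `X_α`, with entries
`M_α(x, y) = Π^α_1({x, y}) / (2 Π^α_0(x))` for `{x, y} ∈ X_α(1)` and `0` otherwise,
viewed as an operator on functions on the vertices of the link. -/
noncomputable def linkWalk (X : WSC V d) (α : Finset V) (f : V → ℝ) : V → ℝ :=
  fun x => ∑ y ∈ (X.linkVerts α).filter
      (fun y => y ≠ x ∧ insert y (insert x α) ∈ X.faces),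
    (X.linkPi α {x, y} / (2 * X.linkPi α {x})) * f y

/-- The projector `J_α` onto the constant functions on the link: `J_α g` is the
constant function with value `E_{x ∼ Π^α_0}[g(x)]`. -/
noncomputable def linkJ (X : WSC V d) (α : Finset V) (g : V → ℝ) : V → ℝ :=
  fun _ => ∑ x ∈ X.linkVerts α, X.linkPi α {x} * g x

/-- The inner product `⟨g, h⟩_{Π^α_0}` on functions on the vertices of the link. -/
noncomputable def linkInner (X : WSC V d) (α : Finset V) (g h : V → ℝ) : ℝ :=
  ∑ x ∈ X.linkVerts α, X.linkPi α {x} * g x * h x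

/-- The second largest eigenvalue `λ₂(M_α)` of the random walk matrix of the graph
of the link `X_α`, via the variational principle. -/
noncomputable def linkLam2 (X : WSC V d) (α : Finset V) : ℝ :=
  sSup { r : ℝ | ∃ f : V → ℝ,
    X.linkInner α f (fun _ => 1) = 0 ∧ X.linkInner α f f ≠ 0 ∧
    r = X.linkInner α f (X.linkWalk α f) / X.linkInner α f f }

/-- `X.gammaC m` is `γ_{m-1} = max_{α ∈ X(m-1)} λ₂(M_α)`, the maximum over faces `α`
of cardinality `m` (dimension `m - 1`) of the second eigenvalue of the link walk. -/
noncomputable def gammaC (X : WSC V d) (m : ℕ) : ℝ :=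
  sSup { r : ℝ | ∃ α ∈ X.faces, α.card = m ∧ r = X.linkLam2 α }

end WSC

namespace WSC

variable {V : Type*} [DecidableEq V] [Fintype V] {d : ℕ}

/-- Reindexing pairs (face, vertex in it). -/
lemma sum_insert_erase (m : ℕ) (F : Finset V → V → ℝ) :
    ∑ β ∈ (univ : Finset V).powersetCard (m + 1), ∑ x ∈ β, F β x =
      ∑ α ∈ (univ : Finset V).powersetCard m, ∑ x ∈ αᶜ, F (insert x α) x := by
  rw [Finset.sum_sigma', Finset.sum_sigma']
  refine Finset.sum_bij' (fun p _ => ⟨p.1.erase p.2, p.2⟩) (fun p _ => ⟨insert p.2 p.1, p.2⟩)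
    ?_ ?_ ?_ ?_ ?_
  · rintro ⟨β, x⟩ h
    simp only [mem_sigma, mem_powersetCard_univ, mem_compl] at h ⊢
    refine ⟨?_, by simp⟩
    rw [card_erase_of_mem h.2, h.1]; rfl
  · rintro ⟨β, x⟩ h
    simp only [mem_sigma, mem_powersetCard_univ, mem_compl] at h ⊢
    refine ⟨?_, by simp⟩
    rw [card_insert_of_notMem h.2, h.1]
  · rintro ⟨β, x⟩ h
    simp only [mem_sigma] at h
    simp [insert_erase h.2]
  · rintro ⟨β, x⟩ h
    simp only [mem_sigma, mem_compl] at h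
    simp [erase_insert h.2]
  · rintro ⟨β, x⟩ h
    simp only [mem_sigma] at h
    simp [insert_erase h.2]

lemma sum_supersets (X : WSC V d) (α : Finset V) (F : Finset V → ℝ) (m : ℕ) (hm : α.card = m)
    (hF : ∀ β, β ∉ X.faces → F β = 0) :
    ∑ β ∈ X.faces.filter (fun β => α ⊆ β ∧ β.card = m + 1), F β =
      ∑ x ∈ αᶜ, F (insert x α) := by
  have h1 : ∑ β ∈ X.faces.filter (fun β => α ⊆ β ∧ β.card = m + 1), F β =
      ∑ β ∈ univ.filter (fun β => α ⊆ β ∧ β.card = m + 1), F β := by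
    refine Finset.sum_subset ?_ ?_
    · intro β; simp
    · intro β hβ hβ'
      apply hF
      intro h
      simp at hβ hβ'
      exact hβ' h hβ.1 hβ.2
  have h2 : univ.filter (fun β => α ⊆ β ∧ β.card = m + 1) = αᶜ.image (fun x => insert x α) := by
    ext β
    simp only [mem_filter, mem_univ, true_and, mem_image, mem_compl]
    constructor
    · rintro ⟨h, hc⟩
      have : (β \ α).card = 1 := by
        rw [card_sdiff_of_subset h]; omega
      obtain ⟨x, hx⟩ := card_eq_one.1 this
      have hx' : x ∈ β \ α := by rw [hx]; simp
      refine ⟨x, (mem_sdiff.1 hx').2, ?_⟩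
      rw [← sdiff_union_of_subset h, hx]; rfl
    · rintro ⟨x, hx, rfl⟩
      exact ⟨subset_insert _ _, by rw [card_insert_of_notMem hx, hm]⟩
  rw [h1, h2, Finset.sum_image]
  intro x hx y hy hxy
  simp only [coe_compl, Set.mem_compl_iff, mem_coe] at hx hy
  have : x ∈ insert y α := by
    have h : insert x α = insert y α := hxy
    rw [← h]; simp
  simpa [hx] using this

lemma W_zero (X : WSC V d) (m : ℕ) (α : Finset V) (h : α ∉ X.faces) : X.W m α = 0 := by
  unfold W
  cases (d + 1 - m) with
  | zero => exact X.weight_zero α (Or.inl h)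
  | succ t =>
    simp only [Waux]
    rw [Finset.sum_eq_zero, mul_zero]
    intro β hβ
    simp only [mem_filter] at hβ
    exact absurd (X.down_closed β hβ.1 α hβ.2.1) h

lemma W_rec (X : WSC V d) (m : ℕ) (hm : m ≤ d) (α : Finset V) (hα : α.card = m) :
    ((m : ℝ) + 1) * X.W m α = ∑ x ∈ αᶜ, X.W (m + 1) (insert x α) := by
  rw [← sum_supersets X α (X.W (m + 1)) m hα (fun β h => X.W_zero _ _ h)]
  have e : d + 1 - m = (d - m) + 1 := by omega
  have e2 : d + 1 - (d - m) = m + 1 := by omega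
  have e3 : d + 1 - (m + 1) = d - m := by omega
  unfold W
  rw [e, e3]
  simp only [Waux]
  rw [e2, ← mul_assoc]
  push_cast
  rw [mul_one_div_cancel (by positivity), one_mul]

lemma W_pos_aux (X : WSC V d) : ∀ t m : ℕ, m + t = d + 1 → ∀ α ∈ X.faces, α.card = m →
    0 < X.W m α := by
  intro t
  induction t with
  | zero =>
    intro m hm α hα hc
    have : d + 1 - m = 0 := by omega
    unfold W
    rw [this]
    exact X.weight_pos α hα (by omega)
  | succ t ih =>
    intro m hm α hα hc
    have h := X.W_rec m (by omega) α hc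
    have hpos : 0 < ∑ x ∈ αᶜ, X.W (m + 1) (insert x α) := by
      apply Finset.sum_pos'
      · intro x hx
        by_cases hf : insert x α ∈ X.faces
        · exact (ih (m + 1) (by omega) _ hf
            (by rw [card_insert_of_notMem (by simpa using hx), hc])).le
        · rw [X.W_zero _ _ hf]
      · obtain ⟨β, hβ, hs, hcard⟩ := X.pure α hα
        have : (β \ α).Nonempty := by
          rw [← card_pos, card_sdiff_of_subset hs]; omega
        obtain ⟨x, hx⟩ := this
        rw [mem_sdiff] at hx
        refine ⟨x, by simpa using hx.2, ?_⟩
        refine ih (m + 1) (by omega) _ (X.down_closed β hβ _ ?_)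
            (by rw [card_insert_of_notMem hx.2, hc])
        exact insert_subset hx.1 hs
    rw [← h] at hpos
    exact pos_of_mul_pos_right hpos (by positivity)

lemma W_pos (X : WSC V d) (α : Finset V) (hα : α ∈ X.faces) : 0 < X.W α.card α :=
  X.W_pos_aux (d + 1 - α.card) α.card (by have := X.dim_le α hα; omega) α hα rfl

lemma W_nonneg (X : WSC V d) (m : ℕ) (α : Finset V) (hα : α.card = m) : 0 ≤ X.W m α := by
  by_cases h : α ∈ X.faces
  · subst hα; exact (X.W_pos α h).le
  · rw [X.W_zero _ _ h]

lemma inn_eq (X : WSC V d) (m : ℕ) (f g : Finset V → ℝ) :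
    X.inn m f g = ∑ α ∈ (univ : Finset V).powersetCard m, X.W m α * f α * g α := by
  unfold inn
  refine Finset.sum_subset ?_ ?_
  · intro α; simp
  · intro α h1 h2
    have : α ∉ X.faces := by
      intro h; simp at h1 h2; exact h2 h h1
    rw [X.W_zero _ _ this]; ring

lemma W_downOp (X : WSC V d) (m : ℕ) (g : Finset V → ℝ) (α : Finset V)
    (hα : α.card = m) :
    ((m : ℝ) + 1) * X.W m α * X.downOp g α =
      ∑ x ∈ αᶜ, X.W (m + 1) (insert x α) * g (insert x α) := by
  by_cases h : α ∈ X.faces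
  · have hp := X.W_pos α h
    unfold downOp
    rw [← Finset.sum_div, hα] 
    rw [hα] at hp
    rw [sum_supersets X α (fun β => X.W (m + 1) β * g β) m hα
      (fun β h => by rw [X.W_zero _ _ h, zero_mul])]
    field_simp
  · rw [X.W_zero _ _ h, Finset.sum_eq_zero]
    · ring
    · intro x _
      rw [X.W_zero _ _ (fun h' => h (X.down_closed _ h' α (subset_insert _ _)))]; ring

lemma adj (X : WSC V d) (m : ℕ) (f g : Finset V → ℝ) :
    X.inn m f (X.downOp g) = X.inn (m + 1) (upOp f) g := by
  rw [inn_eq, inn_eq]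
  have h2 : ∀ β ∈ (univ : Finset V).powersetCard (m + 1),
      X.W (m + 1) β * upOp f β * g β =
        ∑ x ∈ β, (1 / ((m : ℝ) + 1)) * (X.W (m + 1) β * g β * f (β.erase x)) := by
    intro β hβ
    rw [mem_powersetCard_univ] at hβ
    unfold upOp
    rw [hβ, ← Finset.mul_sum, ← Finset.mul_sum]
    push_cast
    ring
  rw [Finset.sum_congr rfl h2, sum_insert_erase]
  refine Finset.sum_congr rfl ?_
  intro α hα
  rw [mem_powersetCard_univ] at hα
  have h3 : ∀ x ∈ αᶜ, (1 / ((m : ℝ) + 1)) * (X.W (m + 1) (insert x α) * g (insert x α) *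
      f ((insert x α).erase x)) =
      (X.W (m + 1) (insert x α) * g (insert x α)) * ((1 / ((m : ℝ) + 1)) * f α) := by
    intro x hx
    rw [erase_insert (by simpa using hx)]; ring
  rw [Finset.sum_congr rfl h3, ← Finset.sum_mul, ← X.W_downOp m g α hα]
  field_simp

lemma inn_comm (X : WSC V d) (m : ℕ) (f g : Finset V → ℝ) : X.inn m f g = X.inn m g f := by
  unfold inn
  refine Finset.sum_congr rfl fun α _ => by ring

lemma inn_self_nonneg (X : WSC V d) (m : ℕ) (f : Finset V → ℝ) : 0 ≤ X.inn m f f := by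
  rw [inn_eq]
  refine Finset.sum_nonneg fun α hα => ?_
  rw [mem_powersetCard_univ] at hα
  rw [mul_assoc]
  exact mul_nonneg (X.W_nonneg m α hα) (mul_self_nonneg _)

lemma inn_cs (X : WSC V d) (m : ℕ) (f g : Finset V → ℝ) :
    X.inn m f g ^ 2 ≤ X.inn m f f * X.inn m g g := by
  simp only [inn_eq]
  have := Finset.sum_mul_sq_le_sq_mul_sq ((univ : Finset V).powersetCard m)
    (fun α => Real.sqrt (X.W m α) * f α) (fun α => Real.sqrt (X.W m α) * g α)
  have e : ∀ f g : Finset V → ℝ, ∑ α ∈ (univ : Finset V).powersetCard m, X.W m α * f α * g α =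
      ∑ α ∈ (univ : Finset V).powersetCard m,
        (Real.sqrt (X.W m α) * f α) * (Real.sqrt (X.W m α) * g α) := by
    intro f g
    refine Finset.sum_congr rfl fun α hα => ?_
    rw [mem_powersetCard_univ] at hα
    have := Real.mul_self_sqrt (X.W_nonneg m α hα)
    linear_combination (-f α * g α) * this
  rw [e, e, e]
  simpa [sq] using this

lemma inn_downOp_one (X : WSC V d) (m : ℕ) (hm : m ≤ d) (f : Finset V → ℝ) :
    X.inn (m + 1) (upOp f) (fun _ => 1) = X.inn m f (fun _ => 1) := by
  rw [← adj, inn_eq, inn_eq]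
  refine Finset.sum_congr rfl fun α hα => ?_
  rw [mem_powersetCard_univ] at hα
  have h1 := X.W_downOp m (fun _ => 1) α hα
  have h2 := X.W_rec m hm α hα
  simp only [mul_one] at h1
  rw [← h2] at h1
  have h3 : X.W m α * X.downOp (fun _ => 1) α = X.W m α := by
    have : ((m : ℝ) + 1) ≠ 0 := by positivity
    apply mul_left_cancel₀ this
    linarith
  linear_combination (f α) * h3

lemma inn_upOp_one (X : WSC V d) (m : ℕ) (f : Finset V → ℝ) :
    X.inn m (X.downOp f) (fun _ => 1) = X.inn (m + 1) f (fun _ => 1) := by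
  rw [inn_comm, adj, inn_comm, inn_eq, inn_eq]
  refine Finset.sum_congr rfl fun α hα => ?_
  rw [mem_powersetCard_univ] at hα
  have : upOp (fun _ => (1 : ℝ)) α = 1 := by
    unfold upOp
    rw [hα]
    simp [hα]
    field_simp
  rw [this]

lemma inn_downUp (X : WSC V d) (m : ℕ) (f : Finset V → ℝ) :
    X.inn (m + 1) f (X.downUp f) = X.inn m (X.downOp f) (X.downOp f) := by
  rw [adj, inn_comm]; rfl

lemma inn_upDown (X : WSC V d) (m : ℕ) (f : Finset V → ℝ) :
    X.inn m f (X.upDown f) = X.inn (m + 1) (upOp f) (upOp f) := adj _ _ _ _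

lemma down_of_up (X : WSC V d) (m : ℕ) (a : ℝ) (ha : 0 ≤ a)
    (h : ∀ f, X.inn m f (fun _ => 1) = 0 →
      X.inn (m + 1) (upOp f) (upOp f) ≤ a * X.inn m f f) (f : Finset V → ℝ)
    (hf : X.inn (m + 1) f (fun _ => 1) = 0) :
    X.inn m (X.downOp f) (X.downOp f) ≤ a * X.inn (m + 1) f f := by
  have h1 := h (X.downOp f) (by rw [inn_upOp_one, hf])
  have h2 := X.inn_cs (m + 1) (upOp (X.downOp f)) f
  rw [← adj] at h2
  have hn := X.inn_self_nonneg m (X.downOp f)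
  have hn2 := X.inn_self_nonneg (m + 1) f
  rcases hn.eq_or_lt with h0 | h0
  · rw [← h0]; positivity
  · have h3 := h2.trans (mul_le_mul_of_nonneg_right h1 hn2)
    nlinarith

lemma up_of_down (X : WSC V d) (m : ℕ) (hm : m ≤ d) (a : ℝ) (ha : 0 ≤ a)
    (h : ∀ f, X.inn (m + 1) f (fun _ => 1) = 0 →
      X.inn m (X.downOp f) (X.downOp f) ≤ a * X.inn (m + 1) f f) (f : Finset V → ℝ)
    (hf : X.inn m f (fun _ => 1) = 0) :
    X.inn (m + 1) (upOp f) (upOp f) ≤ a * X.inn m f f := by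
  have h1 := h (upOp f) (by rw [inn_downOp_one _ _ hm, hf])
  have h2 := X.inn_cs m f (X.downOp (upOp f))
  rw [adj] at h2
  have hn := X.inn_self_nonneg (m + 1) (upOp f)
  have hn2 := X.inn_self_nonneg m f
  rcases hn.eq_or_lt with h0 | h0
  · rw [← h0]; positivity
  · have h3 := h2.trans (mul_le_mul_of_nonneg_left h1 hn2)
    nlinarith

end WSC

namespace WSC

section graph
variable {V : Type*} [Fintype V]

lemma graph_bound (p : V → ℝ) (q : V → V → ℝ) (hq : ∀ x y, 0 ≤ q x y)
    (hs : ∀ x y, q x y = q y x) (hm : ∀ x, ∑ y, q x y = p x) (f : V → ℝ) (e : ℝ)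
    (he : e ^ 2 = 1) :
    e * ∑ x, ∑ y, q x y * f x * f y ≤ ∑ x, p x * f x * f x := by
  have h1 : ∑ x, p x * f x * f x = ∑ x, ∑ y, q x y * f x * f x := by
    refine Finset.sum_congr rfl fun x _ => ?_
    rw [← hm x, Finset.sum_mul, Finset.sum_mul]
  have h2 : ∑ x, p x * f x * f x = ∑ x, ∑ y, q x y * f y * f y := by
    rw [Finset.sum_comm, h1]
    refine Finset.sum_congr rfl fun x _ => Finset.sum_congr rfl fun y _ => ?_
    rw [hs]
  have h3 : 0 ≤ ∑ x, ∑ y, q x y * (f x - e * f y) ^ 2 :=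
    Finset.sum_nonneg fun x _ => Finset.sum_nonneg fun y _ =>
      mul_nonneg (hq x y) (sq_nonneg _)
  have h4 : ∑ x, ∑ y, q x y * (f x - e * f y) ^ 2 =
      (∑ x, ∑ y, q x y * f x * f x) + (∑ x, ∑ y, q x y * f y * f y)
        - 2 * (e * ∑ x, ∑ y, q x y * f x * f y) := by
    simp only [Finset.mul_sum, ← Finset.sum_add_distrib, ← Finset.sum_sub_distrib]
    refine Finset.sum_congr rfl fun x _ => Finset.sum_congr rfl fun y _ => ?_
    linear_combination (q x y * f y * f y) * he
  rw [h4, ← h1, ← h2] at h3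
  linarith

lemma graph_shift (p : V → ℝ) (q : V → V → ℝ) (hq : ∀ x y, 0 ≤ q x y)
    (hs : ∀ x y, q x y = q y x) (hm : ∀ x, ∑ y, q x y = p x) (h1 : ∑ x, p x = 1) (a : ℝ)
    (ha : ∀ f : V → ℝ, ∑ x, p x * f x = 0 → ∑ x, p x * f x * f x ≠ 0 →
      ∑ x, ∑ y, q x y * f x * f y ≤ a * ∑ x, p x * f x * f x) (f : V → ℝ) :
    ∑ x, ∑ y, q x y * f x * f y ≤
      a * (∑ x, p x * f x * f x) + (1 - a) * (∑ x, p x * f x) ^ 2 := by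
  set t := ∑ x, p x * f x with ht
  have e0 : ∑ x, p x * (f x - t) = 0 := by
    simp only [mul_sub, Finset.sum_sub_distrib, ← Finset.sum_mul, h1, ← ht]; ring
  have e1 : ∑ x, p x * (f x - t) * (f x - t) = (∑ x, p x * f x * f x) - t ^ 2 := by
    have : ∀ x, p x * (f x - t) * (f x - t) = p x * f x * f x - 2 * t * (p x * f x) + t ^ 2 * p x :=
      fun x => by ring
    simp only [this, Finset.sum_add_distrib, Finset.sum_sub_distrib, ← Finset.mul_sum, h1, ← ht]
    ring
  have e2 : ∑ x, ∑ y, q x y * (f x - t) * (f y - t) =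
      (∑ x, ∑ y, q x y * f x * f y) - t ^ 2 := by
    have : ∀ x y, q x y * (f x - t) * (f y - t) =
        q x y * f x * f y - t * (q x y * f x) - t * (q x y * f y) + t ^ 2 * q x y :=
      fun x y => by ring
    simp only [this, Finset.sum_add_distrib, Finset.sum_sub_distrib, ← Finset.mul_sum]
    have a1 : ∑ x, ∑ y, q x y * f x = t := by
      simp only [← Finset.sum_mul, hm, ← ht]
    have a2 : ∑ x, ∑ y, q x y * f y = t := by
      rw [Finset.sum_comm]
      simp only [← Finset.sum_mul]
      rw [ht]
      refine Finset.sum_congr rfl fun y _ => ?_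
      rw [← hm y]
      congr 1
      exact Finset.sum_congr rfl fun x _ => hs _ _
    simp only [hm, h1]
    rw [a1, a2]; ring
  have key : ∑ x, ∑ y, q x y * (f x - t) * (f y - t) ≤
      a * ∑ x, p x * (f x - t) * (f x - t) := by
    by_cases h : ∑ x, p x * (f x - t) * (f x - t) = 0
    · have := graph_bound p q hq hs hm (fun x => f x - t) 1 (by norm_num)
      rw [h] at this ⊢
      linarith
    · exact ha (fun x => f x - t) e0 h
  rw [e1, e2] at key
  linarith

end graph

variable {V : Type*} [DecidableEq V] [Fintype V] {d : ℕ}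

/-- Vertex weights of the link, extended by zero. -/
noncomputable def lp (X : WSC V d) (s : ℕ) (σ : Finset V) (x : V) : ℝ :=
  if x ∈ σ then 0 else X.W (s + 1) (insert x σ) / (((s : ℝ) + 1) * X.W s σ)

/-- Edge weights of the link, extended by zero. -/
noncomputable def lq (X : WSC V d) (s : ℕ) (σ : Finset V) (x y : V) : ℝ :=
  if x ∈ σ ∨ y ∈ insert x σ then 0 else
    X.W (s + 2) (insert y (insert x σ)) / (((s : ℝ) + 2) * ((s : ℝ) + 1) * X.W s σ)

lemma lp_nonneg (X : WSC V d) (s : ℕ) (σ : Finset V) (hσ : σ.card = s) (x : V) :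
    0 ≤ X.lp s σ x := by
  unfold lp
  split_ifs with h
  · exact le_rfl
  · have := X.W_nonneg s σ hσ
    have := X.W_nonneg (s + 1) (insert x σ) (by rw [card_insert_of_notMem h, hσ])
    positivity

lemma lq_nonneg (X : WSC V d) (s : ℕ) (σ : Finset V) (hσ : σ.card = s) (x y : V) :
    0 ≤ X.lq s σ x y := by
  unfold lq
  split_ifs with h
  · exact le_rfl
  · push Not at h
    have := X.W_nonneg s σ hσ
    have := X.W_nonneg (s + 2) (insert y (insert x σ))
      (by rw [card_insert_of_notMem h.2, card_insert_of_notMem h.1, hσ])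
    positivity

lemma lq_symm (X : WSC V d) (s : ℕ) (σ : Finset V) (x y : V) :
    X.lq s σ x y = X.lq s σ y x := by
  unfold lq
  have : (x ∈ σ ∨ y ∈ insert x σ) ↔ (y ∈ σ ∨ x ∈ insert y σ) := by
    simp only [mem_insert, eq_comm (a := y)]; tauto
  rw [if_congr this rfl rfl, Finset.insert_comm]

lemma sum_ite_compl (τ : Finset V) (F : V → ℝ) :
    ∑ x, (if x ∈ τ then 0 else F x) = ∑ x ∈ τᶜ, F x := by
  rw [← Finset.sum_filter_add_sum_filter_not univ (fun x => x ∈ τ)]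
  rw [Finset.sum_eq_zero (by intro x hx; simp at hx; simp [hx]), zero_add]
  refine Finset.sum_congr (by ext; simp) ?_
  intro x hx
  simp at hx; simp [hx]

lemma sum_lp (X : WSC V d) (s : ℕ) (hs : s ≤ d) (σ : Finset V) (hσ : σ.card = s)
    (hf : σ ∈ X.faces) : ∑ x, X.lp s σ x = 1 := by
  unfold lp
  rw [sum_ite_compl, ← Finset.sum_div, ← X.W_rec s hs σ hσ]
  have := X.W_pos σ hf
  rw [hσ] at this
  exact div_self (by positivity)

lemma sum_lq (X : WSC V d) (s : ℕ) (hs : s + 1 ≤ d) (σ : Finset V) (hσ : σ.card = s)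
    (hf : σ ∈ X.faces) (x : V) : ∑ y, X.lq s σ x y = X.lp s σ x := by
  unfold lp lq
  by_cases hx : x ∈ σ
  · simp [hx]
  · simp only [hx, false_or, if_false]
    rw [sum_ite_compl, ← Finset.sum_div, ← X.W_rec (s + 1) hs (insert x σ)
      (by rw [card_insert_of_notMem hx, hσ])]
    have := X.W_pos σ hf
    rw [hσ] at this
    push_cast
    field_simp
    ring

lemma linkPi_one (X : WSC V d) (s : ℕ) (σ : Finset V) (hσ : σ.card = s) (x : V) (hx : x ∉ σ) :
    X.linkPi σ {x} = X.lp s σ x := by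
  unfold linkPi lp
  have e : σ ∪ {x} = insert x σ := by ext; simp
  rw [e, card_insert_of_notMem hx, hσ, if_neg hx, Nat.choose_succ_self_right]
  push_cast
  rfl

lemma linkPi_two (X : WSC V d) (s : ℕ) (σ : Finset V) (hσ : σ.card = s) (x y : V) (hx : x ∉ σ)
    (hy : y ∉ insert x σ) :
    X.linkPi σ {x, y} = 2 * X.lq s σ x y := by
  unfold linkPi lq
  have e : σ ∪ {x, y} = insert y (insert x σ) := by ext; simp; tauto
  have h : ¬ (x ∈ σ ∨ y ∈ insert x σ) := by tauto
  rw [e, card_insert_of_notMem hy, card_insert_of_notMem hx, hσ, if_neg h]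
  have hc : ((s + 1 + 1).choose s : ℝ) = ((s : ℝ) + 2) * (s + 1) / 2 := by
    rw [Nat.choose_symm_of_eq_add (b := 2) (by ring), Nat.cast_choose_two]
    push_cast; ring
  rw [hc]
  rw [show s + 1 + 1 = s + 2 from rfl]
  rw [show ((s : ℝ) + 2) * (s + 1) / 2 * X.W s σ = (((s : ℝ) + 2) * (s + 1) * X.W s σ) / 2 by ring,
    div_div_eq_mul_div]
  ring

lemma lp_zero (X : WSC V d) (s : ℕ) (σ : Finset V) (x : V) (hx : x ∉ X.linkVerts σ) :
    X.lp s σ x = 0 := by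
  unfold lp
  split_ifs with h
  · rfl
  · have : insert x σ ∉ X.faces := by
      intro h'; apply hx; simp [linkVerts, h, h']
    rw [X.W_zero _ _ this, zero_div]

lemma linkInner_eq (X : WSC V d) (s : ℕ) (σ : Finset V) (hσ : σ.card = s) (f g : V → ℝ) :
    X.linkInner σ f g = ∑ x, X.lp s σ x * f x * g x := by
  unfold linkInner
  rw [← Finset.sum_subset (Finset.subset_univ (X.linkVerts σ))
    (fun x _ hx => by rw [X.lp_zero s σ x hx]; ring)]
  refine Finset.sum_congr rfl fun x hx => ?_
  rw [X.linkPi_one s σ hσ x (by simp [linkVerts] at hx; exact hx.1)]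

lemma linkWalk_eq (X : WSC V d) (s : ℕ) (σ : Finset V) (hσ : σ.card = s) (f : V → ℝ) 
    (hf : σ ∈ X.faces) :
    X.linkInner σ f (X.linkWalk σ f) = ∑ x, ∑ y, X.lq s σ x y * f x * f y := by
  rw [X.linkInner_eq s σ hσ]
  refine Finset.sum_congr rfl fun x _ => ?_
  by_cases hx : x ∈ X.linkVerts σ
  · have hx1 : x ∉ σ := by simp [linkVerts] at hx; exact hx.1
    have hx2 : insert x σ ∈ X.faces := by simp [linkVerts] at hx; exact hx.2
    have hp : 0 < X.lp s σ x := by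
      unfold lp
      rw [if_neg hx1]
      have h1 := X.W_pos σ hf
      have h2 := X.W_pos _ hx2
      rw [card_insert_of_notMem hx1] at h2
      rw [hσ] at h1 h2
      positivity
    unfold linkWalk
    rw [Finset.mul_sum, ← Finset.sum_subset (Finset.subset_univ _)]
    · refine Finset.sum_congr rfl fun y hy => ?_
      simp only [mem_filter, linkVerts, mem_univ, true_and] at hy
      rw [X.linkPi_two s σ hσ x y hx1 (by simp only [mem_insert]; tauto),
        X.linkPi_one s σ hσ x hx1]
      field_simp
    · intro y _ hy
      have : X.lq s σ x y = 0 := by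
        unfold lq
        split_ifs with h
        · rfl
        · have : insert y (insert x σ) ∉ X.faces := by
            intro h'
            apply hy
            simp only [mem_insert, not_or] at h
            simp only [mem_filter, linkVerts, mem_univ, true_and]
            refine ⟨⟨h.2.2, X.down_closed _ h' _ ?_⟩, h.2.1, h'⟩
            exact insert_subset_insert _ (subset_insert _ _)
          rw [X.W_zero _ _ this, zero_div]
      rw [this]; ring
  · rw [X.lp_zero s σ x hx]
    rw [Finset.sum_eq_zero]
    · ring
    · intro y _
      have : X.lq s σ x y = 0 := by
        unfold lq
        split_ifs with h
        · rfl
        · have : insert y (insert x σ) ∉ X.faces := by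
            intro h'
            apply hx
            simp only [mem_insert, not_or] at h
            simp only [linkVerts, mem_filter, mem_univ, true_and]
            exact ⟨h.1, X.down_closed _ h' _ (subset_insert _ _)⟩
          rw [X.W_zero _ _ this, zero_div]
      rw [this]; ring

lemma link_quot (X : WSC V d) (s : ℕ) (hs : s + 1 ≤ d) (σ : Finset V) (hσ : σ.card = s)
    (hf : σ ∈ X.faces) (f : V → ℝ) (h0 : X.linkInner σ f f ≠ 0) :
    -1 ≤ X.linkInner σ f (X.linkWalk σ f) / X.linkInner σ f f ∧
    X.linkInner σ f (X.linkWalk σ f) / X.linkInner σ f f ≤ 1 := by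
  have hb := fun e he => graph_bound (X.lp s σ) (X.lq s σ) (X.lq_nonneg s σ hσ)
    (X.lq_symm s σ) (X.sum_lq s hs σ hσ hf) f e he
  rw [← X.linkWalk_eq s σ hσ f hf, ← X.linkInner_eq s σ hσ] at hb
  have hpos : 0 < X.linkInner σ f f := by
    refine lt_of_le_of_ne ?_ (Ne.symm h0)
    rw [X.linkInner_eq s σ hσ]
    refine Finset.sum_nonneg fun x _ => ?_
    rw [mul_assoc]
    exact mul_nonneg (X.lp_nonneg s σ hσ x) (mul_self_nonneg _)
  have b1 := hb 1 (by norm_num)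
  have b2 := hb (-1) (by norm_num)
  constructor
  · rw [le_div_iff₀ hpos]; linarith
  · rw [div_le_iff₀ hpos]; linarith

lemma linkLam2_bdd (X : WSC V d) (s : ℕ) (hs : s + 1 ≤ d) (σ : Finset V) (hσ : σ.card = s)
    (hf : σ ∈ X.faces) : BddAbove { r : ℝ | ∃ f : V → ℝ,
    X.linkInner σ f (fun _ => 1) = 0 ∧ X.linkInner σ f f ≠ 0 ∧
    r = X.linkInner σ f (X.linkWalk σ f) / X.linkInner σ f f } := by
  refine ⟨1, ?_⟩
  rintro r ⟨f, _, h, rfl⟩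
  exact (X.link_quot s hs σ hσ hf f h).2

lemma linkLam2_ge (X : WSC V d) (s : ℕ) (hs : s + 1 ≤ d) (σ : Finset V) (hσ : σ.card = s)
    (hf : σ ∈ X.faces) : -1 ≤ X.linkLam2 σ := by
  unfold linkLam2
  rcases Set.eq_empty_or_nonempty { r : ℝ | ∃ f : V → ℝ,
    X.linkInner σ f (fun _ => 1) = 0 ∧ X.linkInner σ f f ≠ 0 ∧
    r = X.linkInner σ f (X.linkWalk σ f) / X.linkInner σ f f } with h | ⟨r, hr⟩
  · rw [h, Real.sSup_empty]; norm_num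
  · refine le_trans ?_ (le_csSup (X.linkLam2_bdd s hs σ hσ hf) hr)
    obtain ⟨f, _, h, rfl⟩ := hr
    exact (X.link_quot s hs σ hσ hf f h).1

lemma linkLam2_le_gammaC (X : WSC V d) (s : ℕ) (σ : Finset V) (hσ : σ.card = s)
    (hf : σ ∈ X.faces) : X.linkLam2 σ ≤ X.gammaC s := by
  unfold gammaC
  refine le_csSup ?_ ⟨σ, hf, hσ, rfl⟩
  refine Set.Finite.bddAbove (Set.Finite.subset (X.faces.image X.linkLam2).finite_toSet ?_)
  rintro r ⟨α, hα, _, rfl⟩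
  simp only [coe_image]
  exact ⟨α, hα, rfl⟩

lemma link_ineq (X : WSC V d) (s : ℕ) (hs : s + 1 ≤ d) (σ : Finset V) (hσ : σ.card = s)
    (hf : σ ∈ X.faces) (a : ℝ) (ha : X.gammaC s ≤ a) (f : V → ℝ) :
    ∑ x, ∑ y, X.lq s σ x y * f x * f y ≤
      a * (∑ x, X.lp s σ x * f x * f x) + (1 - a) * (∑ x, X.lp s σ x * f x) ^ 2 := by
  refine graph_shift (X.lp s σ) (X.lq s σ) (X.lq_nonneg s σ hσ)
    (X.lq_symm s σ) (X.sum_lq s hs σ hσ hf) (X.sum_lp s (by omega) σ hσ hf) a ?_ f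
  intro g hg hg0
  rw [← X.linkInner_eq s σ hσ] at hg0 ⊢
  rw [← X.linkWalk_eq s σ hσ g hf]
  have hpos : 0 < X.linkInner σ g g := by
    refine lt_of_le_of_ne ?_ (Ne.symm hg0)
    rw [X.linkInner_eq s σ hσ]
    refine Finset.sum_nonneg fun x _ => ?_
    rw [mul_assoc]
    exact mul_nonneg (X.lp_nonneg s σ hσ x) (mul_self_nonneg _)
  rw [← div_le_iff₀ hpos]
  refine le_trans ?_ ((X.linkLam2_le_gammaC s σ hσ hf).trans ha)
  refine le_csSup (X.linkLam2_bdd s hs σ hσ hf) ⟨g, ?_, hg0, rfl⟩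
  rw [X.linkInner_eq s σ hσ]
  simpa using hg

end WSC

namespace WSC

variable {V : Type*} [DecidableEq V] [Fintype V] {d : ℕ}

lemma W_mul_lp (X : WSC V d) (s : ℕ) (σ : Finset V) (hσ : σ.card = s) (x : V) :
    X.W s σ * X.lp s σ x =
      if x ∈ σ then 0 else (1 / ((s : ℝ) + 1)) * X.W (s + 1) (insert x σ) := by
  unfold lp
  split_ifs with hx
  · ring
  · by_cases hf : σ ∈ X.faces
    · have := X.W_pos σ hf
      rw [hσ] at this
      field_simp
    · rw [X.W_zero _ _ hf,
        X.W_zero _ _ (fun h' => hf (X.down_closed _ h' σ (subset_insert _ _)))]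
      ring

lemma W_mul_lq (X : WSC V d) (s : ℕ) (σ : Finset V) (hσ : σ.card = s) (x y : V) :
    X.W s σ * X.lq s σ x y =
      if x ∈ σ then 0 else if y ∈ insert x σ then 0 else
        (1 / (((s : ℝ) + 2) * ((s : ℝ) + 1))) * X.W (s + 2) (insert y (insert x σ)) := by
  unfold lq
  by_cases hx : x ∈ σ
  · simp [hx]
  · by_cases hy : y ∈ insert x σ
    · simp [hy]
    · rw [if_neg (by tauto), if_neg hx, if_neg hy]
      by_cases hf : σ ∈ X.faces
      · have := X.W_pos σ hf
        rw [hσ] at this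
        field_simp
      · rw [X.W_zero _ _ hf, X.W_zero _ _ (fun h' => hf (X.down_closed _ h' σ
          ((subset_insert x _).trans (subset_insert _ _))))]
        ring

lemma decomp_norm (X : WSC V d) (s : ℕ) (f : Finset V → ℝ) :
    X.inn (s + 1) f f = ∑ σ ∈ (univ : Finset V).powersetCard s,
      X.W s σ * ∑ x, X.lp s σ x * f (insert x σ) * f (insert x σ) := by
  rw [inn_eq]
  have h1 : ∀ β ∈ (univ : Finset V).powersetCard (s + 1), X.W (s + 1) β * f β * f β =
      ∑ x ∈ β, (1 / ((s : ℝ) + 1)) * (X.W (s + 1) β * f β * f β) := by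
    intro β hβ
    rw [mem_powersetCard_univ] at hβ
    rw [Finset.sum_const, hβ, nsmul_eq_mul]
    push_cast
    field_simp
  rw [Finset.sum_congr rfl h1, sum_insert_erase]
  refine Finset.sum_congr rfl fun σ hσ => ?_
  rw [mem_powersetCard_univ] at hσ
  rw [Finset.mul_sum, ← sum_ite_compl]
  refine Finset.sum_congr rfl fun x _ => ?_
  rw [← mul_assoc (X.W s σ), ← mul_assoc (X.W s σ), W_mul_lp _ _ _ hσ]
  split_ifs <;> ring

lemma decomp_down (X : WSC V d) (s : ℕ) (f : Finset V → ℝ) :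
    X.inn s (X.downOp f) (X.downOp f) = ∑ σ ∈ (univ : Finset V).powersetCard s,
      X.W s σ * (∑ x, X.lp s σ x * f (insert x σ)) ^ 2 := by
  rw [inn_eq]
  refine Finset.sum_congr rfl fun σ hσ => ?_
  rw [mem_powersetCard_univ] at hσ
  by_cases hf : σ ∈ X.faces
  · have hp := X.W_pos σ hf
    rw [hσ] at hp
    have : X.downOp f σ = ∑ x, X.lp s σ x * f (insert x σ) := by
      have h := X.W_downOp s f σ hσ
      rw [← sum_ite_compl] at h
      apply mul_left_cancel₀ (show ((s : ℝ) + 1) * X.W s σ ≠ 0 by positivity)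
      rw [h, Finset.mul_sum]
      refine Finset.sum_congr rfl fun x _ => ?_
      have h2 := X.W_mul_lp s σ hσ x
      rw [show ((s : ℝ) + 1) * X.W s σ * (X.lp s σ x * f (insert x σ)) =
        ((s : ℝ) + 1) * (X.W s σ * X.lp s σ x) * f (insert x σ) by ring, h2]
      split_ifs
      · ring
      · field_simp
    rw [this]; ring
  · rw [X.W_zero _ _ hf]; ring

lemma decomp_up (X : WSC V d) (s : ℕ) (hs : s + 1 ≤ d) (f : Finset V → ℝ) :
    X.inn (s + 2) (upOp f) (upOp f) = (1 / ((s : ℝ) + 2)) * X.inn (s + 1) f f +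
      (((s : ℝ) + 1) / ((s : ℝ) + 2)) * ∑ σ ∈ (univ : Finset V).powersetCard s,
        X.W s σ * ∑ x, ∑ y, X.lq s σ x y * f (insert x σ) * f (insert y σ) := by
  have hA : ∀ α ∈ (univ : Finset V).powersetCard (s + 1),
      X.W (s + 1) α * f α * X.downOp (upOp f) α =
      (1 / ((s : ℝ) + 2)) * (X.W (s + 1) α * f α * f α) +
      ∑ y ∈ α, ∑ x ∈ αᶜ, (1 / ((s : ℝ) + 2) ^ 2) *
        (X.W (s + 2) (insert x α) * f α * f ((insert x α).erase y)) := by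
    intro α hα
    rw [mem_powersetCard_univ] at hα
    have h := X.W_downOp (s + 1) (upOp f) α hα
    have hr := X.W_rec (s + 1) hs α hα
    have hu : ∀ x ∈ αᶜ, X.W (s + 1 + 1) (insert x α) * upOp f (insert x α) =
        (1 / ((s : ℝ) + 2)) * f α * X.W (s + 1 + 1) (insert x α) +
        ∑ y ∈ α, (1 / ((s : ℝ) + 2)) *
          (X.W (s + 2) (insert x α) * f ((insert x α).erase y)) := by
      intro x hx
      have hx' : x ∉ α := by simpa using hx
      unfold upOp
      rw [card_insert_of_notMem hx', hα, Finset.sum_insert hx', erase_insert hx',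
        ← Finset.mul_sum, ← Finset.mul_sum]
      push_cast
      ring
    rw [Finset.sum_congr rfl hu, Finset.sum_add_distrib, ← Finset.mul_sum, ← hr,
      Finset.sum_comm] at h
    push_cast at h
    have h2 : ∑ y ∈ α, ∑ x ∈ αᶜ, (1 / ((s : ℝ) + 2) ^ 2) *
        (X.W (s + 2) (insert x α) * f α * f ((insert x α).erase y)) =
        (f α / ((s : ℝ) + 2)) * ∑ y ∈ α, ∑ x ∈ αᶜ, (1 / ((s : ℝ) + 2)) *
          (X.W (s + 2) (insert x α) * f ((insert x α).erase y)) := by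
      simp only [Finset.mul_sum]
      refine Finset.sum_congr rfl fun y _ => Finset.sum_congr rfl fun x _ => ?_
      field_simp
    rw [h2]
    generalize (∑ y ∈ α, ∑ x ∈ αᶜ, (1 / ((s : ℝ) + 2)) *
          (X.W (s + 2) (insert x α) * f ((insert x α).erase y))) = T at h ⊢
    have hne : ((s : ℝ) + 2) ≠ 0 := by positivity
    field_simp
    have h' : X.W (s + 1) α * X.downOp (upOp f) α * ((s : ℝ) + 2) = X.W (s + 1) α * f α + T := by
      apply mul_left_cancel₀ hne
      field_simp at h
      linear_combination h
    linear_combination (f α) * h'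
  rw [show s + 2 = s + 1 + 1 from rfl, ← adj, inn_eq, Finset.sum_congr rfl hA,
    Finset.sum_add_distrib, ← Finset.mul_sum, ← inn_eq, sum_insert_erase]
  congr 1
  rw [Finset.mul_sum]
  refine Finset.sum_congr rfl fun σ hσ => ?_
  rw [mem_powersetCard_univ] at hσ
  rw [← sum_ite_compl, Finset.mul_sum, Finset.mul_sum]
  refine Finset.sum_congr rfl fun y _ => ?_
  rw [Finset.mul_sum, Finset.mul_sum]
  by_cases hy : y ∈ σ
  · rw [if_pos hy, Finset.sum_eq_zero]
    intro x _
    rw [← mul_assoc (X.W s σ), ← mul_assoc (X.W s σ), W_mul_lq _ _ _ hσ, if_pos hy]; ring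
  · rw [if_neg hy, ← sum_ite_compl]
    refine Finset.sum_congr rfl fun x _ => ?_
    rw [← mul_assoc (X.W s σ), ← mul_assoc (X.W s σ), W_mul_lq _ _ _ hσ, if_neg hy]
    split_ifs with hx
    · ring
    · have e : (insert x (insert y σ)).erase y = insert x σ := by
        rw [Finset.insert_comm, erase_insert]
        simp only [mem_insert, not_or] at hx ⊢
        exact ⟨fun h => hx.1 h.symm, hy⟩
      rw [e]
      field_simp

lemma main_ineq (X : WSC V d) (s : ℕ) (hs : s + 1 ≤ d) (a : ℝ) (ha : X.gammaC s ≤ a)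
    (f : Finset V → ℝ) :
    X.inn (s + 2) (upOp f) (upOp f) ≤ (1 / ((s : ℝ) + 2)) * X.inn (s + 1) f f +
      (((s : ℝ) + 1) / ((s : ℝ) + 2)) * (a * X.inn (s + 1) f f +
        (1 - a) * X.inn s (X.downOp f) (X.downOp f)) := by
  rw [X.decomp_up s hs f]
  gcongr
  rw [decomp_norm, decomp_down, Finset.mul_sum, Finset.mul_sum, ← Finset.sum_add_distrib]
  refine Finset.sum_le_sum fun σ hσ => ?_
  rw [mem_powersetCard_univ] at hσ
  by_cases hf : σ ∈ X.faces
  · have := mul_le_mul_of_nonneg_left (X.link_ineq s hs σ hσ hf a ha (fun x => f (insert x σ)))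
      (X.W_nonneg s σ hσ)
    linarith
  · rw [X.W_zero _ _ hf]; simp

lemma gap (X : WSC V d) (c : ℝ) (hc : 0 < c)
    (hγ : ∀ j : ℕ, j + 2 ≤ d → X.gammaC (j + 1) ≤ 1 / 2)
    (hγ0 : c ≤ 1 - X.gammaC 0) (hc2 : c ≤ 2) :
    ∀ j : ℕ, j + 1 ≤ d → ∀ f, X.inn (j + 1) f (fun _ => 1) = 0 →
      X.inn (j + 2) (upOp f) (upOp f) ≤
        (1 - c / (((j : ℝ) + 2) * 2 ^ j)) * X.inn (j + 1) f f := by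
  intro j
  induction j with
  | zero =>
    intro hj f hf
    have h := X.main_ineq 0 hj (1 - c) (by linarith) f
    have h0 : X.inn 0 (X.downOp f) (X.downOp f) = 0 := by
      have h1 := X.inn_upOp_one 0 f
      rw [hf, inn_eq] at h1
      rw [inn_eq]
      simp only [powersetCard_zero, sum_singleton] at h1 ⊢
      rw [mul_one] at h1
      rw [h1, zero_mul]
    rw [h0] at h
    simp only [Nat.cast_zero, pow_zero] at h ⊢
    refine h.trans (le_of_eq ?_)
    ring
  | succ j ih =>
    intro hj f hf
    have hg : c / (((j : ℝ) + 2) * 2 ^ j) ≤ 1 := by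
      rw [div_le_one (by positivity)]
      have : (1 : ℝ) ≤ 2 ^ j := one_le_pow₀ (by norm_num)
      have hj0 : (0 : ℝ) ≤ j := by positivity
      nlinarith
    have h1 := X.down_of_up (j + 1) _ (by linarith) (ih (by omega)) f hf
    have h := X.main_ineq (j + 1) hj (1 / 2) (hγ j (by omega)) f
    push_cast at h ⊢
    refine h.trans ?_
    have h2 : (((j : ℝ) + 1 + 1) / ((j : ℝ) + 1 + 2)) * (1 / 2 * X.inn (j + 1 + 1) f f +
        (1 - 1 / 2) * X.inn (j + 1) (X.downOp f) (X.downOp f)) ≤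
        (((j : ℝ) + 1 + 1) / ((j : ℝ) + 1 + 2)) * (1 / 2 * X.inn (j + 1 + 1) f f +
        (1 - 1 / 2) * ((1 - c / (((j : ℝ) + 2) * 2 ^ j)) * X.inn (j + 1 + 1) f f)) := by
      have : (0 : ℝ) ≤ 1 - 1 / 2 := by norm_num
      gcongr
    refine (add_le_add_right h2 _).trans (le_of_eq ?_)
    rw [pow_succ]
    field_simp
    ring

lemma quot_bound (X : WSC V d) (m : ℕ) (M : (Finset V → ℝ) → Finset V → ℝ) (a : ℝ)
    (ha : ∀ f, X.inn m f (fun _ => 1) = 0 → X.inn m f (M f) ≤ a * X.inn m f f) :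
    ∀ r ∈ { r : ℝ | ∃ f : Finset V → ℝ,
      X.inn m f (fun _ => 1) = 0 ∧ X.inn m f f ≠ 0 ∧
      r = X.inn m f (M f) / X.inn m f f }, r ≤ a := by
  rintro r ⟨f, h1, h2, rfl⟩
  rw [div_le_iff₀ (lt_of_le_of_ne (X.inn_self_nonneg m f) (Ne.symm h2))]
  exact ha f h1

lemma lam2_nonneg (X : WSC V d) (m : ℕ) (M : (Finset V → ℝ) → Finset V → ℝ)
    (hM : ∀ f, 0 ≤ X.inn m f (M f)) : 0 ≤ X.lam2 m M := by
  refine Real.sSup_nonneg ?_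
  rintro r ⟨f, h1, h2, rfl⟩
  exact div_nonneg (hM f) (X.inn_self_nonneg m f)

lemma le_lam2 (X : WSC V d) (m : ℕ) (M : (Finset V → ℝ) → Finset V → ℝ) (a : ℝ)
    (ha : ∀ f, X.inn m f (fun _ => 1) = 0 → X.inn m f (M f) ≤ a * X.inn m f f)
    (h0 : ∀ f, X.inn m f f = 0 → X.inn m f (M f) ≤ 0) :
    ∀ f, X.inn m f (fun _ => 1) = 0 → X.inn m f (M f) ≤ X.lam2 m M * X.inn m f f := by
  intro f hf
  by_cases h : X.inn m f f = 0
  · rw [h, mul_zero]; exact h0 f h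
  · rw [← div_le_iff₀ (lt_of_le_of_ne (X.inn_self_nonneg m f) (Ne.symm h))]
    exact le_csSup ⟨a, X.quot_bound m M a ha⟩ ⟨f, hf, h, rfl⟩

lemma inn_zero_of_self (X : WSC V d) (m : ℕ) (f g : Finset V → ℝ) (h : X.inn m f f = 0) :
    X.inn m f g ≤ 0 := by
  have := X.inn_cs m f g
  rw [h, zero_mul] at this
  nlinarith [sq_nonneg (X.inn m f g), pow_eq_zero_iff (two_ne_zero) |>.1
    (le_antisymm this (sq_nonneg _))]

end WSC

/-- **Corollary (Liu–Mohanty–Yang complexes).** Let `(X, Π)` be a weighted pure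
`H`-dimensional simplicial complex with `γ_j ≤ 1/2` for all `0 ≤ j ≤ H-2`
(i.e. `X.gammaC (j+1) ≤ 1/2` whenever `j + 2 ≤ H`) and `1 - γ_{-1} ≥ c` for some
`c > 0`.  Then for every `0 ≤ j ≤ H-2`,
`λ₂(P∨_{j+1}) = λ₂(P∧_j) ≤ 1 - c/((j+2)·2^j)`. -/
theorem lam2_downUp_le_LMY {V : Type*} [DecidableEq V] [Fintype V] {H : ℕ}
    (X : WSC V H) (c : ℝ) (hc : 0 < c)
    (hγ : ∀ j : ℕ, j + 2 ≤ H → X.gammaC (j + 1) ≤ 1 / 2)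
    (hγ0 : c ≤ 1 - X.gammaC 0)
    (j : ℕ) (hj : j + 2 ≤ H) :
    X.lam2 (j + 2) X.downUp = X.lam2 (j + 1) X.upDown ∧
    X.lam2 (j + 2) X.downUp ≤ 1 - c / (((j : ℝ) + 2) * 2 ^ j) := by
  have hc2 : c ≤ 2 := by
    have h1 := X.linkLam2_ge 0 (by omega) ∅ rfl X.empty_mem
    have h2 := X.linkLam2_le_gammaC 0 ∅ rfl X.empty_mem
    linarith
  have hg : c / (((j : ℝ) + 2) * 2 ^ j) ≤ 1 := by
    rw [div_le_one (by positivity)]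
    have : (1 : ℝ) ≤ 2 ^ j := one_le_pow₀ (by norm_num)
    have hj0 : (0 : ℝ) ≤ j := by positivity
    nlinarith
  set b := 1 - c / (((j : ℝ) + 2) * 2 ^ j) with hb
  have hb0 : 0 ≤ b := by linarith
  have hup := X.gap c hc hγ hγ0 hc2 j (by omega)
  have hdown := X.down_of_up (j + 1) b hb0 hup
  have hup' : ∀ f, X.inn (j + 1) f (fun _ => 1) = 0 →
      X.inn (j + 1) f (X.upDown f) ≤ b * X.inn (j + 1) f f := by
    intro f hf
    rw [X.inn_upDown]; exact hup f hf
  have hdown' : ∀ f, X.inn (j + 2) f (fun _ => 1) = 0 →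
      X.inn (j + 2) f (X.downUp f) ≤ b * X.inn (j + 2) f f := by
    intro f hf
    rw [X.inn_downUp (j + 1)]; exact hdown f hf
  have n1 : 0 ≤ X.lam2 (j + 1) X.upDown := X.lam2_nonneg _ _ fun f => by
    rw [X.inn_upDown]; exact X.inn_self_nonneg _ _
  have n2 : 0 ≤ X.lam2 (j + 2) X.downUp := X.lam2_nonneg _ _ fun f => by
    rw [X.inn_downUp (j + 1)]; exact X.inn_self_nonneg _ _
  have l1 := X.le_lam2 _ _ b hup' (fun f h => X.inn_zero_of_self _ _ _ h)
  have l2 := X.le_lam2 _ _ b hdown' (fun f h => X.inn_zero_of_self _ _ _ h)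
  refine ⟨le_antisymm ?_ ?_, Real.sSup_le (X.quot_bound _ _ b hdown') hb0⟩
  · refine Real.sSup_le (X.quot_bound _ _ _ ?_) n1
    intro f hf
    rw [X.inn_downUp (j + 1)]
    refine X.down_of_up (j + 1) _ n1 ?_ f hf
    intro g hg
    rw [← X.inn_upDown]; exact l1 g hg
  · refine Real.sSup_le (X.quot_bound _ _ _ ?_) n2
    intro f hf
    rw [X.inn_upDown]
    refine X.up_of_down (j + 1) (by omega) _ n2 ?_ f hf
    intro g hg
    rw [← X.inn_downUp]; exact l2 g hg
end

section
/- Let G = (V, E) be a finite simple graph with n vertices and maximum degree Δ, having at least one edge, and let k ≥ 1 be an integer. If k ≤ n / (Δ + |λ_min(A_G)|), then the transition matrix P∨_{k−1} of the (k−1)-th down-up walk on size-k independent sets of G satisfies λ₂(P∨_{k−1}) ≤ 1 − 1/k². -/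
open Finset

variable {V : Type*} [Fintype V] [DecidableEq V]

/-- The independent sets of size `k` of a finite simple graph `G`. -/
def IndepSets (G : SimpleGraph V) [DecidableRel G.Adj] (k : ℕ) : Finset (Finset V) :=
  Finset.univ.filter (fun S => S.card = k ∧ ∀ u ∈ S, ∀ v ∈ S, ¬ G.Adj u v)

/-- The transition probability of the `(k-1)`-th down-up walk on size-`k`
independent sets of `G`: from `S`, pick a uniformly random `v ∈ S`, then a
uniformly random independent set `T` of size `k` with `T ⊇ S \ {v}`. -/
noncomputable def duP (G : SimpleGraph V) [DecidableRel G.Adj] (k : ℕ)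
    (S T : Finset V) : ℝ :=
  (1 / (k : ℝ)) * ∑ v ∈ S,
    if S.erase v ⊆ T then
      (1 : ℝ) / (((IndepSets G k).filter (fun T' => S.erase v ⊆ T')).card : ℝ)
    else 0

/-- The second largest eigenvalue of the down-up walk on size-`k` independent sets:
the walk is self-adjoint with respect to its stationary distribution, the uniform
distribution on `IndepSets G k`, so by the variational principle `λ₂` is the
supremum of Rayleigh quotients of (nonzero) functions orthogonal to the constants. -/
noncomputable def duLam2 (G : SimpleGraph V) [DecidableRel G.Adj] (k : ℕ) : ℝ :=
  sSup { r : ℝ | ∃ f : Finset V → ℝ,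
    (∑ S ∈ IndepSets G k, f S) = 0 ∧ (∑ S ∈ IndepSets G k, f S ^ 2) ≠ 0 ∧
    r = (∑ S ∈ IndepSets G k, f S * ∑ T ∈ IndepSets G k, duP G k S T * f T) /
        (∑ S ∈ IndepSets G k, f S ^ 2) }

/-- The smallest eigenvalue of a real symmetric matrix, via the variational
principle: the infimum of its Rayleigh quotients. -/
noncomputable def lamMin (A : Matrix V V ℝ) : ℝ :=
  sInf { r : ℝ | ∃ f : V → ℝ, (∑ x, f x ^ 2) ≠ 0 ∧
    r = (∑ x, f x * ∑ y, A x y * f y) / (∑ x, f x ^ 2) }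


/-- Eigenvector expansion of a symmetric form: if every eigenvector orthogonal to `f` or with
eigenvalue at most `c`, then the Rayleigh quotient of `f` is at most `c`. -/
lemma sym_rayleigh {α : Type*} [Fintype α] [DecidableEq α] (N : Matrix α α ℝ)
    (hN : N.IsHermitian) (c : ℝ) (f : α → ℝ)
    (h : ∀ (μ : ℝ) (u : α → ℝ), (∀ x, ∑ y, N x y * u y = μ * u x) →
      μ ≤ c ∨ ∑ x, f x * u x = 0) :
    ∑ x, f x * ∑ y, N x y * f y ≤ c * ∑ x, f x ^ 2 := by
  set b := hN.eigenvectorBasis with hb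
  set F : EuclideanSpace ℝ α := WithLp.toLp 2 f with hF
  have hrow : ∀ i, ∀ x, ∑ y, N x y * b i y = hN.eigenvalues i * b i x := by
    intro i x
    have := congrFun (hN.mulVec_eigenvectorBasis i) x
    simpa [Matrix.mulVec, dotProduct] using this
  have hin : ∀ i, inner ℝ (b i) F = ∑ x, f x * b i x := by
    intro i
    simp [PiLp.inner_apply, hF]
  set NF : EuclideanSpace ℝ α := WithLp.toLp 2 (fun x => ∑ y, N x y * f y) with hNF
  have hNin : ∀ i, inner ℝ (b i) NF = hN.eigenvalues i * ∑ x, f x * b i x := by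
    intro i
    simp only [PiLp.inner_apply, hNF, RCLike.inner_apply, conj_trivial]
    simp_rw [Finset.sum_mul]
    rw [Finset.sum_comm, Finset.mul_sum]
    refine Finset.sum_congr rfl fun y _ => ?_
    have := hrow i y
    have hs : ∀ x, N x y = N y x := fun x => by simpa using (hN.apply y x)
    calc ∑ x, N x y * f y * b i x = f y * ∑ x, N y x * b i x := by
          rw [Finset.mul_sum]; refine Finset.sum_congr rfl fun x _ => ?_
          rw [hs]; ring
      _ = _ := by rw [this]; ring
  have e1 : ∑ x, f x * ∑ y, N x y * f y = ∑ i, hN.eigenvalues i * (∑ x, f x * b i x) ^ 2 := by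
    have := b.sum_inner_mul_inner F NF
    calc ∑ x, f x * ∑ y, N x y * f y = inner ℝ F NF := by
          simp [PiLp.inner_apply, hF, hNF, mul_comm]
      _ = _ := by
          rw [← this]
          refine Finset.sum_congr rfl fun i _ => ?_
          rw [hNin, real_inner_comm, hin]; ring
  have e2 : ∑ x, f x ^ 2 = ∑ i, (∑ x, f x * b i x) ^ 2 := by
    have := b.sum_inner_mul_inner F F
    calc ∑ x, f x ^ 2 = inner ℝ F F := by
          rw [PiLp.inner_apply]; simp [hF, sq]
      _ = _ := by
          rw [← this]
          refine Finset.sum_congr rfl fun i _ => ?_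
          rw [real_inner_comm, hin]; ring
  rw [e1, e2, Finset.mul_sum]
  refine Finset.sum_le_sum fun i _ => ?_
  rcases h _ _ (hrow i) with h | h
  · exact mul_le_mul_of_nonneg_right h (sq_nonneg _)
  · rw [h]; simp

/-- Trickle-down in abstract form. -/
lemma trickle_abs {α : Type*} [Fintype α] [DecidableEq α] (w : α → α → ℝ) (p : α → ℝ)
    (hw : ∀ x y, 0 ≤ w x y) (hs : ∀ x y, w x y = w y x) (hp : ∀ x, p x = ∑ y, w x y)
    (γ c : ℝ) (hγ : γ < 1) (hc : γ = c * (1 - γ))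
    (hconn : ∀ x y, 0 < p x → 0 < p y → ∃ z, 0 < w x z ∧ 0 < w z y)
    (hq : ∀ g : α → ℝ, ∑ x, ∑ y, w x y * g x * g y ≤
      γ * ∑ x, p x * g x ^ 2 + (1 - γ) * ∑ x, (∑ y, w x y * g y) ^ 2 / p x)
    (f : α → ℝ) (hf : ∑ x, p x * f x = 0) :
    ∑ x, ∑ y, w x y * f x * f y ≤ c * ∑ x, p x * f x ^ 2 := by
  have hp0 : ∀ x, 0 ≤ p x := fun x => by rw [hp]; exact Finset.sum_nonneg fun y _ => hw x y
  have hz : ∀ x, p x = 0 → ∀ y, w x y = 0 := by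
    intro x hx y
    rw [hp, Finset.sum_eq_zero_iff_of_nonneg (fun y _ => hw x y)] at hx
    exact hx y (Finset.mem_univ y)
  have hsq : ∀ x, √(p x) * √(p x) = p x := fun x => Real.mul_self_sqrt (hp0 x)
  have hsne : ∀ x, p x ≠ 0 → √(p x) ≠ 0 := fun x hx => by
    rw [Real.sqrt_ne_zero (hp0 x)]; exact hx
  set N : Matrix α α ℝ := fun x y => w x y / (√(p x) * √(p y)) with hNdef
  have hN : N.IsHermitian := by
    ext x y
    rw [Matrix.conjTranspose_apply]
    simp only [hNdef, star_trivial]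
    rw [hs y x, mul_comm]
  have key := sym_rayleigh N hN c (fun x => √(p x) * f x) ?_
  · have e1 : ∑ x, ∑ y, w x y * f x * f y =
        ∑ x, (√(p x) * f x) * ∑ y, N x y * (√(p y) * f y) := by
      refine Finset.sum_congr rfl fun x _ => ?_
      rw [Finset.mul_sum]
      refine Finset.sum_congr rfl fun y _ => ?_
      by_cases hx : p x = 0
      · simp [hz x hx y, hx]
      by_cases hy : p y = 0
      · simp [hs x y, hz y hy x, hy]
      have := hsne x hx
      have := hsne y hy
      simp only [hNdef]
      field_simp
    have e2 : ∑ x, p x * f x ^ 2 = ∑ x, (√(p x) * f x) ^ 2 := by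
      refine Finset.sum_congr rfl fun x _ => ?_
      rw [mul_pow, sq (√(p x)), hsq]
    rw [e1, e2]; exact key
  · intro μ u hu
    set g : α → ℝ := fun x => u x / √(p x) with hg
    have hgr : ∀ x, ∑ y, w x y * g y = μ * (p x * g x) := by
      intro x
      by_cases hx : p x = 0
      · simp [hx, hz x hx]
      have h1 := hsne x hx
      have h2 : p x * g x = √(p x) * u x := by
        simp only [hg]
        rw [mul_div_assoc', div_eq_iff h1, mul_right_comm, hsq]
      rw [h2, mul_left_comm, ← hu x, Finset.mul_sum]
      refine Finset.sum_congr rfl fun y _ => ?_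
      simp only [hg, hNdef]
      field_simp
    have hfu : ∑ x, √(p x) * f x * u x = ∑ x, p x * f x * g x := by
      refine Finset.sum_congr rfl fun x _ => ?_
      by_cases hx : p x = 0
      · simp [hx]
      have h1 := hsne x hx
      simp only [hg]
      rw [mul_div_assoc', eq_div_iff h1]
      calc √(p x) * f x * u x * √(p x) = (√(p x) * √(p x)) * f x * u x := by ring
        _ = _ := by rw [hsq]
    rw [hfu]
    set Z := ∑ x, p x * g x ^ 2 with hZ
    have hZ0 : 0 ≤ Z := Finset.sum_nonneg fun x _ => mul_nonneg (hp0 x) (sq_nonneg _)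
    have hwgg : ∑ x, ∑ y, w x y * g x * g y = μ * Z := by
      rw [hZ, Finset.mul_sum]
      refine Finset.sum_congr rfl fun x _ => ?_
      calc ∑ y, w x y * g x * g y = g x * ∑ y, w x y * g y := by
            rw [Finset.mul_sum]; exact Finset.sum_congr rfl fun y _ => by ring
        _ = _ := by rw [hgr]; ring
    have hdir : ∑ x, ∑ y, w x y * (g x - g y) ^ 2 = 2 * (1 - μ) * Z := by
      have a1 : ∑ x, ∑ y, w x y * g x ^ 2 = Z := by
        refine Finset.sum_congr rfl fun x _ => ?_
        rw [← Finset.sum_mul, hp]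
      have a2 : ∑ x, ∑ y, w x y * g y ^ 2 = Z := by
        rw [Finset.sum_comm, ← a1]
        refine Finset.sum_congr rfl fun x _ => Finset.sum_congr rfl fun y _ => ?_
        rw [hs]
      have : ∑ x, ∑ y, w x y * (g x - g y) ^ 2 =
          ∑ x, ∑ y, w x y * g x ^ 2 + ∑ x, ∑ y, w x y * g y ^ 2
            - 2 * ∑ x, ∑ y, w x y * g x * g y := by
        simp only [Finset.mul_sum, ← Finset.sum_add_distrib, ← Finset.sum_sub_distrib]
        refine Finset.sum_congr rfl fun x _ => Finset.sum_congr rfl fun y _ => by ring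
      rw [this, a1, a2, hwgg]; ring
    rcases hZ0.eq_or_lt with hZz | hZpos
    · right
      have hall := (Finset.sum_eq_zero_iff_of_nonneg
        (fun x _ => mul_nonneg (hp0 x) (sq_nonneg (g x)))).1 hZz.symm
      refine Finset.sum_eq_zero fun x hx => ?_
      rcases mul_eq_zero.1 (hall x hx) with h | h
      · simp [h]
      · simp [pow_eq_zero_iff] at h; simp [h]
    rcases lt_or_ge μ 1 with hμ | hμ
    · left
      have h1 := hq g
      have h2 : ∑ x, (∑ y, w x y * g y) ^ 2 / p x = μ ^ 2 * Z := by
        rw [hZ, Finset.mul_sum]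
        refine Finset.sum_congr rfl fun x _ => ?_
        rw [hgr]
        by_cases hx : p x = 0
        · simp [hx]
        field_simp
      rw [hwgg, h2] at h1
      have h3 : (μ - γ - (1 - γ) * μ ^ 2) * Z ≤ 0 := by nlinarith
      have h4 : μ - γ - (1 - γ) * μ ^ 2 ≤ 0 := by
        by_contra hcon
        push Not at hcon
        nlinarith [mul_pos hcon hZpos]
      have h5 : (1 - μ) * (μ * (1 - γ) - γ) ≤ 0 := by nlinarith
      have h6 : μ * (1 - γ) - γ ≤ 0 := by
        by_contra hcon
        push Not at hcon
        nlinarith [mul_pos (sub_pos.2 hμ) hcon]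
      have h7 : (μ - c) * (1 - γ) ≤ 0 := by nlinarith
      by_contra hcon
      push Not at hcon
      nlinarith [mul_pos (sub_pos.2 hcon) (sub_pos.2 hγ)]
    · right
      have hle : ∑ x, ∑ y, w x y * (g x - g y) ^ 2 ≤ 0 := by
        rw [hdir]; nlinarith
      have hnn : ∀ x ∈ Finset.univ, 0 ≤ ∑ y, w x y * (g x - g y) ^ 2 := fun x _ =>
        Finset.sum_nonneg fun y _ => mul_nonneg (hw x y) (sq_nonneg _)
      have heq : ∀ x y, 0 < w x y → g x = g y := by
        intro x y hxy
        have a := (Finset.sum_eq_zero_iff_of_nonneg hnn).1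
          (le_antisymm hle (Finset.sum_nonneg hnn)) x (Finset.mem_univ x)
        have b := (Finset.sum_eq_zero_iff_of_nonneg
          (fun y _ => mul_nonneg (hw x y) (sq_nonneg _))).1 a y (Finset.mem_univ y)
        rcases mul_eq_zero.1 b with h | h
        · exact absurd h hxy.ne'
        · have := pow_eq_zero_iff (two_ne_zero) |>.1 h
          linarith
      by_cases hex : ∃ x, 0 < p x
      · obtain ⟨x₀, hx₀⟩ := hex
        have : ∀ x, p x * f x * g x = g x₀ * (p x * f x) := by
          intro x
          rcases (hp0 x).eq_or_lt with h | h
          · simp [← h]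
          · obtain ⟨z, h1, h2⟩ := hconn x x₀ h hx₀
            rw [heq x z h1, heq z x₀ h2]; ring
        simp_rw [this]
        rw [← Finset.mul_sum, hf, mul_zero]
      · push Not at hex
        refine Finset.sum_eq_zero fun x _ => ?_
        rw [le_antisymm (hex x) (hp0 x)]; simp

/-- From mean-zero functions to all functions. -/
lemma meanfree_abs {α : Type*} [Fintype α] (w : α → α → ℝ) (p : α → ℝ)
    (hw : ∀ x y, 0 ≤ w x y) (hs : ∀ x y, w x y = w y x) (hp : ∀ x, p x = ∑ y, w x y)
    (γ : ℝ)
    (h : ∀ f : α → ℝ, ∑ x, p x * f x = 0 →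
      ∑ x, ∑ y, w x y * f x * f y ≤ γ * ∑ x, p x * f x ^ 2) (g : α → ℝ) :
    ∑ x, ∑ y, w x y * g x * g y ≤
      γ * ∑ x, p x * g x ^ 2 + (1 - γ) * ((∑ x, p x * g x) ^ 2 / ∑ x, p x) := by
  have hp0 : ∀ x, 0 ≤ p x := fun x => by rw [hp]; exact Finset.sum_nonneg fun y _ => hw x y
  set D := ∑ x, p x with hD
  set m := ∑ x, p x * g x with hm
  have hD0 : 0 ≤ D := Finset.sum_nonneg fun x _ => hp0 x
  rcases hD0.eq_or_lt with hz | hpos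
  · have hall := (Finset.sum_eq_zero_iff_of_nonneg (fun x _ => hp0 x)).1 hz.symm
    have : m = 0 := Finset.sum_eq_zero fun x hx => by rw [hall x hx]; simp
    have h' := h g this
    rw [this]; simpa using h'
  have hDne := hpos.ne'
  have h' := h (fun x => g x - m / D) (by
    simp_rw [mul_sub]
    rw [Finset.sum_sub_distrib, ← Finset.sum_mul, ← hD, ← hm]; field_simp; ring)
  have a1 : ∑ x, p x * (g x - m / D) ^ 2 = ∑ x, p x * g x ^ 2 - m ^ 2 / D := by
    have : ∀ x, p x * (g x - m / D) ^ 2 =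
      p x * g x ^ 2 - 2 * (m / D) * (p x * g x) + (m / D) ^ 2 * p x := fun x => by ring
    simp_rw [this]
    rw [Finset.sum_add_distrib, Finset.sum_sub_distrib, ← Finset.mul_sum, ← Finset.mul_sum,
      ← hD, ← hm]
    field_simp; ring
  have b1 : ∑ x, ∑ y, w x y * g x = m := by
    refine Finset.sum_congr rfl fun x _ => ?_
    rw [← Finset.sum_mul, hp]
  have b2 : ∑ x, ∑ y, w x y * g y = m := by
    rw [Finset.sum_comm, ← b1]
    refine Finset.sum_congr rfl fun x _ => Finset.sum_congr rfl fun y _ => by rw [hs]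
  have b3 : ∑ x, ∑ y, w x y = D := by simp_rw [hD, hp]
  have a2 : ∑ x, ∑ y, w x y * (g x - m / D) * (g y - m / D) =
      ∑ x, ∑ y, w x y * g x * g y - m ^ 2 / D := by
    have : ∀ x y, w x y * (g x - m / D) * (g y - m / D) = w x y * g x * g y
      - (m / D) * (w x y * g x) - (m / D) * (w x y * g y) + (m / D) ^ 2 * w x y :=
      fun x y => by ring
    simp_rw [this, Finset.sum_add_distrib, Finset.sum_sub_distrib, ← Finset.mul_sum]
    rw [b1, b2, b3]; field_simp; ring
  rw [a1, a2] at h'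
  linarith

/-- Sum of `f` over the members of the family containing `τ`. -/
noncomputable def Sm (F : Finset (Finset V)) (τ : Finset V) (f : Finset V → ℝ) : ℝ :=
  ∑ S ∈ F, if τ ⊆ S then f S else 0

lemma Sm_star (F : Finset (Finset V)) (τ : Finset V) (f : Finset V → ℝ) (g : V → ℝ) :
    ∑ v ∈ τᶜ, Sm F (insert v τ) f * g v = Sm F τ (fun S => f S * ∑ v ∈ S \ τ, g v) := by
  unfold Sm
  simp_rw [Finset.sum_mul]
  rw [Finset.sum_comm]
  refine Finset.sum_congr rfl fun S _ => ?_
  by_cases h : τ ⊆ S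
  · rw [if_pos h, Finset.mul_sum]
    have : S \ τ = τᶜ.filter (fun v => insert v τ ⊆ S) := by
      ext v
      simp only [mem_sdiff, mem_filter, mem_compl, insert_subset_iff]
      tauto
    rw [this, Finset.sum_filter]
    refine Finset.sum_congr rfl fun v _ => ?_
    split_ifs <;> simp
  · rw [if_neg h]
    refine Finset.sum_eq_zero fun v _ => ?_
    rw [if_neg, zero_mul]
    exact fun h' => h ((subset_insert v τ).trans h')

/-- Weights of the link graph of `τ`. -/
noncomputable def wt (F : Finset (Finset V)) (τ : Finset V) (u v : V) : ℝ :=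
  Sm F τ (fun S => if u ∈ S \ τ ∧ v ∈ S \ τ ∧ u ≠ v then 1 else 0)

/-- Weighted degrees of the link graph of `τ`. -/
noncomputable def pt (F : Finset (Finset V)) (τ : Finset V) (v : V) : ℝ := ∑ u, wt F τ v u

lemma wt_nonneg (F : Finset (Finset V)) (τ : Finset V) (u v : V) : 0 ≤ wt F τ u v := by
  unfold wt Sm
  refine Finset.sum_nonneg fun S _ => ?_
  dsimp only
  split_ifs <;> first | exact zero_le_one | exact le_rfl

lemma wt_symm (F : Finset (Finset V)) (τ : Finset V) (u v : V) : wt F τ u v = wt F τ v u := by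
  unfold wt
  congr 1; funext S
  refine if_congr ?_ rfl rfl
  tauto

lemma pt_eq (F : Finset (Finset V)) (k : ℕ) (hF : ∀ S ∈ F, S.card = k) (τ : Finset V) (v : V) :
    pt F τ v = ((k : ℝ) - τ.card - 1) * Sm F τ (fun S => if v ∈ S \ τ then 1 else 0) := by
  unfold pt wt Sm
  rw [Finset.sum_comm, Finset.mul_sum]
  refine Finset.sum_congr rfl fun S hS => ?_
  by_cases h : τ ⊆ S
  · simp only [if_pos h]
    by_cases hv : v ∈ S \ τ
    · simp only [hv, true_and, if_true, mul_one]
      have : (univ.filter (fun u => u ∈ S \ τ ∧ v ≠ u)) = (S \ τ).erase v := by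
        ext u; simp [and_comm, eq_comm]
      rw [← Finset.sum_filter, Finset.sum_const, this, nsmul_eq_mul, mul_one,
        card_erase_of_mem hv, Nat.cast_sub (card_pos.2 ⟨v, hv⟩), card_sdiff_of_subset h,
        Nat.cast_sub (card_le_card h), hF S hS, Nat.cast_one]
    · simp [hv]
  · simp [h]

lemma pt_insert (F : Finset (Finset V)) (k : ℕ) (hF : ∀ S ∈ F, S.card = k) (τ : Finset V)
    (x v : V) (hx : x ∉ τ) :
    pt F (insert x τ) v = ((k : ℝ) - τ.card - 2) * wt F τ x v := by
  rw [pt_eq F k hF, card_insert_of_notMem hx]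
  have : Sm F (insert x τ) (fun S => if v ∈ S \ insert x τ then 1 else 0) = wt F τ x v := by
    unfold wt Sm
    refine Finset.sum_congr rfl fun S _ => ?_
    simp only [← ite_and]
    refine if_congr ?_ rfl rfl
    simp only [insert_subset_iff, mem_sdiff, mem_insert, ne_eq, not_or, eq_comm (a := x)]
    tauto
  rw [this]; push_cast; ring

lemma wt_insert (F : Finset (Finset V)) (k : ℕ) (hF : ∀ S ∈ F, S.card = k) (τ : Finset V)
    (u v : V) :
    ∑ x ∈ τᶜ, wt F (insert x τ) u v = ((k : ℝ) - τ.card - 2) * wt F τ u v := by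
  unfold wt Sm
  rw [Finset.sum_comm, Finset.mul_sum]
  refine Finset.sum_congr rfl fun S hS => ?_
  beta_reduce
  by_cases h : τ ⊆ S ∧ u ∈ S \ τ ∧ v ∈ S \ τ ∧ u ≠ v
  · rw [if_pos h.1, if_pos h.2, mul_one]
    obtain ⟨h1, h2, h3, h4⟩ := h
    simp only [← ite_and]
    have : (τᶜ.filter (fun x => insert x τ ⊆ S ∧ u ∈ S \ insert x τ ∧ v ∈ S \ insert x τ ∧ u ≠ v))
        = ((S \ τ).erase u).erase v := by
      ext x
      simp only [mem_sdiff] at h2 h3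
      simp only [mem_filter, mem_compl, mem_erase, mem_sdiff, insert_subset_iff, mem_insert,
        not_or, eq_comm (a := x)]
      tauto
    have hv : v ∈ (S \ τ).erase u := mem_erase.2 ⟨h4.symm, h3⟩
    have hc1 := card_erase_add_one hv
    have hc2 := card_erase_add_one h2
    have hc3 := card_sdiff_add_card_eq_card h1
    rw [hF S hS] at hc3
    rw [← Finset.sum_filter, Finset.sum_const, this, nsmul_eq_mul, mul_one]
    have : k = (((S \ τ).erase u).erase v).card + 1 + 1 + τ.card := by omega
    rw [this]; push_cast; ring
  · have e : (if τ ⊆ S then (if u ∈ S \ τ ∧ v ∈ S \ τ ∧ u ≠ v then (1:ℝ) else 0) else 0) = 0 := by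
      rw [← ite_and, if_neg h]
    rw [e, mul_zero]
    refine Finset.sum_eq_zero fun x _ => ?_
    rw [← ite_and, if_neg]
    rintro ⟨a, b, c, d⟩
    refine h ⟨(subset_insert x τ).trans a, ?_, ?_, d⟩
    · exact sdiff_subset_sdiff le_rfl (subset_insert x τ) b
    · exact sdiff_subset_sdiff le_rfl (subset_insert x τ) c

/-- The link graph of `τ` has second eigenvalue at most `γ`. -/
def LocalExp (F : Finset (Finset V)) (τ : Finset V) (γ : ℝ) : Prop :=
  ∀ g : V → ℝ, ∑ x, pt F τ x * g x = 0 →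
    ∑ x, ∑ y, wt F τ x y * g x * g y ≤ γ * ∑ x, pt F τ x * g x ^ 2

lemma wt_zero_of_mem (F : Finset (Finset V)) (τ : Finset V) (x v : V) (hx : x ∈ τ) :
    wt F τ x v = 0 := by
  unfold wt Sm
  refine Finset.sum_eq_zero fun S _ => ?_
  simp [hx]

lemma trickle (F : Finset (Finset V)) (k : ℕ) (hF : ∀ S ∈ F, S.card = k) (τ : Finset V)
    (hτ : τ.card + 3 ≤ k) (γ c : ℝ) (hγ : γ < 1) (hc : γ = c * (1 - γ))
    (hconn : ∀ x y, 0 < pt F τ x → 0 < pt F τ y → ∃ z, 0 < wt F τ x z ∧ 0 < wt F τ z y)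
    (h : ∀ x ∉ τ, LocalExp F (insert x τ) γ) : LocalExp F τ c := by
  intro f hf
  refine trickle_abs (wt F τ) (pt F τ) (wt_nonneg F τ) (wt_symm F τ) (fun _ => rfl) γ c hγ hc
    hconn ?_ f hf
  intro g
  have hr : (0:ℝ) < (k : ℝ) - τ.card - 2 := by
    have : ((τ.card + 3 : ℕ) : ℝ) ≤ k := by exact_mod_cast hτ
    push_cast at this; linarith
  set r : ℝ := (k : ℝ) - τ.card - 2 with hrdef
  have h1 : ∀ x ∈ τᶜ, ∑ u, ∑ v, wt F (insert x τ) u v * g u * g v ≤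
      γ * (r * ∑ v, wt F τ x v * g v ^ 2) +
      (1 - γ) * (r * ((∑ v, wt F τ x v * g v) ^ 2 / pt F τ x)) := by
    intro x hx
    have hx' : x ∉ τ := mem_compl.1 hx
    have := meanfree_abs (wt F (insert x τ)) (pt F (insert x τ)) (wt_nonneg F _) (wt_symm F _)
      (fun _ => rfl) γ (h x hx') g
    simp_rw [pt_insert F k hF τ x _ hx', ← hrdef, mul_assoc r, ← Finset.mul_sum] at this
    refine this.trans (le_of_eq ?_)
    have e : ∑ v, wt F τ x v = pt F τ x := rfl
    rw [e]
    congr 2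
    by_cases hp : pt F τ x = 0
    · simp [hp]
    field_simp
  have h2 := Finset.sum_le_sum h1
  have e1 : ∑ x ∈ τᶜ, ∑ u, ∑ v, wt F (insert x τ) u v * g u * g v =
      r * ∑ u, ∑ v, wt F τ u v * g u * g v := by
    rw [Finset.sum_comm, Finset.mul_sum]
    refine Finset.sum_congr rfl fun u _ => ?_
    rw [Finset.sum_comm, Finset.mul_sum]
    refine Finset.sum_congr rfl fun v _ => ?_
    rw [← Finset.sum_mul, ← Finset.sum_mul, wt_insert F k hF]; ring
  have e2 : ∑ x ∈ τᶜ, ∑ v, wt F τ x v * g v ^ 2 = ∑ v, pt F τ v * g v ^ 2 := by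
    rw [Finset.sum_subset (Finset.subset_univ τᶜ)]
    · rw [Finset.sum_comm]
      refine Finset.sum_congr rfl fun v _ => ?_
      rw [← Finset.sum_mul]; unfold pt
      congr 1
      exact Finset.sum_congr rfl fun x _ => wt_symm F τ x v
    · intro x _ hx
      refine Finset.sum_eq_zero fun v _ => ?_
      rw [wt_zero_of_mem F τ x v (by simpa using hx), zero_mul]
  have e3 : ∑ x ∈ τᶜ, (∑ v, wt F τ x v * g v) ^ 2 / pt F τ x =
      ∑ x, (∑ v, wt F τ x v * g v) ^ 2 / pt F τ x := by
    refine Finset.sum_subset (Finset.subset_univ τᶜ) ?_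
    intro x _ hx
    have : ∀ v, wt F τ x v = 0 := fun v => wt_zero_of_mem F τ x v (by simpa using hx)
    simp [this]
  rw [Finset.sum_add_distrib, ← Finset.mul_sum, ← Finset.mul_sum, ← Finset.mul_sum,
    ← Finset.mul_sum, e1, e2, e3] at h2
  refine le_of_mul_le_mul_left ?_ hr
  linarith

lemma Sm_filter (F : Finset (Finset V)) (τ : Finset V) (f : Finset V → ℝ) :
    Sm F τ f = ∑ S ∈ F.filter (fun S => τ ⊆ S), f S := by
  unfold Sm; rw [Finset.sum_filter]

lemma Sm_mul (F : Finset (Finset V)) (τ : Finset V) (c : ℝ) (f : Finset V → ℝ) :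
    Sm F τ (fun S => c * f S) = c * Sm F τ f := by
  simp only [Sm_filter, Finset.mul_sum]

lemma Sm_add (F : Finset (Finset V)) (τ : Finset V) (f g : Finset V → ℝ) :
    Sm F τ (fun S => f S + g S) = Sm F τ f + Sm F τ g := by
  simp only [Sm_filter, Finset.sum_add_distrib]

lemma Sm_sub (F : Finset (Finset V)) (τ : Finset V) (f g : Finset V → ℝ) :
    Sm F τ (fun S => f S - g S) = Sm F τ f - Sm F τ g := by
  simp only [Sm_filter, Finset.sum_sub_distrib]

lemma Sm_nonneg (F : Finset (Finset V)) (τ : Finset V) (f : Finset V → ℝ) (hf : ∀ S, 0 ≤ f S) :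
    0 ≤ Sm F τ f := by
  rw [Sm_filter]; exact Finset.sum_nonneg fun S _ => hf S

lemma Sm_cs (F : Finset (Finset V)) (τ : Finset V) (f g : Finset V → ℝ) :
    Sm F τ (fun S => f S * g S) ^ 2 ≤ Sm F τ (fun S => f S ^ 2) * Sm F τ (fun S => g S ^ 2) := by
  simp only [Sm_filter]
  exact Finset.sum_mul_sq_le_sq_mul_sq _ _ _

lemma Sm_one_zero (F : Finset (Finset V)) (τ : Finset V) (f : Finset V → ℝ)
    (h : Sm F τ (fun _ => 1) = 0) : Sm F τ f = 0 := by
  rw [Sm_filter] at h ⊢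
  simp only [sum_const, nsmul_eq_mul, mul_one, Nat.cast_eq_zero, card_eq_zero] at h
  rw [h, Finset.sum_empty]

lemma Sm_up (F : Finset (Finset V)) (k : ℕ) (hF : ∀ S ∈ F, S.card = k) (τ : Finset V)
    (f : Finset V → ℝ) :
    ∑ v ∈ τᶜ, Sm F (insert v τ) f = ((k : ℝ) - τ.card) * Sm F τ f := by
  have := Sm_star F τ f (fun _ => 1)
  simp only [mul_one] at this
  rw [this, ← Sm_mul]
  unfold Sm
  refine Finset.sum_congr rfl fun S hS => ?_
  by_cases h : τ ⊆ S
  · simp only [if_pos h, sum_const, nsmul_eq_mul, mul_one]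
    rw [card_sdiff_of_subset h, Nat.cast_sub (card_le_card h), hF S hS]; ring
  · simp [h]

lemma pt_sum (F : Finset (Finset V)) (k : ℕ) (hF : ∀ S ∈ F, S.card = k) (τ : Finset V)
    (g : V → ℝ) :
    ∑ v, pt F τ v * g v = ((k : ℝ) - τ.card - 1) * Sm F τ (fun S => ∑ v ∈ S \ τ, g v) := by
  simp_rw [pt_eq F k hF, mul_assoc, ← Finset.mul_sum]
  congr 1
  simp only [Sm_filter, Finset.sum_mul]
  rw [Finset.sum_comm]
  refine Finset.sum_congr rfl fun S _ => ?_
  simp only [ite_mul, one_mul, zero_mul]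
  rw [← Finset.sum_filter]
  congr 1
  ext; simp

lemma wt_sum (F : Finset (Finset V)) (τ : Finset V) (g : V → ℝ) :
    ∑ u, ∑ v, wt F τ u v * g u * g v =
      Sm F τ (fun S => (∑ v ∈ S \ τ, g v) ^ 2 - ∑ v ∈ S \ τ, g v ^ 2) := by
  unfold wt
  simp only [Sm_filter, Finset.sum_mul]
  calc _ = ∑ u, ∑ S ∈ F with τ ⊆ S, ∑ v,
        (if u ∈ S \ τ ∧ v ∈ S \ τ ∧ u ≠ v then (1:ℝ) else 0) * g u * g v := by
        refine Finset.sum_congr rfl fun u _ => Finset.sum_comm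
    _ = ∑ S ∈ F with τ ⊆ S, ∑ u, ∑ v,
        (if u ∈ S \ τ ∧ v ∈ S \ τ ∧ u ≠ v then (1:ℝ) else 0) * g u * g v := Finset.sum_comm
    _ = _ := by
      refine Finset.sum_congr rfl fun S _ => ?_
      have a : ∀ T : Finset V, ∀ h : V → ℝ, ∑ v ∈ T, h v = ∑ v, if v ∈ T then h v else 0 := by
        intro T h; simp
      rw [sq, Finset.sum_mul_sum, ← Finset.sum_sub_distrib, a (S \ τ)]
      refine Finset.sum_congr rfl fun u _ => ?_
      by_cases hu : u ∈ S \ τ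
      · rw [if_pos hu, a (S \ τ)]
        have : g u ^ 2 = ∑ v, if v = u then g u ^ 2 else 0 := by simp
        rw [this, ← Finset.sum_sub_distrib]
        refine Finset.sum_congr rfl fun v _ => ?_
        by_cases huv : v = u
        · subst huv; rw [if_pos hu]; simp [sq]
        · have h2 : u ≠ v := fun h => huv h.symm
          by_cases hv : v ∈ S \ τ
          · rw [if_pos ⟨hu, hv, h2⟩, if_pos hv, if_neg huv]; ring
          · rw [if_neg (fun h => hv h.2.1), if_neg hv, if_neg huv]; ring
      · rw [if_neg hu]
        refine Finset.sum_eq_zero fun v _ => ?_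
        rw [if_neg (fun h => hu h.1)]; ring

/-- Unnormalised variance of `f` over the members of the family containing `τ`. -/
noncomputable def Wr (F : Finset (Finset V)) (f : Finset V → ℝ) (τ : Finset V) : ℝ :=
  Sm F τ (fun S => f S ^ 2) - Sm F τ f ^ 2 / Sm F τ (fun _ => 1)

lemma var_step (F : Finset (Finset V)) (k : ℕ) (hF : ∀ S ∈ F, S.card = k) (τ : Finset V)
    (hτ : τ.card + 2 ≤ k) (γ : ℝ) (hγ : 0 ≤ γ) (hl : LocalExp F τ γ) (f : Finset V → ℝ) :
    ((k : ℝ) - τ.card - 1) * (1 - γ) * Wr F f τ ≤ ∑ v ∈ τᶜ, Wr F f (insert v τ) := by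
  have hr : (1:ℝ) ≤ (k : ℝ) - τ.card - 1 := by
    have : ((τ.card + 2 : ℕ) : ℝ) ≤ k := by exact_mod_cast hτ
    push_cast at this; linarith
  set r : ℝ := (k : ℝ) - τ.card with hrdef
  set N := Sm F τ (fun _ => 1) with hN
  set m := Sm F τ f / N with hm
  set n : V → ℝ := fun v => Sm F (insert v τ) (fun _ => 1) with hn
  set φ : V → ℝ := fun v => Sm F (insert v τ) f with hφ
  set g : V → ℝ := fun v => φ v / n v - m with hg
  have hmN : m * N = Sm F τ f := by
    by_cases h : N = 0
    · rw [h, Sm_one_zero F τ f h, mul_zero]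
    · rw [hm, div_mul_cancel₀ _ h]
  have hng : ∀ v, n v * g v = φ v - m * n v := by
    intro v
    simp only [hg]
    by_cases h : n v = 0
    · have : φ v = 0 := Sm_one_zero F _ f h
      rw [h, this]; ring
    · field_simp
  have hup1 : ∑ v ∈ τᶜ, φ v = r * Sm F τ f := Sm_up F k hF τ f
  have hup2 : ∑ v ∈ τᶜ, n v = r * N := Sm_up F k hF τ _
  have hup3 := Sm_up F k hF τ (fun S => f S ^ 2)
  have h1 : ∑ v ∈ τᶜ, n v * g v = 0 := by
    simp_rw [hng]
    rw [Finset.sum_sub_distrib, ← Finset.mul_sum, hup1, hup2, ← hmN]; ring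
  have h1' : Sm F τ (fun S => ∑ v ∈ S \ τ, g v) = 0 := by
    have := Sm_star F τ (fun _ => 1) g
    simp only [one_mul] at this
    rw [← this]; exact h1
  set T := ∑ v ∈ τᶜ, n v * g v ^ 2 with hT
  have hT' : Sm F τ (fun S => ∑ v ∈ S \ τ, g v ^ 2) = T := by
    have := Sm_star F τ (fun _ => 1) (fun v => g v ^ 2)
    simp only [one_mul] at this
    rw [← this]
  have hT0 : 0 ≤ T := by
    rw [← hT']; exact Sm_nonneg _ _ _ fun S => Finset.sum_nonneg fun v _ => sq_nonneg _
  have h2 : T = ∑ v ∈ τᶜ, φ v * g v := by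
    have : ∀ v, n v * g v ^ 2 = φ v * g v - m * (n v * g v) := by
      intro v
      linear_combination g v * hng v
    rw [hT]; simp_rw [this]
    rw [Finset.sum_sub_distrib, ← Finset.mul_sum, h1]; ring
  have h2' : T = Sm F τ (fun S => f S * ∑ v ∈ S \ τ, g v) := by
    rw [h2]; exact Sm_star F τ f g
  have h4 : T = ∑ v ∈ τᶜ, φ v ^ 2 / n v - r * (Sm F τ f ^ 2 / N) := by
    have : ∀ v, φ v * g v = φ v ^ 2 / n v - m * φ v := by
      intro v; simp only [hg]; ring
    rw [h2]; simp_rw [this]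
    rw [Finset.sum_sub_distrib, ← Finset.mul_sum, hup1, hm]; ring
  have h3 : T = Sm F τ (fun S => (f S - m) * ∑ v ∈ S \ τ, g v) := by
    simp_rw [sub_mul]
    rw [Sm_sub, Sm_mul, h1', ← h2']; ring
  have hW : Sm F τ (fun S => (f S - m) ^ 2) = Wr F f τ := by
    have : ∀ S, (f S - m) ^ 2 = f S ^ 2 - (2 * m) * f S + m ^ 2 * 1 := fun S => by ring
    simp_rw [this]
    rw [Sm_add, Sm_sub, Sm_mul, Sm_mul, ← hN, Wr, ← hN]
    have e : Sm F τ f ^ 2 / N = m * Sm F τ f := by rw [hm]; ring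
    rw [e, ← hmN]; ring
  have hW0 : 0 ≤ Wr F f τ := by rw [← hW]; exact Sm_nonneg _ _ _ fun S => sq_nonneg _
  have hcs := Sm_cs F τ (fun S => f S - m) (fun S => ∑ v ∈ S \ τ, g v)
  rw [← h3, hW] at hcs
  have hloc := hl g (by rw [pt_sum F k hF, h1', mul_zero])
  rw [wt_sum, Sm_sub, pt_sum F k hF τ (fun v => g v ^ 2), hT', ← hrdef] at hloc
  have h5 : T ≤ (1 + γ * (r - 1)) * Wr F f τ := by
    rcases hT0.eq_or_lt with h | h
    · rw [← h]; have : 0 ≤ γ * (r - 1) := mul_nonneg hγ (by linarith)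
      positivity
    · have : T * T ≤ ((1 + γ * (r - 1)) * Wr F f τ) * T := by
        calc T * T = T ^ 2 := by ring
          _ ≤ _ := hcs
          _ ≤ Wr F f τ * (T + γ * ((r - 1) * T)) :=
            mul_le_mul_of_nonneg_left (by linarith) hW0
          _ = _ := by ring
      exact le_of_mul_le_mul_right this h
  have h6 : ∑ v ∈ τᶜ, Wr F f (insert v τ) = r * Wr F f τ - T := by
    unfold Wr
    rw [Finset.sum_sub_distrib, hup3, h4, ← hrdef, ← hN]
    ring
  rw [h6]
  linarith

lemma var_main (F : Finset (Finset V)) (k : ℕ) (hF : ∀ S ∈ F, S.card = k)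
    (hl : ∀ τ : Finset V, τ.card + 2 ≤ k → LocalExp F τ (1 / ((τ.card : ℝ) + 2)))
    (f : Finset V → ℝ) (d : ℕ) : ∀ τ : Finset V, τ.card + 1 + d = k →
    ((τ.card : ℝ) + 1) * Wr F f τ ≤ k * Sm (powersetCard (k - 1) univ) τ (Wr F f) := by
  induction d with
  | zero =>
    intro τ hτ
    have : Sm (powersetCard (k - 1) univ) τ (Wr F f) = Wr F f τ := by
      rw [Sm_filter, Finset.sum_eq_single τ]
      · intro S hS hne
        rw [mem_filter, mem_powersetCard] at hS
        exact absurd (eq_of_subset_of_card_le hS.2 (by omega)).symm hne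
      · intro h
        refine absurd ?_ h
        rw [mem_filter, mem_powersetCard]
        exact ⟨⟨subset_univ _, by omega⟩, subset_rfl⟩
    rw [this, ← hτ]; push_cast; simp
  | succ d ih =>
    intro τ hτ
    set E := Sm (powersetCard (k - 1) univ) τ (Wr F f) with hE
    have hs := var_step F k hF τ (by omega) _ (by positivity) (hl τ (by omega)) f
    have hup := Sm_up (powersetCard (k - 1) (univ : Finset V)) (k - 1)
      (fun S hS => (mem_powersetCard.1 hS).2) τ (Wr F f)
    have h1 : ∑ v ∈ τᶜ, ((τ.card : ℝ) + 2) * Wr F f (insert v τ) ≤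
        ∑ v ∈ τᶜ, (k : ℝ) * Sm (powersetCard (k - 1) univ) (insert v τ) (Wr F f) := by
      refine Finset.sum_le_sum fun v hv => ?_
      have hc := card_insert_of_notMem (mem_compl.1 hv)
      have := ih (insert v τ) (by omega)
      rw [hc] at this; push_cast at this
      linarith
    rw [← Finset.mul_sum, ← Finset.mul_sum, hup, ← hE] at h1
    have hk : (k : ℝ) = τ.card + 1 + (d + 1) := by exact_mod_cast hτ.symm
    have hk1 : ((k - 1 : ℕ) : ℝ) = (k : ℝ) - 1 := by
      rw [Nat.cast_sub (by omega)]; simp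
    rw [hk1] at h1
    have hj : (0:ℝ) ≤ τ.card := by positivity
    have h2 : ((τ.card : ℝ) + 2) * (((k : ℝ) - τ.card - 1) * (1 - 1 / ((τ.card : ℝ) + 2)) *
      Wr F f τ) ≤ k * (((k : ℝ) - 1 - τ.card) * E) :=
      (mul_le_mul_of_nonneg_left hs (by linarith)).trans h1
    have e : ((τ.card : ℝ) + 2) * (((k : ℝ) - τ.card - 1) * (1 - 1 / ((τ.card : ℝ) + 2)) *
      Wr F f τ) = ((k : ℝ) - 1 - τ.card) * ((τ.card + 1) * Wr F f τ) := by
      field_simp; ring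
    rw [e] at h2
    have hpos : (0:ℝ) < (k : ℝ) - 1 - τ.card := by rw [hk]; linarith [Nat.cast_nonneg (α := ℝ) d]
    refine le_of_mul_le_mul_left ?_ hpos
    linarith

/-- Independence of a vertex set. -/
def Ind (G : SimpleGraph V) (σ : Finset V) : Prop := ∀ u ∈ σ, ∀ v ∈ σ, ¬ G.Adj u v

lemma mem_IndepSets (G : SimpleGraph V) [DecidableRel G.Adj] (k : ℕ) (S : Finset V) :
    S ∈ IndepSets G k ↔ S.card = k ∧ Ind G S := by
  simp [IndepSets, Ind]

/-- Closed neighbourhood of a vertex set. -/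
def cn (G : SimpleGraph V) [DecidableRel G.Adj] (σ : Finset V) : Finset V :=
  σ.biUnion (fun x => insert x (G.neighborFinset x))

lemma mem_cn (G : SimpleGraph V) [DecidableRel G.Adj] (σ : Finset V) (z : V) :
    z ∈ cn G σ ↔ ∃ x ∈ σ, z = x ∨ G.Adj x z := by
  simp [cn]

lemma card_cn (G : SimpleGraph V) [DecidableRel G.Adj] (σ : Finset V) :
    (cn G σ).card ≤ σ.card * (G.maxDegree + 1) := by
  refine card_biUnion_le_card_mul _ _ _ fun x _ => ?_
  refine (card_insert_le _ _).trans ?_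
  have := G.degree_le_maxDegree x
  rw [← G.card_neighborFinset_eq_degree x] at this
  omega

lemma Ind_insert (G : SimpleGraph V) [DecidableRel G.Adj] (σ : Finset V) (hσ : Ind G σ) (z : V)
    (hz : z ∉ cn G σ) : Ind G (insert z σ) := by
  rw [mem_cn] at hz
  push Not at hz
  intro u hu v hv
  rw [mem_insert] at hu hv
  rcases hu with rfl | hu <;> rcases hv with rfl | hv
  · exact G.loopless.irrefl _
  · exact fun h => (hz v hv).2 h.symm
  · exact (hz u hu).2
  · exact hσ u hu v hv

lemma not_mem_cn_of_Ind (G : SimpleGraph V) [DecidableRel G.Adj] (σ : Finset V) (z : V)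
    (hz : z ∉ σ) (h : Ind G (insert z σ)) : z ∉ cn G σ := by
  rw [mem_cn]
  rintro ⟨x, hx, rfl | h'⟩
  · exact hz hx
  · exact h x (mem_insert_of_mem hx) z (mem_insert_self _ _) h'

lemma Ind_mono (G : SimpleGraph V) {σ τ : Finset V} (h : σ ⊆ τ) (hτ : Ind G τ) : Ind G σ :=
  fun u hu v hv => hτ u (h hu) v (h hv)

lemma exists_not_cn (G : SimpleGraph V) [DecidableRel G.Adj] (k : ℕ)
    (hn : k * (G.maxDegree + 1) ≤ Fintype.card V) (σ : Finset V) (hσ : σ.card < k) :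
    ∃ z, z ∉ cn G σ := by
  by_contra h
  push Not at h
  have h1 : (cn G σ) = univ := eq_univ_of_forall h
  have h2 := card_cn G σ
  rw [h1, card_univ] at h2
  have : σ.card * (G.maxDegree + 1) < k * (G.maxDegree + 1) :=
    Nat.mul_lt_mul_of_pos_right hσ (Nat.succ_pos _)
  omega

lemma ind_extend (G : SimpleGraph V) [DecidableRel G.Adj] (k : ℕ)
    (hn : k * (G.maxDegree + 1) ≤ Fintype.card V) (d : ℕ) : ∀ σ : Finset V, Ind G σ →
    σ.card + d = k → ∃ S ∈ IndepSets G k, σ ⊆ S := by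
  induction d with
  | zero => exact fun σ hσ hc => ⟨σ, (mem_IndepSets G k σ).2 ⟨hc, hσ⟩, subset_rfl⟩
  | succ d ih =>
    intro σ hσ hc
    obtain ⟨z, hz⟩ := exists_not_cn G k hn σ (by omega)
    have hz' : z ∉ σ := fun h => hz ((mem_cn G σ z).2 ⟨z, h, Or.inl rfl⟩)
    obtain ⟨S, hS, hs⟩ := ih (insert z σ) (Ind_insert G σ hσ z hz)
      (by rw [card_insert_of_notMem hz']; omega)
    exact ⟨S, hS, (subset_insert _ _).trans hs⟩

lemma wt_pos (G : SimpleGraph V) [DecidableRel G.Adj] (k : ℕ)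
    (hn : k * (G.maxDegree + 1) ≤ Fintype.card V) (τ : Finset V) (hτ : τ.card + 2 ≤ k)
    (x y : V) (hx : x ∉ τ) (hy : y ∉ τ) (hxy : x ≠ y) (h : Ind G (insert x (insert y τ))) :
    0 < wt (IndepSets G k) τ x y := by
  have hc : (insert x (insert y τ)).card ≤ k := by
    have := card_insert_le x (insert y τ)
    have := card_insert_le y τ
    omega
  obtain ⟨S, hS, hs⟩ := ind_extend G k hn (k - (insert x (insert y τ)).card) _ h (by omega)
  unfold wt Sm
  rw [insert_subset_iff, insert_subset_iff] at hs
  refine Finset.sum_pos' (fun S _ => ?_) ⟨S, hS, ?_⟩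
  · dsimp only
    split_ifs <;> first | exact zero_le_one | exact le_rfl
  · rw [if_pos hs.2.2]
    beta_reduce
    rw [if_pos]
    · exact one_pos
    · simp [hx, hy, hxy, hs.1, hs.2.1]

lemma of_wt_pos (G : SimpleGraph V) [DecidableRel G.Adj] (k : ℕ) (τ : Finset V)
    (x y : V) (h : wt (IndepSets G k) τ x y ≠ 0) :
    x ∉ τ ∧ y ∉ τ ∧ x ≠ y ∧ Ind G (insert x (insert y τ)) := by
  unfold wt Sm at h
  obtain ⟨S, hS, hs⟩ := Finset.exists_ne_zero_of_sum_ne_zero h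
  rw [← ite_and] at hs
  have hs' := of_not_not fun h' => hs (if_neg h')
  simp only [mem_sdiff] at hs'
  refine ⟨hs'.2.1.2, hs'.2.2.1.2, hs'.2.2.2, Ind_mono G ?_ ((mem_IndepSets G k S).1 hS).2⟩
  rw [insert_subset_iff, insert_subset_iff]
  exact ⟨hs'.2.1.1, hs'.2.2.1.1, hs'.1⟩

lemma of_pt_pos (G : SimpleGraph V) [DecidableRel G.Adj] (k : ℕ) (τ : Finset V)
    (x : V) (h : pt (IndepSets G k) τ x ≠ 0) : x ∉ τ ∧ Ind G (insert x τ) := by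
  obtain ⟨y, _, hy⟩ := Finset.exists_ne_zero_of_sum_ne_zero h
  have := of_wt_pos G k τ x y hy
  exact ⟨this.1, Ind_mono G (insert_subset_insert _ (subset_insert _ _)) this.2.2.2⟩

lemma conn (G : SimpleGraph V) [DecidableRel G.Adj] (k : ℕ)
    (hn : k * (G.maxDegree + 1) ≤ Fintype.card V) (τ : Finset V) (hτ : τ.card + 3 ≤ k)
    (x y : V) (hx : 0 < pt (IndepSets G k) τ x) (hy : 0 < pt (IndepSets G k) τ y) :
    ∃ z, 0 < wt (IndepSets G k) τ x z ∧ 0 < wt (IndepSets G k) τ z y := by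
  obtain ⟨hx1, hx2⟩ := of_pt_pos G k τ x hx.ne'
  obtain ⟨hy1, hy2⟩ := of_pt_pos G k τ y hy.ne'
  obtain ⟨z, hz⟩ := exists_not_cn G k hn (insert x (insert y τ)) (by
    have := card_insert_le x (insert y τ)
    have := card_insert_le y τ
    omega)
  have mono : ∀ a b : Finset V, a ⊆ b → cn G a ⊆ cn G b := fun a b h =>
    biUnion_subset_biUnion_of_subset_left _ h
  have self : ∀ a : Finset V, a ⊆ cn G a := fun a w hw => (mem_cn G a w).2 ⟨w, hw, Or.inl rfl⟩
  have hzs : z ∉ insert x (insert y τ) := fun h => hz (self _ h)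
  simp only [mem_insert, not_or] at hzs
  have hzx := Ind_insert G _ hx2 z (fun h => hz (mono _ _
    (insert_subset_insert _ (subset_insert _ _)) h))
  have hzy := Ind_insert G _ hy2 z (fun h => hz (mono _ _ (subset_insert _ _) h))
  refine ⟨z, ?_, ?_⟩
  · rw [wt_symm]
    exact wt_pos G k hn τ (by omega) z x hzs.2.2 hx1 hzs.1 hzx
  · exact wt_pos G k hn τ (by omega) z y hzs.2.2 hy1 hzs.2.1 hzy

lemma lamMin_bdd (G : SimpleGraph V) [DecidableRel G.Adj] :
    BddBelow { r : ℝ | ∃ f : V → ℝ, (∑ x, f x ^ 2) ≠ 0 ∧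
    r = (∑ x, f x * ∑ y, G.adjMatrix ℝ x y * f y) / (∑ x, f x ^ 2) } := by
  refine ⟨-(Fintype.card V : ℝ), ?_⟩
  rintro r ⟨f, hf, rfl⟩
  have h0 : 0 ≤ ∑ x, f x ^ 2 := Finset.sum_nonneg fun x _ => sq_nonneg _
  have hpos : 0 < ∑ x, f x ^ 2 := lt_of_le_of_ne h0 hf.symm
  rw [le_div_iff₀ hpos]
  have h1 : ∀ x y, -(f x ^ 2 / 2 + f y ^ 2 / 2) ≤ f x * (G.adjMatrix ℝ x y * f y) := by
    intro x y
    rw [SimpleGraph.adjMatrix_apply]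
    split_ifs <;> nlinarith [sq_nonneg (f x + f y), sq_nonneg (f x), sq_nonneg (f y)]
  calc -(Fintype.card V : ℝ) * ∑ x, f x ^ 2 = ∑ x, ∑ y, -(f x ^ 2 / 2 + f y ^ 2 / 2) := by
        simp only [Finset.sum_neg_distrib, Finset.sum_add_distrib, Finset.sum_const, nsmul_eq_mul,
          ← Finset.sum_div, ← Finset.mul_sum, card_univ]
        ring
    _ ≤ _ := by
        refine Finset.sum_le_sum fun x _ => ?_
        rw [Finset.mul_sum]
        exact Finset.sum_le_sum fun y _ => h1 x y

lemma lamMin_form (G : SimpleGraph V) [DecidableRel G.Adj] (g : V → ℝ) :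
    -|lamMin (G.adjMatrix ℝ)| * ∑ x, g x ^ 2 ≤ ∑ x, g x * ∑ y, G.adjMatrix ℝ x y * g y := by
  by_cases h : ∑ x, g x ^ 2 = 0
  · have hall := (Finset.sum_eq_zero_iff_of_nonneg (fun x _ => sq_nonneg (g x))).1 h
    have : ∀ x, g x = 0 := fun x => by simpa using hall x (Finset.mem_univ x)
    simp [this]
  · have hpos : 0 < ∑ x, g x ^ 2 :=
      lt_of_le_of_ne (Finset.sum_nonneg fun x _ => sq_nonneg _) (Ne.symm h)
    rw [← le_div_iff₀ hpos]
    exact (neg_abs_le _).trans (csInf_le (lamMin_bdd G) ⟨g, h, rfl⟩)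

lemma one_le_lamMin (G : SimpleGraph V) [DecidableRel G.Adj] (hE : ∃ u v, G.Adj u v) :
    1 ≤ |lamMin (G.adjMatrix ℝ)| := by
  obtain ⟨u, v, huv⟩ := hE
  have hne : u ≠ v := huv.ne
  have h := lamMin_form G (fun x => (if x = u then 1 else 0) - (if x = v then 1 else 0))
  have e1 : ∑ x, ((if x = u then (1:ℝ) else 0) - (if x = v then 1 else 0)) ^ 2 = 2 := by
    have : ∀ x, ((if x = u then (1:ℝ) else 0) - (if x = v then 1 else 0)) ^ 2 =
        (if x = u then (1:ℝ) else 0) + (if x = v then 1 else 0) := by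
      intro x
      by_cases h1 : x = u
      · subst h1; simp [hne]
      · simp [h1]
    simp_rw [this, Finset.sum_add_distrib]
    simp; norm_num
  have e2 : ∑ x, ((if x = u then (1:ℝ) else 0) - (if x = v then 1 else 0)) *
      ∑ y, G.adjMatrix ℝ x y * ((if y = u then (1:ℝ) else 0) - (if y = v then 1 else 0)) = -2 := by
    have e3 : ∀ x, ∑ y, G.adjMatrix ℝ x y *
        ((if y = u then (1:ℝ) else 0) - (if y = v then 1 else 0)) =
        G.adjMatrix ℝ x u - G.adjMatrix ℝ x v := by
      intro x; simp [mul_sub, Finset.sum_sub_distrib]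
    simp_rw [e3, sub_mul]
    simp [Finset.sum_sub_distrib, huv, huv.symm]
    norm_num
  rw [e1, e2] at h
  linarith

lemma base_case (G : SimpleGraph V) [DecidableRel G.Adj] (k : ℕ) (τ : Finset V)
    (hτ : τ.card + 2 = k) (L : ℝ) (hk1 : k * (G.maxDegree + 1) ≤ Fintype.card V)
    (hkn : (k : ℝ) * (G.maxDegree + L) ≤ Fintype.card V)
    (hL : ∀ g : V → ℝ, -L * ∑ x, g x ^ 2 ≤ ∑ x, g x * ∑ y, G.adjMatrix ℝ x y * g y) :
    LocalExp (IndepSets G k) τ (1 / (k : ℝ)) := by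
  intro f hf
  have hk0 : (2:ℝ) ≤ k := by exact_mod_cast (by omega : 2 ≤ k)
  by_cases hI : Ind G τ
  swap
  · have h0 : ∀ x y, wt (IndepSets G k) τ x y = 0 := by
      intro x y
      by_contra h
      exact hI (Ind_mono G ((subset_insert _ _).trans (subset_insert _ _))
        (of_wt_pos G k τ x y h).2.2.2)
    have hp0 : ∀ x, pt (IndepSets G k) τ x = 0 := fun x => Finset.sum_eq_zero fun y _ => h0 x y
    simp [h0, hp0]
  set w := wt (IndepSets G k) τ with hw
  set p := pt (IndepSets G k) τ with hp
  have hself : ∀ a : Finset V, a ⊆ cn G a := fun a w hw => (mem_cn G a w).2 ⟨w, hw, Or.inl rfl⟩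
  have hw1 : ∀ x y, w x y = if x ∉ cn G τ ∧ y ∉ cn G τ ∧ x ≠ y ∧ ¬ G.Adj x y then 1 else 0 := by
    intro x y
    split_ifs with h
    · obtain ⟨h1, h2, h3, h4⟩ := h
      have hx : x ∉ τ := fun h => h1 (hself _ h)
      have hy : y ∉ τ := fun h => h2 (hself _ h)
      have hy' := Ind_insert G τ hI y h2
      have hxy : Ind G (insert x (insert y τ)) := by
        refine Ind_insert G _ hy' x ?_
        rw [mem_cn] at h1 ⊢
        rintro ⟨a, ha, h5⟩
        rw [mem_insert] at ha
        rcases ha with rfl | ha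
        · rcases h5 with h5 | h5
          · exact h3 h5
          · exact h4 h5.symm
        · exact h1 ⟨a, ha, h5⟩
      have hc : (insert x (insert y τ)).card = k := by
        rw [card_insert_of_notMem, card_insert_of_notMem hy, ← hτ]
        simp [h3, hx]
      rw [hw]; unfold wt Sm
      rw [Finset.sum_eq_single (insert x (insert y τ))]
      · rw [if_pos ((subset_insert _ _).trans (subset_insert _ _))]
        beta_reduce
        rw [if_pos]
        simp [hx, hy, h3]
      · intro S hS hne
        rw [← ite_and, if_neg]
        rintro ⟨a, b, c, d⟩
        rw [mem_sdiff] at b c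
        refine hne (eq_of_subset_of_card_le ?_ ?_).symm
        · rw [insert_subset_iff, insert_subset_iff]; exact ⟨b.1, c.1, a⟩
        · rw [hc, ((mem_IndepSets G k S).1 hS).1]
      · intro h
        exact absurd ((mem_IndepSets G k _).2 ⟨hc, hxy⟩) h
    · by_contra h'
      obtain ⟨a, b, c, d⟩ := of_wt_pos G k τ x y h'
      refine h ⟨not_mem_cn_of_Ind G τ x a (Ind_mono G (insert_subset_insert _ (subset_insert _ _)) d),
        not_mem_cn_of_Ind G τ y b (Ind_mono G (subset_insert _ _) d), c, ?_⟩
      exact d x (by simp) y (by simp)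
  have hp1 : ∀ x, x ∈ cn G τ → p x = 0 := by
    intro x hx
    refine Finset.sum_eq_zero fun y _ => ?_
    rw [← hw, hw1, if_neg (fun h => h.1 hx)]
  have hp2 : ∀ x, x ∉ cn G τ → k * (L - 1) ≤ p x := by
    intro x hx
    have hxt : x ∉ τ := fun h => hx (hself _ h)
    have e : p x = ((cn G (insert x τ))ᶜ.card : ℝ) := by
      have : (cn G (insert x τ))ᶜ =
          univ.filter (fun y => x ∉ cn G τ ∧ y ∉ cn G τ ∧ x ≠ y ∧ ¬ G.Adj x y) := by
        ext y
        simp only [mem_compl, mem_filter, mem_univ, true_and, mem_cn, mem_insert,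
          exists_eq_or_imp, not_or] at hx ⊢
        tauto
      rw [this, hp]
      unfold pt
      rw [← hw]
      simp_rw [hw1]
      rw [Finset.sum_boole]
    have hc := card_cn G (insert x τ)
    rw [card_insert_of_notMem hxt] at hc
    have hc' : (((cn G (insert x τ)).card : ℕ) : ℝ) ≤ ((k : ℝ) - 1) * (G.maxDegree + 1) := by
      have : ((τ.card : ℝ) + 1) = (k : ℝ) - 1 := by rw [← hτ]; push_cast; ring
      rw [← this]; exact_mod_cast hc
    have hcc : ((cn G (insert x τ))ᶜ.card : ℝ) + (cn G (insert x τ)).card = Fintype.card V := by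
      exact_mod_cast card_compl_add_card (cn G (insert x τ))
    rw [e]
    have : (0:ℝ) ≤ G.maxDegree := by positivity
    nlinarith
  set c : ℝ := (∑ x ∈ (cn G τ)ᶜ, f x) / ((cn G τ)ᶜ.card : ℝ) with hc
  set h : V → ℝ := fun x => if x ∉ cn G τ then f x - c else 0 with hh
  have hhsum : ∑ x, h x = 0 := by
    have : (univ.filter (fun x => x ∉ cn G τ)) = (cn G τ)ᶜ := by ext; simp
    simp only [hh]
    rw [← Finset.sum_filter, this, Finset.sum_sub_distrib, Finset.sum_const, nsmul_eq_mul, hc]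
    by_cases h0 : ((cn G τ)ᶜ.card : ℝ) = 0
    · have : (cn G τ)ᶜ = ∅ := card_eq_zero.1 (by exact_mod_cast h0)
      rw [this]; simp
    · rw [mul_div_cancel₀ _ h0, sub_self]
  have hwh : ∑ x, ∑ y, w x y * h x * h y ≤ (L - 1) * ∑ x, h x ^ 2 := by
    have e : ∀ x y, w x y * h x * h y = h x * h y - (if x = y then h x ^ 2 else 0)
        - h x * (G.adjMatrix ℝ x y * h y) := by
      intro x y
      by_cases hx : x ∈ cn G τ
      · have : h x = 0 := by simp [hh, hx]
        simp [this]
      by_cases hy : y ∈ cn G τ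
      · have : h y = 0 := by simp [hh, hy]
        rw [this]
        by_cases hxy : x = y
        · rw [if_pos hxy, hxy, this]; ring
        · rw [if_neg hxy]; ring
      rw [hw1, SimpleGraph.adjMatrix_apply]
      by_cases hxy : x = y
      · subst hxy
        rw [if_neg (fun h => h.2.2.1 rfl), if_pos rfl, if_neg (G.loopless.irrefl x)]; ring
      by_cases ha : G.Adj x y
      · rw [if_neg (fun h => h.2.2.2 ha), if_neg hxy, if_pos ha]; ring
      · rw [if_pos ⟨hx, hy, hxy, ha⟩, if_neg hxy, if_neg ha]; ring
    simp_rw [e, Finset.sum_sub_distrib]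
    have e1 : ∑ x, ∑ y, h x * h y = 0 := by
      rw [← Finset.sum_mul_sum, hhsum, zero_mul]
    have e2 : ∑ x, ∑ y, (if x = y then h x ^ 2 else 0) = ∑ x, h x ^ 2 := by simp
    have e3 := hL h
    simp_rw [Finset.mul_sum] at e3
    rw [e1, e2]
    rw [← Finset.mul_sum] at e3
    linarith
  have hph : (L - 1) * ∑ x, h x ^ 2 ≤ 1 / (k : ℝ) * ∑ x, p x * h x ^ 2 := by
    rw [Finset.mul_sum, Finset.mul_sum]
    refine Finset.sum_le_sum fun x _ => ?_
    by_cases hx : x ∈ cn G τ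
    · simp [hh, hx]
    · have := hp2 x hx
      rw [← mul_assoc]
      refine mul_le_mul_of_nonneg_right ?_ (sq_nonneg _)
      rw [one_div, inv_mul_eq_div, le_div_iff₀ (by linarith)]
      linarith
  have hsym : ∀ x y, w x y = w y x := wt_symm _ τ
  set D := ∑ x, p x with hD
  have hD0 : 0 ≤ D := Finset.sum_nonneg fun x _ => Finset.sum_nonneg fun y _ => wt_nonneg _ _ _ _
  have f1 : ∑ x, ∑ y, w x y * h x * h y = ∑ x, ∑ y, w x y * f x * f y + c ^ 2 * D := by
    have e : ∀ x y, w x y * h x * h y = w x y * f x * f y - c * (w x y * f x)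
        - c * (w x y * f y) + c ^ 2 * w x y := by
      intro x y
      by_cases h0 : w x y = 0
      · simp [h0]
      · have hcond : x ∉ cn G τ ∧ y ∉ cn G τ ∧ x ≠ y ∧ ¬ G.Adj x y := by
          by_contra h'
          exact h0 (by rw [hw1, if_neg h'])
        simp only [hh]
        rw [if_pos hcond.1, if_pos hcond.2.1]; ring
    have b1 : ∑ x, ∑ y, w x y * f x = 0 := by
      rw [← hf]
      refine Finset.sum_congr rfl fun x _ => ?_
      rw [← Finset.sum_mul]; rfl
    have b2 : ∑ x, ∑ y, w x y * f y = 0 := by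
      rw [Finset.sum_comm, ← b1]
      refine Finset.sum_congr rfl fun x _ => Finset.sum_congr rfl fun y _ => by rw [hsym]
    have b3 : ∑ x, ∑ y, w x y = D := rfl
    simp_rw [e, Finset.sum_add_distrib, Finset.sum_sub_distrib, ← Finset.mul_sum]
    rw [b1, b2, b3]; ring
  have f2 : ∑ x, p x * h x ^ 2 = ∑ x, p x * f x ^ 2 + c ^ 2 * D := by
    have e : ∀ x, p x * h x ^ 2 = p x * f x ^ 2 - (2 * c) * (p x * f x) + c ^ 2 * p x := by
      intro x
      by_cases hx : x ∈ cn G τ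
      · rw [hp1 x hx]; ring
      · simp only [hh]; rw [if_pos hx]; ring
    simp_rw [e]
    rw [Finset.sum_add_distrib, Finset.sum_sub_distrib, ← Finset.mul_sum, ← Finset.mul_sum, hf]
    ring
  rw [f1] at hwh
  rw [f2] at hph
  have hk2 : 1 / (k : ℝ) ≤ 1 := by
    rw [div_le_one (by linarith)]; linarith
  have : 0 ≤ c ^ 2 * D := mul_nonneg (sq_nonneg _) hD0
  nlinarith [mul_nonneg (sub_nonneg.2 hk2) this]

lemma all_local (G : SimpleGraph V) [DecidableRel G.Adj] (k : ℕ)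
    (L : ℝ) (hk1 : k * (G.maxDegree + 1) ≤ Fintype.card V)
    (hkn : (k : ℝ) * (G.maxDegree + L) ≤ Fintype.card V)
    (hL : ∀ g : V → ℝ, -L * ∑ x, g x ^ 2 ≤ ∑ x, g x * ∑ y, G.adjMatrix ℝ x y * g y) (d : ℕ) :
    ∀ τ : Finset V, τ.card + 2 + d = k →
      LocalExp (IndepSets G k) τ (1 / ((τ.card : ℝ) + 2)) := by
  induction d with
  | zero =>
    intro τ hτ
    have := base_case G k τ hτ L hk1 hkn hL
    rw [← hτ] at this ⊢
    push_cast at this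
    simpa using this
  | succ d ih =>
    intro τ hτ
    have hj : (0:ℝ) ≤ τ.card := by positivity
    refine trickle (IndepSets G k) k (fun S hS => ((mem_IndepSets G k S).1 hS).1) τ (by omega)
      (1 / ((τ.card : ℝ) + 3)) _ ?_ ?_ (conn G k hk1 τ (by omega)) ?_
    · rw [div_lt_one (by linarith)]; linarith
    · field_simp; ring
    · intro x hx
      have hc := card_insert_of_notMem hx
      have := ih (insert x τ) (by omega)
      rw [hc] at this
      have e : ((τ.card + 1 : ℕ) : ℝ) + 2 = (τ.card : ℝ) + 3 := by push_cast; ring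
      rwa [e] at this

lemma sum_erase_eq (k : ℕ) (hk : 1 ≤ k) (S : Finset V) (hS : S.card = k) (ψ : Finset V → ℝ) :
    ∑ v ∈ S, ψ (S.erase v) =
      ∑ σ ∈ powersetCard (k - 1) (univ : Finset V), if σ ⊆ S then ψ σ else 0 := by
  have : (powersetCard (k - 1) (univ : Finset V)).filter (fun σ => σ ⊆ S) =
      S.image (fun v => S.erase v) := by
    ext σ
    simp only [mem_filter, mem_powersetCard, subset_univ, true_and, mem_image]
    constructor
    · rintro ⟨h1, h2⟩
      have : (S \ σ).card = 1 := by rw [card_sdiff_of_subset h2]; omega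
      obtain ⟨v, hv⟩ := card_eq_one.1 this
      refine ⟨v, ?_, ?_⟩
      · have : v ∈ S \ σ := by rw [hv]; simp
        exact (mem_sdiff.1 this).1
      · rw [← sdiff_singleton_eq_erase, ← hv, Finset.sdiff_sdiff_eq_self h2]
    · rintro ⟨v, hv, rfl⟩
      exact ⟨by rw [card_erase_of_mem hv, hS], erase_subset _ _⟩
  rw [← Finset.sum_filter, this, Finset.sum_image]
  intro a ha b hb hab
  by_contra hne
  have h1 : a ∈ S.erase b := mem_erase.2 ⟨hne, ha⟩
  have h2 : S.erase a = S.erase b := hab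
  rw [← h2] at h1
  exact notMem_erase a S h1

lemma dirichlet (G : SimpleGraph V) [DecidableRel G.Adj] (k : ℕ) (hk : 1 ≤ k)
    (f : Finset V → ℝ) :
    ∑ S ∈ IndepSets G k, f S * ∑ T ∈ IndepSets G k, duP G k S T * f T =
      ∑ S ∈ IndepSets G k, f S ^ 2 -
        1 / (k : ℝ) * Sm (powersetCard (k - 1) univ) ∅ (Wr (IndepSets G k) f) := by
  set F := IndepSets G k with hFdef
  have hF : ∀ S ∈ F, S.card = k := fun S hS => ((mem_IndepSets G k S).1 hS).1
  have hk0 : (0:ℝ) < k := by exact_mod_cast hk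
  have h1 : ∀ S ∈ F, ∑ T ∈ F, duP G k S T * f T =
      1 / (k : ℝ) * ∑ σ ∈ powersetCard (k - 1) (univ : Finset V),
        if σ ⊆ S then Sm F σ f / Sm F σ (fun _ => 1) else 0 := by
    intro S hS
    rw [← sum_erase_eq k hk S (hF S hS) (fun σ => Sm F σ f / Sm F σ (fun _ => 1))]
    unfold duP
    simp_rw [mul_assoc, ← Finset.mul_sum, Finset.sum_mul]
    congr 1
    rw [Finset.sum_comm]
    refine Finset.sum_congr rfl fun v _ => ?_
    rw [Sm_filter, Sm_filter, Finset.sum_div, Finset.sum_filter]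
    refine Finset.sum_congr rfl fun T _ => ?_
    split_ifs
    · rw [Finset.sum_const, nsmul_eq_mul, mul_one, one_div, inv_mul_eq_div]
    · simp
  have swap : ∀ a b : Finset V → ℝ,
      ∑ S ∈ F, a S * ∑ σ ∈ powersetCard (k - 1) (univ : Finset V), (if σ ⊆ S then b σ else 0) =
      ∑ σ ∈ powersetCard (k - 1) (univ : Finset V), b σ * Sm F σ a := by
    intro a b
    simp_rw [Finset.mul_sum]
    rw [Finset.sum_comm]
    refine Finset.sum_congr rfl fun σ _ => ?_
    unfold Sm
    rw [Finset.mul_sum]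
    refine Finset.sum_congr rfl fun S _ => ?_
    split_ifs <;> ring
  have h2 : ∑ S ∈ F, f S * ∑ T ∈ F, duP G k S T * f T = 1 / (k : ℝ) *
      ∑ σ ∈ powersetCard (k - 1) (univ : Finset V), Sm F σ f ^ 2 / Sm F σ (fun _ => 1) := by
    calc _ = 1 / (k : ℝ) * ∑ S ∈ F, f S * ∑ σ ∈ powersetCard (k - 1) (univ : Finset V),
          (if σ ⊆ S then Sm F σ f / Sm F σ (fun _ => 1) else 0) := by
          rw [Finset.mul_sum]
          refine Finset.sum_congr rfl fun S hS => ?_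
          rw [h1 S hS]; ring
      _ = _ := by
          rw [swap f (fun σ => Sm F σ f / Sm F σ (fun _ => 1))]
          congr 1
          refine Finset.sum_congr rfl fun σ _ => ?_
          ring
  have h3 : ∑ σ ∈ powersetCard (k - 1) (univ : Finset V), Sm F σ (fun S => f S ^ 2) =
      k * ∑ S ∈ F, f S ^ 2 := by
    have := swap (fun S => f S ^ 2) (fun _ => 1)
    simp only [one_mul] at this
    rw [← this, Finset.mul_sum]
    refine Finset.sum_congr rfl fun S hS => ?_
    rw [← sum_erase_eq k hk S (hF S hS) (fun _ => 1)]
    rw [Finset.sum_const, hF S hS, nsmul_eq_mul]; ring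
  have h4 : Sm (powersetCard (k - 1) univ) ∅ (Wr F f) = k * ∑ S ∈ F, f S ^ 2 -
      ∑ σ ∈ powersetCard (k - 1) (univ : Finset V), Sm F σ f ^ 2 / Sm F σ (fun _ => 1) := by
    rw [← h3, ← Finset.sum_sub_distrib]
    unfold Sm
    simp only [empty_subset, if_true]
    rfl
  rw [h2, h4]
  field_simp
  ring

/-- **Theorem (sampling independent sets of fixed size).** Let `G` be a finite
simple graph with `n` vertices and maximum degree `Δ`, having at least one edge,
and let `k ≥ 1`.  If `k ≤ n / (Δ + |λ_min(A_G)|)`, then the `(k-1)`-th down-up walk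
on size-`k` independent sets of `G` satisfies `λ₂(P∨_{k-1}) ≤ 1 - 1/k²`. -/
theorem duLam2_le (G : SimpleGraph V) [DecidableRel G.Adj]
    (hE : ∃ u v, G.Adj u v) (k : ℕ) (hk : 1 ≤ k)
    (hkn : (k : ℝ) ≤ (Fintype.card V : ℝ) /
      ((G.maxDegree : ℝ) + |lamMin (G.adjMatrix ℝ)|)) :
    duLam2 G k ≤ 1 - 1 / (k : ℝ) ^ 2 := by
  have hL1 := one_le_lamMin G hE
  have hL := lamMin_form G
  set L := |lamMin (G.adjMatrix ℝ)| with hLdef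
  have hk1 : (1:ℝ) ≤ k := by exact_mod_cast hk
  have hΔ : (0:ℝ) ≤ G.maxDegree := by positivity
  rw [le_div_iff₀ (by linarith)] at hkn
  have hn : k * (G.maxDegree + 1) ≤ Fintype.card V := by
    have : (k : ℝ) * (G.maxDegree + 1) ≤ Fintype.card V :=
      (mul_le_mul_of_nonneg_left (by linarith) (by linarith)).trans hkn
    exact_mod_cast this
  have hF : ∀ S ∈ IndepSets G k, S.card = k := fun S hS => ((mem_IndepSets G k S).1 hS).1
  unfold duLam2
  refine Real.sSup_le ?_ ?_
  · rintro r ⟨f, hf0, hf1, rfl⟩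
    have hpos : 0 < ∑ S ∈ IndepSets G k, f S ^ 2 :=
      lt_of_le_of_ne (Finset.sum_nonneg fun x _ => sq_nonneg _) (Ne.symm hf1)
    rw [div_le_iff₀ hpos, dirichlet G k hk]
    have hm := var_main (IndepSets G k) k hF (fun τ hτ =>
      all_local G k L hn hkn hL (k - (τ.card + 2)) τ (by omega)) f (k - 1) ∅
      (by rw [card_empty]; omega)
    have hW : Wr (IndepSets G k) f ∅ = ∑ S ∈ IndepSets G k, f S ^ 2 := by
      unfold Wr Sm
      simp only [empty_subset, if_true]
      rw [hf0]; simp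
    rw [hW, card_empty] at hm
    set E := Sm (powersetCard (k - 1) univ) ∅ (Wr (IndepSets G k) f)
    set Q := ∑ S ∈ IndepSets G k, f S ^ 2
    have : 1 / (k : ℝ) ^ 2 * Q ≤ 1 / (k : ℝ) * E := by
      have h2 : Q ≤ k * E := by simpa using hm
      calc 1 / (k : ℝ) ^ 2 * Q ≤ 1 / (k : ℝ) ^ 2 * (k * E) :=
            mul_le_mul_of_nonneg_left h2 (by positivity)
        _ = _ := by field_simp
    linarith
  · rw [sub_nonneg, div_le_one (by positivity)]
    nlinarith
end

section
/- Let M₁ = (E, I₁) and M₂ = (E, I₂) be two partition matroids that have a common independent set of size r and share no double block, and let k ≥ 1 be an integer. If k ≤ r/3, then the transition matrix P∨_{k−1} of the (k−1)-th down-up walk on size-k common independent sets of M₁ and M₂ satisfies λ₂(P∨_{k−1}) ≤ 1 − 1/k². -/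
open Finset

/-- A matroid on a finite ground set `E`, given by its (finite, nonempty, downward
closed) family of independent sets, satisfying the exchange property. -/
structure FinMatroid (E : Type*) [Fintype E] [DecidableEq E] where
  ind : Finset (Finset E)
  empty_mem : ∅ ∈ ind
  subset_mem : ∀ S ∈ ind, ∀ T ⊆ S, T ∈ ind
  exchange : ∀ S ∈ ind, ∀ T ∈ ind, T.card < S.card →
    ∃ x ∈ S, x ∉ T ∧ insert x T ∈ ind

variable {E : Type*} [Fintype E] [DecidableEq E]

/-- `M` is the partition matroid with blocks the fibres of `b` and capacities `cap`:
a set is independent iff it meets the block `b⁻¹(i)` in at most `cap i` elements. -/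
def IsPartitionWith (M : FinMatroid E) (b : E → ℕ) (cap : ℕ → ℕ) : Prop :=
  ∀ S : Finset E, S ∈ M.ind ↔ ∀ i : ℕ, (S.filter (fun x => b x = i)).card ≤ cap i

/-- The common independent sets of `M₁` and `M₂` of size `k`. -/
def commonK (M₁ M₂ : FinMatroid E) (k : ℕ) : Finset (Finset E) :=
  (M₁.ind ∩ M₂.ind).filter (fun S => S.card = k)

/-- The transition probability of the `(k-1)`-th down-up walk on size-`k` common
independent sets of `M₁` and `M₂`: from `S`, pick a uniformly random `x ∈ S`, then a
uniformly random common independent set `T` of size `k` with `T ⊇ S \ {x}`. -/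
noncomputable def miP (M₁ M₂ : FinMatroid E) (k : ℕ) (S T : Finset E) : ℝ :=
  (1 / (k : ℝ)) * ∑ x ∈ S,
    if S.erase x ⊆ T then
      (1 : ℝ) / (((commonK M₁ M₂ k).filter (fun T' => S.erase x ⊆ T')).card : ℝ)
    else 0

/-- The second largest eigenvalue of the down-up walk on size-`k` common
independent sets: the walk is self-adjoint with respect to its stationary
distribution, the uniform distribution on `commonK M₁ M₂ k`, so by the variational
principle `λ₂` is the supremum of Rayleigh quotients of (nonzero) functions
orthogonal to the constants. -/
noncomputable def miLam2 (M₁ M₂ : FinMatroid E) (k : ℕ) : ℝ :=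
  sSup { r : ℝ | ∃ f : Finset E → ℝ,
    (∑ S ∈ commonK M₁ M₂ k, f S) = 0 ∧ (∑ S ∈ commonK M₁ M₂ k, f S ^ 2) ≠ 0 ∧
    r = (∑ S ∈ commonK M₁ M₂ k, f S * ∑ T ∈ commonK M₁ M₂ k, miP M₁ M₂ k S T * f T) /
        (∑ S ∈ commonK M₁ M₂ k, f S ^ 2) }


def LGap (A : E → E → ℝ) (γ : ℝ) : Prop :=
  ∀ g : E → ℝ, ∑ x, (∑ y, A x y) * g x = 0 →
    ∑ x, ∑ y, A x y * (g x * g y) ≤ γ * ∑ x, (∑ y, A x y) * g x ^ 2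

lemma sum_sym_sq (A : E → E → ℝ) (hs : ∀ x y, A x y = A y x) (u : E → ℝ) :
    ∑ x, ∑ y, A x y * u y = ∑ x, (∑ y, A x y) * u x := by
  rw [Finset.sum_comm]
  refine Finset.sum_congr rfl fun x _ => ?_
  rw [Finset.sum_mul]
  exact Finset.sum_congr rfl fun y _ => by rw [hs]

/-- local variance contraction -/
lemma local_var (A : E → E → ℝ) (γ : ℝ) (hγ : 0 ≤ γ) (hA : ∀ x y, 0 ≤ A x y)
    (hs : ∀ x y, A x y = A y x) (hg : LGap A γ) (h : E → E → ℝ) (hh : ∀ x y, h x y = h y x)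
    (hb : E → ℝ) (hhb : ∀ x, (∑ y, A x y) * hb x = ∑ y, A x y * h x y) (h0 : ℝ)
    (hh0 : (∑ x, ∑ y, A x y) * h0 = ∑ x, (∑ y, A x y) * hb x) :
    2 * (∑ x, (∑ y, A x y) * hb x ^ 2 - (∑ x, ∑ y, A x y) * h0 ^ 2) ≤
      (1 + γ) * (∑ x, ∑ y, A x y * h x y ^ 2 - (∑ x, ∑ y, A x y) * h0 ^ 2) := by
  set m : E → ℝ := fun x => ∑ y, A x y with hm
  set M := ∑ x, m x with hM
  -- centered
  set c : E → ℝ := fun x => hb x - h0 with hc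
  have hc0 : ∑ x, m x * c x = 0 := by
    simp only [hc, mul_sub, Finset.sum_sub_distrib, ← Finset.sum_mul]
    change ∑ x, m x * hb x - M * h0 = 0
    have : M * h0 = ∑ x, m x * hb x := hh0
    linarith
  have hN : ∑ x, m x * c x ^ 2 = ∑ x, m x * hb x ^ 2 - M * h0 ^ 2 := by
    have : ∀ x, m x * c x ^ 2 = m x * hb x ^ 2 - 2 * h0 * (m x * hb x) + m x * h0 ^ 2 := by
      intro x; simp only [hc]; ring
    simp only [this, Finset.sum_add_distrib, Finset.sum_sub_distrib, ← Finset.mul_sum,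
      ← Finset.sum_mul]
    have : M * h0 = ∑ x, m x * hb x := hh0
    rw [← this, ← hM]; ring
  have hhx : ∑ x, ∑ y, A x y * h x y = M * h0 := by
    have : M * h0 = ∑ x, m x * hb x := hh0
    rw [this]; exact Finset.sum_congr rfl fun x _ => (hhb x).symm
  have hR : ∑ x, ∑ y, A x y * (h x y - h0) ^ 2 = ∑ x, ∑ y, A x y * h x y ^ 2 - M * h0 ^ 2 := by
    have : ∀ x y, A x y * (h x y - h0) ^ 2 = A x y * h x y ^ 2 - 2 * h0 * (A x y * h x y)
        + A x y * h0 ^ 2 := by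
      intro x y; ring
    simp only [this, Finset.sum_add_distrib, Finset.sum_sub_distrib, ← Finset.mul_sum,
      ← Finset.sum_mul]
    rw [hhx]; change _ - _ + M * h0 ^ 2 = _; ring
  have hcr1 : ∑ x, ∑ y, A x y * ((h x y - h0) * c x) = ∑ x, m x * c x ^ 2 := by
    refine Finset.sum_congr rfl fun x _ => ?_
    have : ∀ y, A x y * ((h x y - h0) * c x) = (A x y * h x y - A x y * h0) * c x := by
      intro y; ring
    simp only [this, ← Finset.sum_mul, Finset.sum_sub_distrib]
    rw [← hhb x]; simp only [hm, hc]; ring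
  have hcr2 : ∑ x, ∑ y, A x y * ((h x y - h0) * c y) = ∑ x, m x * c x ^ 2 := by
    rw [← hcr1, Finset.sum_comm]
    refine Finset.sum_congr rfl fun x _ => Finset.sum_congr rfl fun y _ => ?_
    rw [hs, hh]
  have hq := hg c hc0
  have hd1 : ∑ x, ∑ y, A x y * c x ^ 2 = ∑ x, m x * c x ^ 2 := by
    refine Finset.sum_congr rfl fun x _ => ?_
    rw [← Finset.sum_mul]
  have hd2 : ∑ x, ∑ y, A x y * c y ^ 2 = ∑ x, m x * c x ^ 2 := sum_sym_sq A hs (fun x => c x ^ 2)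
  have key : 0 ≤ ∑ x, ∑ y, A x y * ((1 + γ) * (h x y - h0) - (c x + c y)) ^ 2 :=
    Finset.sum_nonneg fun x _ => Finset.sum_nonneg fun y _ => mul_nonneg (hA x y) (sq_nonneg _)
  have e : ∀ x y, A x y * ((1 + γ) * (h x y - h0) - (c x + c y)) ^ 2 =
      (1 + γ) ^ 2 * (A x y * (h x y - h0) ^ 2) - 2 * (1 + γ) * (A x y * ((h x y - h0) * c x))
      - 2 * (1 + γ) * (A x y * ((h x y - h0) * c y)) + A x y * c x ^ 2 + A x y * c y ^ 2
      + 2 * (A x y * (c x * c y)) := by intro x y; ring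
  simp only [e, Finset.sum_add_distrib, Finset.sum_sub_distrib, ← Finset.mul_sum] at key
  rw [hcr1, hcr2, hd1, hd2] at key
  rw [← hN, ← hR]
  change _ ≤ γ * ∑ x, m x * c x ^ 2 at hq
  have h1 : 0 < 1 + γ := by linarith
  refine le_of_mul_le_mul_left ?_ h1
  nlinarith

lemma spectral_step (A : E → E → ℝ) (c : ℝ) (hc : 0 ≤ c) (hA : ∀ x y, 0 ≤ A x y)
    (hs : ∀ x y, A x y = A y x)
    (H : ∀ (l : ℝ) (f : E → ℝ), c < l → (∀ x, ∑ y, A x y * f y = l * ((∑ y, A x y) * f x)) →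
      ∑ x, (∑ y, A x y) * f x = 0 → ∑ x, (∑ y, A x y) * f x ^ 2 = 0) : LGap A c := by
  set m : E → ℝ := fun x => ∑ y, A x y with hm
  have hm0 : ∀ x, 0 ≤ m x := fun x => Finset.sum_nonneg fun y _ => hA x y
  set s : E → ℝ := fun x => Real.sqrt (m x) with hsd
  have hss : ∀ x, s x * s x = m x := fun x => Real.mul_self_sqrt (hm0 x)
  have hA0 : ∀ x y, s x = 0 → A x y = 0 := by
    intro x y h
    have : m x = 0 := by rw [← hss, h]; ring
    exact (Finset.sum_eq_zero_iff_of_nonneg (fun y _ => hA x y)).1 this y (Finset.mem_univ _)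
  have hA0' : ∀ x y, s y = 0 → A x y = 0 := fun x y h => by rw [hs]; exact hA0 y x h
  set M := ∑ x, m x with hM
  set K : Matrix E E ℝ := Matrix.of fun x y =>
    (if x = y then c else 0) - (s x)⁻¹ * A x y * (s y)⁻¹ + s x * s y / M with hK
  have hKv : ∀ (v : E → ℝ) x, (K.mulVec v) x =
      c * v x - (s x)⁻¹ * ∑ y, A x y * ((s y)⁻¹ * v y) + s x / M * ∑ y, s y * v y := by
    intro v x
    simp only [Matrix.mulVec, dotProduct, hK, Matrix.of_apply, add_mul, sub_mul,
      Finset.sum_add_distrib, Finset.sum_sub_distrib, ite_mul, zero_mul, Finset.sum_ite_eq,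
      Finset.mem_univ, if_true, Finset.mul_sum]
    congr 1
    · congr 1; exact Finset.sum_congr rfl fun y _ => by ring
    · exact Finset.sum_congr rfl fun y _ => by ring
  have hherm : K.IsHermitian := by
    ext x y
    simp only [hK, Matrix.conjTranspose_apply, Matrix.of_apply, star_trivial]
    rw [hs y x]; simp only [eq_comm (a := y)]; ring
  have hpsd : K.PosSemidef := by
    rw [hherm.posSemidef_iff_eigenvalues_nonneg]
    intro i
    by_contra hneg
    simp only [Pi.zero_apply, not_le] at hneg
    set μ := hherm.eigenvalues i with hμ
    set v : E → ℝ := fun x => hherm.eigenvectorBasis i x with hv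
    have hev : ∀ x, (K.mulVec v) x = μ * v x := by
      intro x
      have := congrFun (hherm.mulVec_eigenvectorBasis i) x
      simpa using this
    have hv0 : ∀ x, s x = 0 → v x = 0 := by
      intro x hx
      have := hev x
      rw [hKv, hx] at this
      simp only [inv_zero, zero_mul, zero_div, sub_zero, add_zero] at this
      have h2 : (c - μ) * v x = 0 := by linarith
      rcases mul_eq_zero.1 h2 with h | h
      · linarith
      · exact h
    set f : E → ℝ := fun x => (s x)⁻¹ * v x with hf
    have hvf : ∀ x, v x = s x * f x := by
      intro x
      by_cases hx : s x = 0
      · rw [hv0 x hx, hx]; ring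
      · simp only [hf]; field_simp
    have hsv : ∑ x, s x * v x = ∑ x, m x * f x :=
      Finset.sum_congr rfl fun x _ => by rw [hvf, ← hss]; ring
    have hmul : ∀ x, c * (m x * f x) - ∑ y, A x y * f y + m x / M * ∑ y, m y * f y
        = μ * (m x * f x) := by
      intro x
      have := hev x
      rw [hKv, hsv] at this
      by_cases hx : s x = 0
      · have : m x = 0 := by rw [← hss, hx]; ring
        rw [this]
        simp [hA0 x _ hx]
      · have h2 := congrArg (fun t => s x * t) this
        rw [hvf x] at h2
        have h3 : s x * (c * (s x * f x) - (s x)⁻¹ * ∑ y, A x y * ((s y)⁻¹ * v y)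
          + s x / M * ∑ y, m y * f y) = c * (s x * s x * f x) - (s x * (s x)⁻¹) * ∑ y, A x y * f y
          + (s x * s x) / M * ∑ y, m y * f y := by simp only [hf]; ring
        rw [h3, mul_inv_cancel₀ hx, hss, one_mul] at h2
        rw [h2, ← hss]; ring
    have hz : ∑ x, m x * f x = 0 := by
      have hsum : ∑ x, (c * (m x * f x) - ∑ y, A x y * f y + m x / M * ∑ y, m y * f y)
        = ∑ x, μ * (m x * f x) := Finset.sum_congr rfl fun x _ => hmul x
      simp only [Finset.sum_add_distrib, Finset.sum_sub_distrib, ← Finset.mul_sum,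
        ← Finset.sum_mul, ← Finset.sum_div] at hsum
      rw [sum_sym_sq A hs f] at hsum
      change c * _ - ∑ x, m x * f x + M / M * _ = _ at hsum
      by_cases hM0 : M = 0
      · have : ∀ x, m x = 0 := fun x =>
          (Finset.sum_eq_zero_iff_of_nonneg (fun y _ => hm0 y)).1 hM0 x (Finset.mem_univ _)
        simp [this]
      · rw [div_self hM0] at hsum
        have h2 : (c - μ) * ∑ x, m x * f x = 0 := by linarith
        rcases mul_eq_zero.1 h2 with h | h
        · linarith
        · exact h
    have hfin := H (c - μ) f (by linarith) (by
      intro x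
      have := hmul x
      rw [hz] at this
      change _ = (c - μ) * (m x * f x)
      linarith) hz
    have hvz : ∑ x, v x ^ 2 = 0 := by
      rw [← hfin]
      refine Finset.sum_congr rfl fun x _ => ?_
      change _ = m x * f x ^ 2
      rw [hvf, ← hss]; ring
    have hall : ∀ x, v x = 0 := fun x => by
      have := (Finset.sum_eq_zero_iff_of_nonneg (fun y _ => sq_nonneg (v y))).1 hvz x
        (Finset.mem_univ _)
      exact pow_eq_zero_iff (two_ne_zero) |>.1 this
    have hnz := hherm.eigenvectorBasis.orthonormal.ne_zero i
    exact hnz (by ext x; exact hall x)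
  intro g hg
  have := hpsd.dotProduct_mulVec_nonneg (fun x => s x * g x)
  simp only [dotProduct, hKv, star_trivial, Pi.star_apply] at this
  have e1 : ∑ y, s y * (s y * g y) = 0 := by
    rw [← hg]; exact Finset.sum_congr rfl fun y _ => by rw [← mul_assoc, hss]
  rw [e1] at this
  have e2 : ∀ x, s x * g x * (c * (s x * g x) - (s x)⁻¹ * ∑ y, A x y * ((s y)⁻¹ * (s y * g y))
      + s x / M * 0) = c * (m x * g x ^ 2) - ∑ y, A x y * (g x * g y) := by
    intro x
    have e3 : ∀ y, A x y * ((s y)⁻¹ * (s y * g y)) = A x y * g y := by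
      intro y
      by_cases hy : s y = 0
      · rw [hA0' x y hy]; ring
      · field_simp
    simp only [e3]
    by_cases hx : s x = 0
    · simp [hA0 x _ hx, hx, ← hss]
    · have e4 : ∑ y, A x y * (g x * g y) = g x * ∑ y, A x y * g y := by
        rw [Finset.mul_sum]; exact Finset.sum_congr rfl fun y _ => by ring
      rw [e4, ← hss]; field_simp; ring
  simp only [e2, Finset.sum_sub_distrib, ← Finset.mul_sum] at this
  simp only [Finset.mul_sum] at this ⊢
  linarith

lemma trickle_s13 (A : E → E → ℝ) (C : E → E → E → ℝ) (γ : ℝ) (h0 : 0 ≤ γ) (h1 : γ < 1)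
    (hC : ∀ x y z, 0 ≤ C x y z) (hC1 : ∀ x y z, C x y z = C y x z)
    (hC2 : ∀ x y z, C x y z = C x z y) (hA : ∀ x y, A x y = ∑ z, C x y z)
    (hloc : ∀ x, LGap (C x) γ)
    (hconn : ∀ x y, ∑ z, A x z ≠ 0 → ∑ z, A y z ≠ 0 → ∃ z, A x z ≠ 0 ∧ A z y ≠ 0) :
    LGap A (γ / (1 - γ)) := by
  have hAn : ∀ x y, 0 ≤ A x y := fun x y => by
    rw [hA]; exact Finset.sum_nonneg fun z _ => hC x y z
  have hs : ∀ x y, A x y = A y x := fun x y => by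
    rw [hA, hA]; exact Finset.sum_congr rfl fun z _ => hC1 x y z
  refine spectral_step A _ (div_nonneg h0 (by linarith)) hAn hs ?_
  intro l f hl hf hf0
  set m : E → ℝ := fun x => ∑ y, A x y with hm
  set N := ∑ x, m x * f x ^ 2 with hN
  change N = 0
  have hf' : ∀ x, ∑ y, A x y * f y = l * (m x * f x) := hf
  by_contra hNne
  have hNpos : 0 < N := lt_of_le_of_ne
    (Finset.sum_nonneg fun x _ => mul_nonneg (Finset.sum_nonneg fun y _ => hAn x y) (sq_nonneg _))
    (Ne.symm hNne)
  have hQ : ∑ x, ∑ y, A x y * (f x * f y) = l * N := by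
    rw [hN, Finset.mul_sum]
    refine Finset.sum_congr rfl fun x _ => ?_
    have : ∀ y, A x y * (f x * f y) = f x * (A x y * f y) := fun y => by ring
    simp only [this, ← Finset.mul_sum]
    rw [hf']; ring
  have hd2 : ∑ x, ∑ y, A x y * f y ^ 2 = N := sum_sym_sq A hs (fun x => f x ^ 2)
  have hd1 : ∑ x, ∑ y, A x y * f x ^ 2 = N := by
    refine Finset.sum_congr rfl fun x _ => ?_
    rw [← Finset.sum_mul]
  have hx : ∀ x, ∑ y, ∑ z, C x y z * (f y * f z) - l ^ 2 * (m x * f x ^ 2) ≤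
      γ * (∑ y, A x y * f y ^ 2 - l ^ 2 * (m x * f x ^ 2)) := by
    intro x
    have := hloc x (fun y => f y - l * f x)
    simp only [← hA] at this
    have t1 : ∑ y, A x y * (f y - l * f x) = 0 := by
      simp only [mul_sub, Finset.sum_sub_distrib, hf', ← Finset.sum_mul]
      change _ - m x * _ = 0
      ring
    have t2 : ∑ y, A x y * (f y - l * f x) ^ 2 = ∑ y, A x y * f y ^ 2 - l ^ 2 * (m x * f x ^ 2) := by
      have e : ∀ y, A x y * (f y - l * f x) ^ 2 = A x y * f y ^ 2 - 2 * l * f x * (A x y * f y)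
        + A x y * (l ^ 2 * f x ^ 2) := fun y => by ring
      simp only [e, Finset.sum_add_distrib, Finset.sum_sub_distrib, ← Finset.mul_sum, hf',
        ← Finset.sum_mul]
      change _ - _ + m x * _ = _
      ring
    have t3 : ∑ y, ∑ z, C x y z * ((f y - l * f x) * (f z - l * f x)) =
        ∑ y, ∑ z, C x y z * (f y * f z) - l ^ 2 * (m x * f x ^ 2) := by
      have e : ∀ y z, C x y z * ((f y - l * f x) * (f z - l * f x)) =
        C x y z * (f y * f z) - l * f x * (C x y z * f z) - (C x y z) * (l * f x * f y)
        + C x y z * (l ^ 2 * f x ^ 2) := fun y z => by ring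
      have e5 : ∑ y, ∑ z, C x y z * f z = l * (m x * f x) := by
        rw [sum_sym_sq (C x) (hC2 x) f]
        simp only [← hA, hf']
      have e6 : ∑ y, A x y * (l * f x * f y) = l * f x * (l * (m x * f x)) := by
        rw [← hf', Finset.mul_sum]; exact Finset.sum_congr rfl fun y _ => by ring
      simp only [e, Finset.sum_add_distrib, Finset.sum_sub_distrib, ← Finset.mul_sum,
        ← Finset.sum_mul, ← hA]
      rw [e5, e6]
      change _ - _ - _ + m x * _ = _
      ring
    rw [t2, t3] at this
    exact this t1
  have hsum := Finset.sum_le_sum (fun x (_ : x ∈ Finset.univ) => hx x)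
  simp only [Finset.sum_sub_distrib, ← Finset.mul_sum] at hsum
  have hCs : ∑ x, ∑ y, ∑ z, C x y z * (f y * f z) = l * N := by
    rw [← hQ, Finset.sum_comm]
    refine Finset.sum_congr rfl fun y _ => ?_
    rw [Finset.sum_comm]
    refine Finset.sum_congr rfl fun z _ => ?_
    rw [← Finset.sum_mul, hA]
    congr 1
    exact Finset.sum_congr rfl fun x _ => by rw [hC1, hC2]
  rw [hCs, hd2] at hsum
  have hl' : γ < l * (1 - γ) := by rwa [div_lt_iff₀ (by linarith)] at hl
  have h5 : l - l ^ 2 ≤ γ * (1 - l ^ 2) := by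
    refine le_of_mul_le_mul_right ?_ hNpos
    change l * N - l ^ 2 * N ≤ γ * (N - l ^ 2 * N) at hsum
    linarith
  have hl1 : 1 ≤ l := by
    by_contra hlt
    push Not at hlt
    nlinarith [mul_pos (sub_pos.2 hlt) (sub_pos.2 hl')]
  have hdir : ∑ x, ∑ y, A x y * (f x - f y) ^ 2 = 2 * (1 - l) * N := by
    have e : ∀ x y, A x y * (f x - f y) ^ 2 = A x y * f x ^ 2 - 2 * (A x y * (f x * f y))
      + A x y * f y ^ 2 := fun x y => by ring
    simp only [e, Finset.sum_add_distrib, Finset.sum_sub_distrib, ← Finset.mul_sum]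
    rw [hd1, hd2, hQ]; ring
  have hnn : ∀ x y, 0 ≤ A x y * (f x - f y) ^ 2 := fun x y => mul_nonneg (hAn x y) (sq_nonneg _)
  have hdir0 : ∑ x, ∑ y, A x y * (f x - f y) ^ 2 = 0 := by
    refine le_antisymm ?_ (Finset.sum_nonneg fun x _ => Finset.sum_nonneg fun y _ => hnn x y)
    rw [hdir]; nlinarith
  have hconst : ∀ x y, A x y ≠ 0 → f x = f y := by
    intro x y hxy
    have h6 := (Finset.sum_eq_zero_iff_of_nonneg
      (fun x _ => Finset.sum_nonneg fun y _ => hnn x y)).1 hdir0 x (Finset.mem_univ _)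
    have h7 := (Finset.sum_eq_zero_iff_of_nonneg (fun y _ => hnn x y)).1 h6 y (Finset.mem_univ _)
    have h8 := (mul_eq_zero.1 h7).resolve_left hxy
    have := pow_eq_zero_iff (two_ne_zero) |>.1 h8
    linarith
  have hcc : ∀ x y, m x ≠ 0 → m y ≠ 0 → f x = f y := by
    intro x y h h'
    obtain ⟨z, hz1, hz2⟩ := hconn x y h h'
    rw [hconst x z hz1, hconst z y hz2]
  apply hNne
  have : ∀ x, m x * f x ^ 2 = 0 := by
    intro x
    by_cases hmx : m x = 0
    · rw [hmx]; ring
    · have h9 : ∑ y, m y * f y = ∑ y, m y * f x := by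
        refine Finset.sum_congr rfl fun y _ => ?_
        by_cases hmy : m y = 0
        · rw [hmy]; ring
        · rw [hcc x y hmx hmy]
      have h10 : (∑ y, m y) * f x = 0 := by rw [Finset.sum_mul, ← h9]; exact hf0
      rcases mul_eq_zero.1 h10 with h | h
      · exact absurd ((Finset.sum_eq_zero_iff_of_nonneg
          (fun y _ => Finset.sum_nonneg fun z _ => hAn y z)).1 h x (Finset.mem_univ _)) hmx
      · rw [h]; ring
  simp [hN, this]

noncomputable def upG (F : Finset E → ℝ) : ℕ → Finset E → ℝ
  | 0, S => F S
  | n + 1, S => ∑ x ∈ Sᶜ, upG F n (insert x S)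

noncomputable def lvl (j : ℕ) (H : Finset E → ℝ) : ℝ :=
  (j.factorial : ℝ) * ∑ S ∈ powersetCard j (univ : Finset E), H S

/-- double counting -/
lemma sum_erase_insert (j : ℕ) (H : Finset E → Finset E → ℝ) :
    ∑ S ∈ powersetCard j (univ : Finset E), ∑ x ∈ Sᶜ, H S (insert x S) =
      ∑ T ∈ powersetCard (j + 1) (univ : Finset E), ∑ x ∈ T, H (T.erase x) T := by
  rw [Finset.sum_sigma', Finset.sum_sigma']
  refine Finset.sum_bij' (fun p _ => ⟨insert p.2 p.1, p.2⟩) (fun p _ => ⟨p.1.erase p.2, p.2⟩)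
    ?_ ?_ ?_ ?_ ?_
  · rintro ⟨S, x⟩ h
    simp only [mem_sigma, mem_powersetCard, subset_univ, true_and, mem_compl] at h ⊢
    exact ⟨by rw [card_insert_of_notMem h.2, h.1], mem_insert_self _ _⟩
  · rintro ⟨S, x⟩ h
    simp only [mem_sigma, mem_powersetCard, subset_univ, true_and, mem_compl] at h ⊢
    exact ⟨by rw [card_erase_of_mem h.2, h.1]; rfl, notMem_erase _ _⟩
  · rintro ⟨S, x⟩ h
    simp only [mem_sigma, mem_powersetCard, subset_univ, true_and, mem_compl] at h ⊢
    simp [erase_insert h.2]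
  · rintro ⟨S, x⟩ h
    simp only [mem_sigma, mem_powersetCard, subset_univ, true_and, mem_compl] at h ⊢
    simp [insert_erase h.2]
  · rintro ⟨S, x⟩ h
    simp only [mem_sigma, mem_powersetCard, subset_univ, true_and, mem_compl] at h ⊢
    simp [erase_insert h.2]

lemma lvl_succ (j : ℕ) (H : Finset E → ℝ) :
    lvl j (fun S => ∑ x ∈ Sᶜ, H (insert x S)) = lvl (j + 1) H := by
  unfold lvl
  rw [sum_erase_insert j (fun _ T => H T)]
  have : ∑ T ∈ powersetCard (j + 1) (univ : Finset E), ∑ x ∈ T, H T =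
      ((j : ℝ) + 1) * ∑ T ∈ powersetCard (j + 1) (univ : Finset E), H T := by
    rw [mul_sum]
    refine sum_congr rfl fun T hT => ?_
    rw [sum_const, (mem_powersetCard.1 hT).2]; simp
  rw [this, Nat.factorial_succ]; push_cast; ring

lemma upG_supp (F : Finset E → ℝ) (k : ℕ) (hF : ∀ S, S.card ≠ k → F S = 0) (n : ℕ) :
    ∀ S : Finset E, S.card + n ≠ k → upG F n S = 0 := by
  induction n with
  | zero => intro S h; exact hF S (by simpa using h)
  | succ n ih =>
    intro S h
    refine sum_eq_zero fun x hx => ih _ ?_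
    rw [card_insert_of_notMem (mem_compl.1 hx)]; omega

lemma upG_sum (F : Finset E → ℝ) (k : ℕ) (hF : ∀ S, S.card ≠ k → F S = 0) (n : ℕ)
    (S : Finset E) (h : S.card + (n + 1) ≤ k) :
    upG F (n + 1) S = ∑ x, upG F n (insert x S) := by
  change ∑ x ∈ Sᶜ, upG F n (insert x S) = _
  refine sum_subset (subset_univ _) fun x _ hx => ?_
  rw [mem_compl, not_not] at hx
  rw [insert_eq_of_mem hx]
  exact upG_supp F k hF n S (by omega)

lemma lvl_upG (F : Finset E → ℝ) (n : ℕ) : ∀ j, lvl j (upG F n) = lvl (j + n) F := by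
  induction n with
  | zero => intro j; rfl
  | succ n ih =>
    intro j
    have : lvl j (upG F (n + 1)) = lvl (j + 1) (upG F n) := lvl_succ j (upG F n)
    rw [this, ih]; congr 1; omega

lemma upG_nonneg (F : Finset E → ℝ) (hF : ∀ S, 0 ≤ F S) (n : ℕ) : ∀ S, 0 ≤ upG F n S := by
  induction n with
  | zero => exact hF
  | succ n ih => exact fun S => sum_nonneg fun x _ => ih _

lemma upG_abs_cont (W F : Finset E → ℝ) (hW : ∀ S, 0 ≤ W S) (hWF : ∀ S, W S = 0 → F S = 0)
    (n : ℕ) : ∀ S, upG W n S = 0 → upG F n S = 0 := by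
  induction n with
  | zero => exact hWF
  | succ n ih =>
    intro S h
    exact sum_eq_zero fun x hx => ih _ ((sum_eq_zero_iff_of_nonneg
      (fun x _ => upG_nonneg W hW n (insert x S))).1 h x hx)

/-- indicator of size `k` members of `X` -/
noncomputable def indK (X : Finset (Finset E)) (k : ℕ) (S : Finset E) : ℝ :=
  if S ∈ X ∧ S.card = k then 1 else 0

lemma indK_supp (X : Finset (Finset E)) (k : ℕ) (S : Finset E) (h : S.card ≠ k) :
    indK X k S = 0 := by simp [indK, h]

lemma indK_nonneg (X : Finset (Finset E)) (k : ℕ) (S : Finset E) : 0 ≤ indK X k S := by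
  unfold indK; split_ifs <;> norm_num

lemma w_mem (X : Finset (Finset E)) (hX : ∀ S ∈ X, ∀ T ⊆ S, T ∈ X) (k n : ℕ) :
    ∀ S, upG (indK X k) n S ≠ 0 → S ∈ X := by
  induction n with
  | zero => intro S h; by_contra hS; exact h (by simp [upG, indK, hS])
  | succ n ih =>
    intro S h
    obtain ⟨x, _, hx⟩ := exists_ne_zero_of_sum_ne_zero h
    exact hX _ (ih _ hx) _ (subset_insert _ _)

lemma w_ne (X : Finset (Finset E)) (k : ℕ)
    (hext : ∀ S ∈ X, S.card < k → ∃ x, x ∉ S ∧ insert x S ∈ X) (n : ℕ) :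
    ∀ S ∈ X, S.card + n = k → 0 < upG (indK X k) n S := by
  induction n with
  | zero => intro S h h2; simp [upG, indK, h, show S.card = k by omega]
  | succ n ih =>
    intro S h h2
    obtain ⟨x, hx, hxX⟩ := hext S h (by omega)
    refine sum_pos' (fun x _ => upG_nonneg _ (indK_nonneg X k) n _) ⟨x, by simpa using hx, ?_⟩
    exact ih _ hxX (by rw [card_insert_of_notMem hx]; omega)

lemma block_psd (U : Finset E) (b : E → ℕ) (t : ℕ → Prop) [DecidablePred t] (g : E → ℝ) :
    0 ≤ ∑ x ∈ U, ∑ y ∈ U, (if b x = b y ∧ t (b x) then (1 : ℝ) else 0) * (g x * g y) := by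
  have : ∑ x ∈ U, ∑ y ∈ U, (if b x = b y ∧ t (b x) then (1 : ℝ) else 0) * (g x * g y) =
      ∑ i ∈ U.image b, (∑ x ∈ U, if b x = i ∧ t i then g x else 0) ^ 2 := by
    have e : ∀ i, (∑ x ∈ U, if b x = i ∧ t i then g x else 0) ^ 2 =
      ∑ x ∈ U, ∑ y ∈ U, (if b x = i ∧ t i then g x else 0) * (if b y = i ∧ t i then g y else 0) := by
      intro i; rw [sq, sum_mul_sum]
    simp only [e]
    symm
    rw [sum_comm]
    refine sum_congr rfl fun x hx => ?_
    rw [sum_comm]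
    refine sum_congr rfl fun y hy => ?_
    rw [sum_eq_single (b x)]
    · by_cases h1 : b x = b y <;> by_cases h2 : t (b x) <;> simp [h1, h2, eq_comm]
      all_goals simp_all
    · intro i _ hi; simp [Ne.symm hi]
    · intro h; exact absurd (mem_image_of_mem b hx) h
  rw [this]
  exact sum_nonneg fun i _ => sq_nonneg _

/-- top-level gap -/
lemma top_gap (A : E → E → ℝ) (hA : ∀ x y, 0 ≤ A x y) (hs : ∀ x y, A x y = A y x)
    (U : Finset E) (hU : ∀ x y, x ∉ U → A x y = 0) (d : ℝ) (hd : 1 ≤ d)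
    (hdeg : ∀ x ∈ U, d ≤ ∑ y, A x y)
    (hJ : ∀ g : E → ℝ, ∑ x ∈ U, ∑ y ∈ U, A x y * (g x * g y) ≤
      (∑ x ∈ U, g x) ^ 2 + ∑ x ∈ U, g x ^ 2) : LGap A (1 / d) := by
  intro g hg
  set m : E → ℝ := fun x => ∑ y, A x y with hm
  have hm0 : ∀ x, 0 ≤ m x := fun x => sum_nonneg fun y _ => hA x y
  set M := ∑ x, m x with hM
  have hM0 : 0 ≤ M := sum_nonneg fun x _ => hm0 x
  obtain ⟨c, hc⟩ : ∃ c : ℝ, ∑ x ∈ U, (g x - c) = 0 := by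
    rcases U.eq_empty_or_nonempty with h | h
    · exact ⟨0, by simp [h]⟩
    · refine ⟨(∑ x ∈ U, g x) / U.card, ?_⟩
      have : (U.card : ℝ) ≠ 0 := by exact_mod_cast h.card_pos.ne'
      rw [sum_sub_distrib, sum_const, nsmul_eq_mul]; field_simp; ring
  have h1 := hJ (fun x => g x - c)
  rw [hc] at h1
  have h2 : ∑ x ∈ U, ∑ y ∈ U, A x y * ((g x - c) * (g y - c)) =
      ∑ x, ∑ y, A x y * ((g x - c) * (g y - c)) := by
    rw [sum_subset (subset_univ U)]
    · refine sum_congr rfl fun x _ => sum_subset (subset_univ U) fun y _ hy => ?_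
      rw [hs, hU y x hy]; ring
    · intro x _ hx; exact sum_eq_zero fun y _ => by rw [hU x y hx]; ring
  have h3 : ∑ x, ∑ y, A x y * ((g x - c) * (g y - c)) =
      ∑ x, ∑ y, A x y * (g x * g y) + c ^ 2 * M := by
    have e : ∀ x y, A x y * ((g x - c) * (g y - c)) = A x y * (g x * g y) - c * (A x y * g y)
      - A x y * (c * g x) + A x y * c ^ 2 := fun x y => by ring
    have e5 : ∑ x, ∑ y, A x y * g y = 0 := by rw [sum_sym_sq A hs g]; exact hg
    have e6 : ∑ x, (∑ y, A x y) * (c * g x) = 0 := by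
      rw [← mul_zero c, ← hg, mul_sum]; exact sum_congr rfl fun x _ => by ring
    simp only [e, sum_add_distrib, sum_sub_distrib, ← mul_sum, ← sum_mul]
    rw [e5, e6]
    change _ - _ - _ + M * _ = _
    ring
  have h4 : d * ∑ x ∈ U, (g x - c) ^ 2 ≤ ∑ x, m x * (g x - c) ^ 2 := by
    rw [mul_sum]
    refine (sum_le_sum fun x hx => mul_le_mul_of_nonneg_right (hdeg x hx) (sq_nonneg _)).trans ?_
    exact sum_le_sum_of_subset_of_nonneg (subset_univ _) fun x _ _ =>
      mul_nonneg (hm0 x) (sq_nonneg _)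
  have h5 : ∑ x, m x * (g x - c) ^ 2 = ∑ x, m x * g x ^ 2 + c ^ 2 * M := by
    have e : ∀ x, m x * (g x - c) ^ 2 = m x * g x ^ 2 - 2 * c * (m x * g x) + m x * c ^ 2 :=
      fun x => by ring
    simp only [e, sum_add_distrib, sum_sub_distrib, ← mul_sum, ← sum_mul]
    have : ∑ x, m x * g x = 0 := hg
    rw [this, ← hM]; ring
  rw [h2, h3] at h1
  rw [h5] at h4
  change _ ≤ 1 / d * ∑ x, m x * g x ^ 2
  rw [one_div, ← div_eq_inv_mul, le_div_iff₀ (by linarith)]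
  have : 0 ≤ (d - 1) * (c ^ 2 * M) := mul_nonneg (by linarith) (by positivity)
  nlinarith

lemma lvl_succ' (j : ℕ) (H : Finset E → ℝ) (hH : ∀ T : Finset E, T.card = j → H T = 0) :
    lvl j (fun S => ∑ x, H (insert x S)) = lvl (j + 1) H := by
  rw [← lvl_succ]
  unfold lvl
  congr 1
  refine sum_congr rfl fun S hS => ?_
  symm
  refine sum_subset (subset_univ _) fun x _ hx => ?_
  rw [mem_compl, not_not] at hx
  rw [insert_eq_of_mem hx]
  exact hH S (mem_powersetCard.1 hS).2

/-- the energy density at a face -/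
noncomputable def enH (W F : Finset E → ℝ) (n : ℕ) (S : Finset E) : ℝ :=
  upG W n S * (upG F n S / upG W n S) ^ 2

lemma bad_card (b : E → ℕ) (cap : ℕ → ℕ) (T C : Finset E)
    (hT : ∀ i : ℕ, (T.filter (fun x => b x = i)).card ≤ cap i) :
    (T.filter (fun z => z ∈ C ∨ cap (b z) ≤ (C.filter (fun x => b x = b z)).card)).card ≤
      C.card := by
  set B := T.filter (fun z => z ∈ C ∨ cap (b z) ≤ (C.filter (fun x => b x = b z)).card) with hB
  rw [card_eq_sum_card_fiberwise (f := b) (s := B) (t := (T ∪ C).image b),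
    card_eq_sum_card_fiberwise (f := b) (s := C) (t := (T ∪ C).image b)]
  · refine sum_le_sum fun i _ => ?_
    by_cases hi : cap i ≤ (C.filter (fun x => b x = i)).card
    · refine le_trans (card_le_card ?_) ((hT i).trans hi)
      intro z hz
      simp only [hB, mem_filter] at hz ⊢
      exact ⟨hz.1.1, hz.2⟩
    · refine card_le_card ?_
      intro z hz
      simp only [hB, mem_filter] at hz ⊢
      obtain ⟨⟨_, h⟩, rfl⟩ := hz
      exact ⟨h.resolve_right hi, rfl⟩
  · intro x hx; exact mem_image_of_mem b (mem_union_right _ hx)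
  · intro x hx; exact mem_image_of_mem b (mem_union_left _ (mem_filter.1 hx).1)

lemma insert_ind (M : FinMatroid E) (b : E → ℕ) (cap : ℕ → ℕ) (h : IsPartitionWith M b cap)
    (C B : Finset E) (z : E) (hz : (C.filter (fun x => b x = b z)).card < cap (b z))
    (hBC : B ⊆ C) (hB : B ∈ M.ind) : insert z B ∈ M.ind := by
  rw [h] at hB ⊢
  intro i
  rw [filter_insert]
  split_ifs with hi
  · subst hi
    refine (card_insert_le _ _).trans ?_
    have := card_le_card (filter_subset_filter (fun x => b x = b z) hBC)
    omega
  · exact hB i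

lemma ext_count (M₁ M₂ : FinMatroid E) (b₁ b₂ : E → ℕ) (cap₁ cap₂ : ℕ → ℕ)
    (h₁ : IsPartitionWith M₁ b₁ cap₁) (h₂ : IsPartitionWith M₂ b₂ cap₂)
    (T : Finset E) (hT : T ∈ M₁.ind ∩ M₂.ind) (C : Finset E) :
    ∃ Z : Finset E, T.card ≤ Z.card + 2 * C.card ∧ ∀ z ∈ Z, z ∉ C ∧
      ∀ B ⊆ C, B ∈ M₁.ind ∩ M₂.ind → insert z B ∈ M₁.ind ∩ M₂.ind := by
  rw [mem_inter] at hT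
  have c1 := bad_card b₁ cap₁ T C ((h₁ T).1 hT.1)
  have c2 := bad_card b₂ cap₂ T C ((h₂ T).1 hT.2)
  set B1 := T.filter (fun z => z ∈ C ∨ cap₁ (b₁ z) ≤ (C.filter (fun x => b₁ x = b₁ z)).card)
  set B2 := T.filter (fun z => z ∈ C ∨ cap₂ (b₂ z) ≤ (C.filter (fun x => b₂ x = b₂ z)).card)
  refine ⟨T \ (B1 ∪ B2), ?_, ?_⟩
  · have := le_card_sdiff (B1 ∪ B2) T
    have := card_union_le B1 B2
    omega
  · intro z hz
    simp only [B1, B2, mem_sdiff, mem_union, mem_filter, not_or, not_and, not_le] at hz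
    obtain ⟨hzT, hz1, hz2⟩ := hz
    refine ⟨(hz1 hzT).1, fun B hBC hB => ?_⟩
    rw [mem_inter] at hB ⊢
    exact ⟨insert_ind M₁ b₁ cap₁ h₁ C B z (hz1 hzT).2 hBC hB.1,
      insert_ind M₂ b₂ cap₂ h₂ C B z (hz2 hzT).2 hBC hB.2⟩

lemma pair_ind (M : FinMatroid E) (b : E → ℕ) (cap : ℕ → ℕ) (h : IsPartitionWith M b cap)
    (S : Finset E) (x y : E) (hxy : x ≠ y) (hxS : x ∉ S) (hyS : y ∉ S)
    (hx : insert x S ∈ M.ind) (hy : insert y S ∈ M.ind) :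
    insert y (insert x S) ∈ M.ind ↔
      ¬ (b x = b y ∧ cap (b x) ≤ (S.filter (fun z => b z = b x)).card + 1) := by
  have hyx : y ∉ insert x S := by simp [Ne.symm hxy, hyS]
  constructor
  · rintro hi ⟨hb, hc⟩
    rw [h] at hi
    have := hi (b x)
    rw [filter_insert, if_pos hb.symm, filter_insert, if_pos rfl, card_insert_of_notMem,
      card_insert_of_notMem] at this
    · omega
    · simp [hxS]
    · simp [Ne.symm hxy, hyS]
  · intro hn
    by_cases hb : b x = b y
    · have hc : ¬ cap (b x) ≤ (S.filter (fun z => b z = b x)).card + 1 := fun hc => hn ⟨hb, hc⟩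
      refine insert_ind M b cap h (insert x S) (insert x S) y ?_ (Finset.Subset.refl _) hx
      rw [← hb, filter_insert, if_pos rfl, card_insert_of_notMem]
      · omega
      · simp [hxS]
    · refine insert_ind M b cap h (insert x S) (insert x S) y ?_ (Finset.Subset.refl _) hx
      rw [filter_insert, if_neg hb]
      have := (h _).1 hy (b y)
      rw [filter_insert, if_pos rfl, card_insert_of_notMem] at this
      · omega
      · simp [hyS]

lemma link_gap (M₁ M₂ : FinMatroid E) (b₁ b₂ : E → ℕ) (cap₁ cap₂ : ℕ → ℕ)
    (h₁ : IsPartitionWith M₁ b₁ cap₁) (h₂ : IsPartitionWith M₂ b₂ cap₂)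
    (hnd : ∀ x y : E, x ≠ y → b₁ x = b₁ y → b₂ x ≠ b₂ y)
    (T : Finset E) (hT : T ∈ M₁.ind ∩ M₂.ind) (k : ℕ) (hk : 3 * k ≤ T.card) (n : ℕ) :
    ∀ S : Finset E, S.card + n + 2 = k →
      LGap (fun x y => upG (indK (M₁.ind ∩ M₂.ind) k) n (insert y (insert x S)))
        (1 / ((S.card : ℝ) + 2)) := by
  have hX : ∀ S ∈ M₁.ind ∩ M₂.ind, ∀ T ⊆ S, T ∈ M₁.ind ∩ M₂.ind := by
    intro S hS T hTS
    rw [mem_inter] at hS ⊢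
    exact ⟨M₁.subset_mem S hS.1 T hTS, M₂.subset_mem S hS.2 T hTS⟩
  have hecount := ext_count M₁ M₂ b₁ b₂ cap₁ cap₂ h₁ h₂ T hT
  have hext : ∀ S ∈ M₁.ind ∩ M₂.ind, S.card < k → ∃ x, x ∉ S ∧ insert x S ∈ M₁.ind ∩ M₂.ind := by
    intro S hS hc
    obtain ⟨Z, hZ, hz⟩ := hecount S
    have : 0 < Z.card := by omega
    obtain ⟨z, hzZ⟩ := card_pos.1 this
    exact ⟨z, (hz z hzZ).1, (hz z hzZ).2 S (Finset.Subset.refl _) hS⟩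
  have hIX : ∀ S, S ∈ M₁.ind ∩ M₂.ind ↔ S ∈ M₁.ind ∧ S ∈ M₂.ind := fun S => mem_inter
  generalize hXd : M₁.ind ∩ M₂.ind = X at *
  have hsupp := indK_supp X k
  have hwn := fun n S => upG_nonneg (indK X k) (indK_nonneg X k) n S
  induction n with
  | zero =>
    intro S hS
    have hSk : ((S.card : ℝ) + 2) = k := by rw [← hS]; push_cast; ring
    rw [hSk]
    change LGap (fun x y => indK X k (insert y (insert x S))) (1 / (k : ℝ))
    have hcard : ∀ x, x ∈ S → (insert x S).card = S.card := fun x hx => by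
      rw [insert_eq_of_mem hx]
    refine top_gap _ (fun x y => indK_nonneg X k _) (fun x y => by simp only [Finset.insert_comm])
      (univ.filter fun x => x ∉ S ∧ insert x S ∈ X) ?_ k (by exact_mod_cast (by omega : 1 ≤ k)) ?_ ?_
    · intro x y hx
      simp only [mem_filter, mem_univ, true_and, not_and] at hx
      by_cases hxS : x ∈ S
      · apply hsupp
        rw [insert_eq_of_mem hxS]
        have := card_insert_le y S
        omega
      · have hxX := hx hxS
        simp only [indK]
        rw [if_neg]
        rintro ⟨h, _⟩
        exact hxX (hX _ h _ (subset_insert _ _))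
    · intro x hx
      simp only [mem_filter, mem_univ, true_and] at hx
      obtain ⟨Z, hZ, hz⟩ := hecount (insert x S)
      rw [card_insert_of_notMem hx.1] at hZ
      have hkZ : k ≤ Z.card := by omega
      have h3 : ∑ y ∈ Z, indK X k (insert y (insert x S)) = Z.card := by
        rw [sum_congr rfl (g := fun _ => (1 : ℝ)), sum_const]
        · simp
        · intro y hy
          simp only [indK]
          rw [if_pos]
          refine ⟨(hz y hy).2 _ (Finset.Subset.refl _) hx.2, ?_⟩
          rw [card_insert_of_notMem (hz y hy).1, card_insert_of_notMem hx.1]; omega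
      calc (k : ℝ) ≤ Z.card := by exact_mod_cast hkZ
        _ = _ := h3.symm
        _ ≤ _ := sum_le_sum_of_subset_of_nonneg (subset_univ _) fun y _ _ => indK_nonneg X k _
    · intro g
      set U := univ.filter fun x => x ∉ S ∧ insert x S ∈ X with hU
      set t₁ : ℕ → Prop := fun i => cap₁ i ≤ (S.filter (fun z => b₁ z = i)).card + 1 with ht₁
      set t₂ : ℕ → Prop := fun i => cap₂ i ≤ (S.filter (fun z => b₂ z = i)).card + 1 with ht₂
      have hpt : ∀ x ∈ U, ∀ y ∈ U, indK X k (insert y (insert x S)) * (g x * g y) =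
          g x * g y - (if b₁ x = b₁ y ∧ t₁ (b₁ x) then (1 : ℝ) else 0) * (g x * g y)
          - (if b₂ x = b₂ y ∧ t₂ (b₂ x) then (1 : ℝ) else 0) * (g x * g y)
          + (if x = y then ((if t₁ (b₁ x) then (1 : ℝ) else 0) + (if t₂ (b₂ x) then (1 : ℝ) else 0)
            - 1) * g x ^ 2 else 0) := by
        intro x hx y hy
        simp only [hU, mem_filter, mem_univ, true_and] at hx hy
        by_cases hxy : x = y
        · subst hxy
          have : indK X k (insert x (insert x S)) = 0 := by
            apply hsupp
            rw [insert_eq_of_mem (mem_insert_self _ _), card_insert_of_notMem hx.1]; omega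
          rw [this]
          simp only [true_and, if_true]
          ring
        · rw [if_neg hxy]
          have hm : insert y (insert x S) ∈ X ↔ ¬ (b₁ x = b₁ y ∧ t₁ (b₁ x)) ∧
              ¬ (b₂ x = b₂ y ∧ t₂ (b₂ x)) := by
            rw [hIX, pair_ind M₁ b₁ cap₁ h₁ S x y hxy hx.1 hy.1 ((hIX _).1 hx.2).1 ((hIX _).1 hy.2).1,
              pair_ind M₂ b₂ cap₂ h₂ S x y hxy hx.1 hy.1 ((hIX _).1 hx.2).2 ((hIX _).1 hy.2).2]
          have hc : (insert y (insert x S)).card = k := by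
            rw [card_insert_of_notMem, card_insert_of_notMem hx.1]
            · omega
            · simp [Ne.symm hxy, hy.1]
          have hno : ¬ ((b₁ x = b₁ y ∧ t₁ (b₁ x)) ∧ (b₂ x = b₂ y ∧ t₂ (b₂ x))) :=
            fun h => hnd x y hxy h.1.1 h.2.1
          simp only [indK, hc, and_true, hm]
          by_cases p : b₁ x = b₁ y ∧ t₁ (b₁ x)
          · have q : ¬ (b₂ x = b₂ y ∧ t₂ (b₂ x)) := fun q => hno ⟨p, q⟩
            rw [if_pos p, if_neg q, if_neg (fun h => h.1 p)]; ring
          · by_cases q : b₂ x = b₂ y ∧ t₂ (b₂ x)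
            · rw [if_neg p, if_pos q, if_neg (fun h => h.2 q)]; ring
            · rw [if_neg p, if_neg q, if_pos ⟨p, q⟩]; ring
      rw [sum_congr rfl fun x hx => sum_congr rfl fun y hy => hpt x hx y hy]
      simp only [sum_add_distrib, sum_sub_distrib]
      have p1 := block_psd U b₁ t₁ g
      have p2 := block_psd U b₂ t₂ g
      have p3 : ∑ x ∈ U, ∑ y ∈ U, g x * g y = (∑ x ∈ U, g x) ^ 2 := by
        rw [sq, sum_mul_sum]
      have p4 : ∑ x ∈ U, ∑ y ∈ U, (if x = y then ((if t₁ (b₁ x) then (1 : ℝ) else 0) +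
          (if t₂ (b₂ x) then (1 : ℝ) else 0) - 1) * g x ^ 2 else 0) ≤ ∑ x ∈ U, g x ^ 2 := by
        refine sum_le_sum fun x hx => ?_
        rw [sum_ite_eq, if_pos hx]
        have := sq_nonneg (g x)
        split_ifs <;> nlinarith
      linarith
  | succ n ih =>
    intro S hS
    have hc0 : (0 : ℝ) ≤ S.card := Nat.cast_nonneg _
    have hγ : 1 / ((S.card : ℝ) + 2) =
        (1 / ((S.card : ℝ) + 3)) / (1 - 1 / ((S.card : ℝ) + 3)) := by
      have : (1 : ℝ) - 1 / ((S.card : ℝ) + 3) = (S.card + 2) / (S.card + 3) := by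
        field_simp; ring
      rw [this]; field_simp
    rw [hγ]
    refine trickle_s13 _ (fun x y z => upG (indK X k) n (insert z (insert y (insert x S)))) _
      (by positivity) ?_ (fun x y z => hwn _ _) ?_ ?_ ?_ ?_ ?_
    · rw [div_lt_one (by positivity)]; linarith
    · intro x y z; simp only [Finset.insert_comm x y]
    · intro x y z; simp only [Finset.insert_comm y z]
    · intro x y
      refine upG_sum (indK X k) k hsupp n _ ?_
      have := card_insert_le y (insert x S)
      have := card_insert_le x S
      omega
    · intro x
      by_cases hx : x ∈ S
      · have hz : ∀ y z, upG (indK X k) n (insert z (insert y (insert x S))) = 0 := by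
          intro y z
          apply upG_supp _ k hsupp
          rw [insert_eq_of_mem hx]
          have := card_insert_le y S
          have := card_insert_le z (insert y S)
          omega
        intro g _
        simp [hz]
      · have hcx := card_insert_of_notMem hx
        have := ih (insert x S) (by omega)
        rw [hcx] at this
        have e : (((S.card + 1 : ℕ) : ℝ) + 2) = S.card + 3 := by push_cast; ring
        rwa [e] at this
    · intro x y hx hy
      have hsum : ∀ x, ∑ z, upG (indK X k) (n + 1) (insert z (insert x S)) =
          upG (indK X k) (n + 2) (insert x S) := fun x => by
        symm
        refine upG_sum (indK X k) k hsupp (n + 1) _ ?_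
        have := card_insert_le x S
        omega
      rw [hsum] at hx hy
      have hf : ∀ x, upG (indK X k) (n + 2) (insert x S) ≠ 0 → x ∉ S ∧ insert x S ∈ X := by
        intro x hx
        refine ⟨fun hxS => hx ?_, w_mem X hX k _ _ hx⟩
        apply upG_supp _ k hsupp
        rw [insert_eq_of_mem hxS]
        omega
      obtain ⟨hxS, hxX⟩ := hf x hx
      obtain ⟨hyS, hyX⟩ := hf y hy
      obtain ⟨Z, hZ, hz⟩ := hecount (insert x (insert y S))
      have c1 := card_insert_le x (insert y S)
      have c2 := card_insert_le y S
      obtain ⟨z, hzZ⟩ := card_pos.1 (by omega : 0 < Z.card)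
      obtain ⟨hzC, hzB⟩ := hz z hzZ
      simp only [mem_insert, not_or] at hzC
      refine ⟨z, ?_, ?_⟩
      · refine (w_ne X k hext (n + 1) _ (hzB (insert x S) ?_ hxX) ?_).ne'
        · exact insert_subset_insert _ (subset_insert _ _)
        · rw [card_insert_of_notMem, card_insert_of_notMem hxS]
          · omega
          · simp [hzC.1, hzC.2.2]
      · simp only [Finset.insert_comm y z]
        refine (w_ne X k hext (n + 1) _ (hzB (insert y S) ?_ hyX) ?_).ne'
        · exact subset_insert _ _
        · rw [card_insert_of_notMem, card_insert_of_notMem hyS]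
          · omega
          · simp [hzC.2.1, hzC.2.2]

lemma energy_step (X : Finset (Finset E)) (k : ℕ) (F : Finset E → ℝ)
    (hF : ∀ S, indK X k S = 0 → F S = 0) (j n : ℕ) (hj : j + n + 2 = k)
    (hgap : ∀ S : Finset E, S.card + n + 2 = k →
      LGap (fun x y => upG (indK X k) n (insert y (insert x S))) (1 / ((S.card : ℝ) + 2))) :
    2 * (lvl (j + 1) (enH (indK X k) F (n + 1)) - lvl j (enH (indK X k) F (n + 2))) ≤
      (1 + 1 / ((j : ℝ) + 2)) *
        (lvl (j + 2) (enH (indK X k) F n) - lvl j (enH (indK X k) F (n + 2))) := by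
  set w := indK X k with hw
  have hsupp : ∀ S, S.card ≠ k → w S = 0 := indK_supp X k
  have hFs : ∀ S, S.card ≠ k → F S = 0 := fun S h => hF S (hsupp S h)
  have hwn := fun n S => upG_nonneg w (indK_nonneg X k) n S
  have hwF : ∀ n S, upG w n S * (upG F n S / upG w n S) = upG F n S := by
    intro n S
    by_cases h : upG w n S = 0
    · rw [h, upG_abs_cont w F (indK_nonneg X k) hF n S h]; simp
    · field_simp
  have hen : ∀ n S, S.card + n ≠ k → enH w F n S = 0 := by
    intro n S h
    simp [enH, upG_supp w k hsupp n S h]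
  have e1 : lvl (j + 1) (enH w F (n + 1)) = lvl j (fun S => ∑ x, enH w F (n + 1) (insert x S)) :=
    (lvl_succ' j _ fun T hT => hen _ _ (by omega)).symm
  have e2 : lvl (j + 2) (enH w F n) =
      lvl j (fun S => ∑ x, ∑ y, enH w F n (insert y (insert x S))) := by
    rw [lvl_succ' j (fun T => ∑ y, enH w F n (insert y T)), lvl_succ' (j + 1)]
    · intro T hT; exact hen _ _ (by omega)
    · intro T hT
      refine sum_eq_zero fun y _ => hen _ _ ?_
      have := card_insert_le y T
      omega
  rw [e1, e2]
  unfold lvl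
  have key : ∀ S ∈ powersetCard j (univ : Finset E),
      2 * (∑ x, enH w F (n + 1) (insert x S) - enH w F (n + 2) S) ≤
      (1 + 1 / ((j : ℝ) + 2)) *
        (∑ x, ∑ y, enH w F n (insert y (insert x S)) - enH w F (n + 2) S) := by
    intro S hS
    have hSc := (mem_powersetCard.1 hS).2
    have hm : ∀ G : Finset E → ℝ, (∀ S, S.card ≠ k → G S = 0) → ∀ x,
        ∑ y, upG G n (insert y (insert x S)) = upG G (n + 1) (insert x S) := by
      intro G hG x
      symm
      refine upG_sum G k hG n _ ?_
      have := card_insert_le x S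
      omega
    have hM : ∀ G : Finset E → ℝ, (∀ S, S.card ≠ k → G S = 0) →
        ∑ x, upG G (n + 1) (insert x S) = upG G (n + 2) S := by
      intro G hG
      exact (upG_sum G k hG (n + 1) _ (by omega)).symm
    have hg := hgap S (by omega)
    rw [hSc] at hg
    have := local_var (fun x y => upG w n (insert y (insert x S))) _ (by positivity)
      (fun x y => hwn _ _) (fun x y => by simp only [Finset.insert_comm]) hg
      (fun x y => upG F n (insert y (insert x S)) / upG w n (insert y (insert x S)))
      (fun x y => by simp only [Finset.insert_comm])
      (fun x => upG F (n + 1) (insert x S) / upG w (n + 1) (insert x S)) ?_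
      (upG F (n + 2) S / upG w (n + 2) S) ?_
    · simp only [hm w hsupp, hM w hsupp] at this
      exact this
    · intro x
      simp only [hm w hsupp, hwF, hm F hFs]
    · simp only [hm w hsupp, hM w hsupp, hwF, hM F hFs]
  have hsum := sum_le_sum key
  simp only [← mul_sum, sum_sub_distrib] at hsum
  have hpos : (0 : ℝ) ≤ (j.factorial : ℝ) := Nat.cast_nonneg _
  have := mul_le_mul_of_nonneg_left hsum hpos
  nlinarith

lemma energy_final (V : ℕ → ℝ) (k : ℕ) (hk : 1 ≤ k) (h0 : V 0 = 0)
    (hstep : ∀ j, j + 2 ≤ k → 2 * (V (j + 1) - V j) ≤ (1 + 1 / ((j : ℝ) + 2)) * (V (j + 2) - V j)) :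
    V k ≤ (k : ℝ) ^ 2 * (V k - V (k - 1)) := by
  obtain ⟨q, rfl⟩ : ∃ q, k = q + 1 := ⟨k - 1, by omega⟩
  have : ∀ j, j + 1 ≤ q + 1 → V (j + 1) ≤ ((j : ℝ) + 1) ^ 2 * (V (j + 1) - V j) := by
    intro j
    induction j with
    | zero => intro _; simp [h0]
    | succ j ih =>
      intro hj
      have h1 := ih (by omega)
      have h2 := hstep j (by omega)
      have hj0 : (0 : ℝ) ≤ j := Nat.cast_nonneg _
      have e : (1 + 1 / ((j : ℝ) + 2)) = (j + 3) / (j + 2) := by field_simp; ring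
      rw [e, div_mul_eq_mul_div, le_div_iff₀ (by positivity)] at h2
      push_cast
      have h3 : ((j : ℝ) + 1) * (V (j + 1) - V j) ≤ (j + 3) * (V (j + 2) - V (j + 1)) := by
        linarith
      have h4 := mul_le_mul_of_nonneg_left h3 (by positivity : (0 : ℝ) ≤ j + 1)
      change V (j + 2) ≤ _ * (V (j + 2) - V (j + 1))
      nlinarith
  have := this q (by omega)
  simpa using this

/-- **Theorem (sampling common independent sets of two partition matroids).**
Let `M₁` and `M₂` be two partition matroids on `E` (with block functions `b₁, b₂`
and capacities `cap₁, cap₂`) that have a common independent set of size `r` and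
share no double block (no two distinct elements lie in the same block of `M₁` and
also in the same block of `M₂`), and let `k ≥ 1`.  If `k ≤ r/3`, then the
`(k-1)`-th down-up walk on size-`k` common independent sets satisfies
`λ₂(P∨_{k-1}) ≤ 1 - 1/k²`. -/
theorem miLam2_le (M₁ M₂ : FinMatroid E) (b₁ b₂ : E → ℕ) (cap₁ cap₂ : ℕ → ℕ)
    (h₁ : IsPartitionWith M₁ b₁ cap₁) (h₂ : IsPartitionWith M₂ b₂ cap₂)
    (hnd : ∀ x y : E, x ≠ y → b₁ x = b₁ y → b₂ x ≠ b₂ y)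
    (r : ℕ) (hr : ∃ T ∈ M₁.ind ∩ M₂.ind, T.card = r)
    (k : ℕ) (hk : 1 ≤ k) (hkr : (k : ℝ) ≤ (r : ℝ) / 3) :
    miLam2 M₁ M₂ k ≤ 1 - 1 / (k : ℝ) ^ 2 := by
  obtain ⟨T, hT, hTr⟩ := hr
  have hk3 : 3 * k ≤ T.card := by
    rw [hTr]
    have : (3 * k : ℝ) ≤ r := by linarith
    exact_mod_cast this
  have hk1 : (1 : ℝ) ≤ k := by exact_mod_cast hk
  have hnn : (0 : ℝ) ≤ 1 - 1 / (k : ℝ) ^ 2 := by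
    rw [sub_nonneg, div_le_one (by positivity)]
    nlinarith
  refine Real.sSup_le ?_ hnn
  rintro ρ ⟨f, hf0, hfne, rfl⟩
  have hgap := link_gap M₁ M₂ b₁ b₂ cap₁ cap₂ h₁ h₂ hnd T hT k hk3
  set X := M₁.ind ∩ M₂.ind with hX
  have hXk : commonK M₁ M₂ k = (powersetCard k (univ : Finset E)).filter (· ∈ X) := by
    ext S; simp [commonK, hX, mem_powersetCard, and_comm]
  set F : Finset E → ℝ := fun S => indK X k S * f S with hFd
  have hF : ∀ S, indK X k S = 0 → F S = 0 := fun S h => by simp [hFd, h]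
  have hsumk : ∀ H : Finset E → ℝ, ∑ S ∈ commonK M₁ M₂ k, H S =
      ∑ S ∈ powersetCard k (univ : Finset E), indK X k S * H S := by
    intro H
    rw [hXk, sum_filter]
    refine sum_congr rfl fun S hS => ?_
    simp [indK, (mem_powersetCard.1 hS).2]
  set V : ℕ → ℝ := fun j => lvl j (enH (indK X k) F (k - j)) with hV
  have hVfin := energy_final V k hk ?_ ?_
  · -- assemble
    have hVk : V k = (k.factorial : ℝ) * ∑ S ∈ commonK M₁ M₂ k, f S ^ 2 := by
      simp only [hV, lvl, hsumk, Nat.sub_self]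
      congr 1
      refine sum_congr rfl fun S _ => ?_
      simp only [enH, upG, hFd, indK]
      split_ifs <;> simp
    obtain ⟨q, rfl⟩ : ∃ q, k = q + 1 := ⟨k - 1, by omega⟩
    have hup : ∀ (H : Finset E → ℝ) (R : Finset E), R.card = q →
        upG (fun S => indK X (q + 1) S * H S) 1 R =
          ∑ T ∈ commonK M₁ M₂ (q + 1), if R ⊆ T then H T else 0 := by
      intro H R hR
      change ∑ x ∈ Rᶜ, indK X (q + 1) (insert x R) * H (insert x R) = _
      rw [← sum_filter]
      have : ∑ x ∈ Rᶜ, indK X (q + 1) (insert x R) * H (insert x R) =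
          ∑ x ∈ Rᶜ.filter (fun x => insert x R ∈ X), H (insert x R) := by
        rw [sum_filter]
        refine sum_congr rfl fun x hx => ?_
        simp [indK, card_insert_of_notMem (mem_compl.1 hx), hR]
      rw [this]
      refine sum_bij (fun x _ => insert x R) ?_ ?_ ?_ ?_
      · intro x hx
        simp only [mem_filter, mem_compl] at hx
        simp only [hXk, mem_filter, mem_powersetCard, subset_univ, true_and]
        exact ⟨⟨by rw [card_insert_of_notMem hx.1, hR], hx.2⟩, subset_insert _ _⟩
      · intro x hx y hy hxy
        simp only [mem_filter, mem_compl] at hx hy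
        have : x ∈ insert y R := hxy ▸ mem_insert_self x R
        exact (mem_insert.1 this).resolve_right hx.1
      · intro T hT
        simp only [hXk, mem_filter, mem_powersetCard, subset_univ, true_and] at hT
        obtain ⟨⟨hTc, hTX⟩, hRT⟩ := hT
        have : (T \ R).card = 1 := by rw [card_sdiff_of_subset hRT, hTc, hR]; omega
        obtain ⟨x, hx⟩ := card_eq_one.1 this
        have hxm : x ∈ T \ R := by rw [hx]; exact mem_singleton_self x
        have hT' : insert x R = T := by
          rw [insert_eq, ← hx, sdiff_union_of_subset hRT]
        refine ⟨x, ?_, hT'⟩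
        simp only [mem_filter, mem_compl]
        exact ⟨(mem_sdiff.1 hxm).2, by rw [hT']; exact hTX⟩
      · intro x _; rfl
    have hw1 : ∀ R : Finset E, R.card = q → upG (indK X (q + 1)) 1 R =
        (((commonK M₁ M₂ (q + 1)).filter (fun T' => R ⊆ T')).card : ℝ) := by
      intro R hR
      have := hup (fun _ => 1) R hR
      simp only [mul_one] at this
      rw [← sum_filter, sum_const] at this
      simpa using this
    have hnum : ((q + 1 : ℕ) : ℝ) * (∑ S ∈ commonK M₁ M₂ (q + 1), f S *
        ∑ T ∈ commonK M₁ M₂ (q + 1), miP M₁ M₂ (q + 1) S T * f T) =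
        ∑ R ∈ powersetCard q (univ : Finset E), enH (indK X (q + 1)) F 1 R := by
      have e1 : ∀ R ∈ powersetCard q (univ : Finset E), enH (indK X (q + 1)) F 1 R =
          ∑ x ∈ Rᶜ, F (insert x R) * (upG F 1 R / upG (indK X (q + 1)) 1 R) := by
        intro R _
        rw [← sum_mul]
        change _ = upG F 1 R * _
        simp only [enH]
        by_cases h : upG (indK X (q + 1)) 1 R = 0
        · rw [h, upG_abs_cont _ F (indK_nonneg X (q + 1)) hF 1 R h]; simp
        · field_simp
      rw [sum_congr rfl e1, sum_erase_insert q
        (fun R T => F T * (upG F 1 R / upG (indK X (q + 1)) 1 R)), hsumk, mul_sum]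
      refine sum_congr rfl fun S hS => ?_
      have hSc := (mem_powersetCard.1 hS).2
      rw [← mul_sum]
      simp only [hFd]
      have hkey : ((q + 1 : ℕ) : ℝ) * ∑ T ∈ commonK M₁ M₂ (q + 1), miP M₁ M₂ (q + 1) S T * f T =
          ∑ x ∈ S, upG F 1 (S.erase x) / upG (indK X (q + 1)) 1 (S.erase x) := by
        have hq : ((q + 1 : ℕ) : ℝ) ≠ 0 := by positivity
        rw [mul_sum]
        have e2 : ∀ T, ((q + 1 : ℕ) : ℝ) * (miP M₁ M₂ (q + 1) S T * f T) =
            ∑ x ∈ S, (if S.erase x ⊆ T then f T else 0) *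
              (1 / (((commonK M₁ M₂ (q + 1)).filter (fun T' => S.erase x ⊆ T')).card : ℝ)) := by
          intro T
          simp only [miP]
          rw [← mul_assoc, ← mul_assoc, mul_one_div_cancel hq, one_mul, sum_mul]
          refine sum_congr rfl fun x _ => ?_
          split_ifs <;> ring
        rw [sum_congr rfl fun T _ => e2 T, sum_comm]
        refine sum_congr rfl fun x hx => ?_
        have hce : (S.erase x).card = q := by rw [card_erase_of_mem hx, hSc]; rfl
        rw [← sum_mul, hw1 _ hce, hup f _ hce, mul_one_div]
      rw [← hkey]; ring
    have hVk1 : V q = (q.factorial : ℝ) * (((q + 1 : ℕ) : ℝ) * (∑ S ∈ commonK M₁ M₂ (q + 1), f S *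
        ∑ T ∈ commonK M₁ M₂ (q + 1), miP M₁ M₂ (q + 1) S T * f T)) := by
      rw [hnum]
      simp only [hV, lvl, show q + 1 - q = 1 by omega]
    set Nf := ∑ S ∈ commonK M₁ M₂ (q + 1), f S ^ 2 with hNf
    set Q := ∑ S ∈ commonK M₁ M₂ (q + 1), f S *
        ∑ T ∈ commonK M₁ M₂ (q + 1), miP M₁ M₂ (q + 1) S T * f T with hQ
    have hNpos : 0 < Nf := lt_of_le_of_ne (sum_nonneg fun S _ => sq_nonneg _) (Ne.symm hfne)
    have hVk1' : V q = ((q + 1).factorial : ℝ) * Q := by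
      rw [hVk1, Nat.factorial_succ]; push_cast; ring
    rw [Nat.add_sub_cancel, hVk, hVk1'] at hVfin
    have hfac : (0 : ℝ) < ((q + 1).factorial : ℝ) := by exact_mod_cast Nat.factorial_pos _
    have hfin : Nf ≤ ((q + 1 : ℕ) : ℝ) ^ 2 * (Nf - Q) := by
      refine le_of_mul_le_mul_left ?_ hfac
      linarith
    rw [div_le_iff₀ hNpos, sub_mul, one_mul, div_mul_eq_mul_div, one_mul, le_sub_comm,
      div_le_iff₀ (by positivity)]
    linarith
  · -- V 0 = 0
    have hz : upG F k ∅ = 0 := by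
      have := lvl_upG F k 0
      simp only [lvl, powersetCard_zero, sum_singleton, Nat.factorial_zero, Nat.cast_one, one_mul,
        zero_add] at this
      rw [this, ← hsumk, hf0, mul_zero]
    simp [hV, lvl, enH, hz]
  · intro j hj
    have h := energy_step X k F hF j (k - j - 2) (by omega) (hgap (k - j - 2))
    have a1 : k - j - 2 + 1 = k - (j + 1) := by omega
    have a2 : k - j - 2 + 2 = k - j := by omega
    have a3 : k - j - 2 = k - (j + 2) := by omega
    rw [a1, a2, a3] at h
    exact h
end
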